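/- Let ψ satisfy hypotheses (i)–(iv) below on the domain Q. Then for every y ∈ [0, f(0)), the second-order partial derivatives of ψ extend continuously up to the boundary portion {x = 0} near (0,y) and satisfy ψ_{xx}(0,y) = 1/a and ψ_{xy}(0,y) = ψ_{yy}(0,y) = 0; equivalently, ψ_{xx}(x',y') → 1/a, ψ_{xy}(x',y') → 0 and ψ_{yy}(x',y') → 0 as (x',y') → (0,y) within Q, for every 0 ≤ y < f(0). -/

import Mathlib

open Set Filter

/-- First partial derivative in the `x`-direction. -/
noncomputable def pd1 (ψ : ℝ × ℝ → ℝ) (p : ℝ × ℝ) : ℝ :=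
  deriv (fun x => ψ (x, p.2)) p.1

/-- First partial derivative in the `y`-direction. -/
noncomputable def pd2 (ψ : ℝ × ℝ → ℝ) (p : ℝ × ℝ) : ℝ :=
  deriv (fun y => ψ (p.1, y)) p.2

/-- The domain `Q = {(x,y) : 0 < x < ε₀, 0 < y < f(x)}`. -/
def Qset (ε₀ : ℝ) (f : ℝ → ℝ) : Set (ℝ × ℝ) :=
  {p | 0 < p.1 ∧ p.1 < ε₀ ∧ 0 < p.2 ∧ p.2 < f p.1}

/-- The part of the closure of `Q` with `x > 0`, on which the `Oᵢ` are `C¹`. -/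
def Dset (ε₀ : ℝ) (f : ℝ → ℝ) : Set (ℝ × ℝ) :=
  closure (Qset ε₀ f) ∩ {p | 0 < p.1}

/-- The upper boundary `{(x, f(x)) : 0 ≤ x ≤ ε₀}`. -/
def Gamf (ε₀ : ℝ) (f : ℝ → ℝ) : Set (ℝ × ℝ) :=
  (fun x => (x, f x)) '' Set.Icc 0 ε₀

section
noncomputable def linF (a b : ℝ) : ℝ × ℝ →L[ℝ] ℝ :=
  a • ContinuousLinearMap.fst ℝ ℝ ℝ + b • ContinuousLinearMap.snd ℝ ℝ ℝ

@[simp] lemma linF_apply (a b : ℝ) (p : ℝ × ℝ) : linF a b p = a * p.1 + b * p.2 := by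
  simp [linF]

lemma linF_ext {L : ℝ × ℝ →L[ℝ] ℝ} {a b : ℝ} (h1 : L (1,0) = a) (h2 : L (0,1) = b) :
    L = linF a b := by
  ext <;> simp [h1, h2]

/-- C² data on a set. -/
structure C2on (U : Set (ℝ × ℝ)) (u ux uy uxx uxy uyy : ℝ × ℝ → ℝ) : Prop where
  d0 : ∀ p ∈ U, HasFDerivAt u (linF (ux p) (uy p)) p
  d1 : ∀ p ∈ U, HasFDerivAt ux (linF (uxx p) (uxy p)) p
  d2 : ∀ p ∈ U, HasFDerivAt uy (linF (uxy p) (uyy p)) p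
  cxx : ContinuousOn uxx U
  cxy : ContinuousOn uxy U
  cyy : ContinuousOn uyy U

lemma linF_dx {u : ℝ × ℝ → ℝ} {a b x y : ℝ} (h : HasFDerivAt u (linF a b) (x, y)) :
    HasDerivAt (fun s => u (s, y)) a x := by
  have h2 : HasDerivAt (fun s : ℝ => ((s, y) : ℝ × ℝ)) (1, 0) x :=
    (hasDerivAt_id x).prodMk (hasDerivAt_const x y)
  refine HasDerivAt.congr_deriv (HasFDerivAt.comp_hasDerivAt (l := u) x h h2) ?_
  simp

lemma linF_dy {u : ℝ × ℝ → ℝ} {a b x y : ℝ} (h : HasFDerivAt u (linF a b) (x, y)) :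
    HasDerivAt (fun s => u (x, s)) b y := by
  have h2 : HasDerivAt (fun s : ℝ => ((x, s) : ℝ × ℝ)) (0, 1) y :=
    (hasDerivAt_const y x).prodMk (hasDerivAt_id y)
  refine HasDerivAt.congr_deriv (HasFDerivAt.comp_hasDerivAt (l := u) y h h2) ?_
  simp

lemma linF_mul {u v : ℝ × ℝ → ℝ} {a b c d : ℝ} {p : ℝ × ℝ}
    (hu : HasFDerivAt u (linF a b) p) (hv : HasFDerivAt v (linF c d) p) :
    HasFDerivAt (fun q => u q * v q) (linF (u p * c + a * v p) (u p * d + b * v p)) p := by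
  refine (hu.mul hv).congr_fderiv ?_
  ext <;> simp <;> ring

lemma linF_add {u v : ℝ × ℝ → ℝ} {a b c d : ℝ} {p : ℝ × ℝ}
    (hu : HasFDerivAt u (linF a b) p) (hv : HasFDerivAt v (linF c d) p) :
    HasFDerivAt (fun q => u q + v q) (linF (a + c) (b + d)) p := by
  refine (hu.add hv).congr_fderiv ?_
  ext <;> simp

lemma linF_sub {u v : ℝ × ℝ → ℝ} {a b c d : ℝ} {p : ℝ × ℝ}
    (hu : HasFDerivAt u (linF a b) p) (hv : HasFDerivAt v (linF c d) p) :
    HasFDerivAt (fun q => u q - v q) (linF (a - c) (b - d)) p := by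
  refine (hu.sub hv).congr_fderiv ?_
  ext <;> simp

lemma linF_comp {u : ℝ × ℝ → ℝ} {k : ℝ → ℝ} {a b k' : ℝ} {p : ℝ × ℝ}
    (hk : HasDerivAt k k' (u p)) (hu : HasFDerivAt u (linF a b) p) :
    HasFDerivAt (fun q => k (u q)) (linF (k' * a) (k' * b)) p := by
  refine (hk.comp_hasFDerivAt p hu).congr_fderiv ?_
  ext <;> simp

lemma linF_fst (p : ℝ × ℝ) : HasFDerivAt (fun q : ℝ × ℝ => q.1) (linF 1 0) p := by
  refine (hasFDerivAt_fst).congr_fderiv ?_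
  ext <;> simp

lemma linF_snd (p : ℝ × ℝ) : HasFDerivAt (fun q : ℝ × ℝ => q.2) (linF 0 1) p := by
  refine (hasFDerivAt_snd).congr_fderiv ?_
  ext <;> simp

lemma linF_const (c : ℝ) (p : ℝ × ℝ) : HasFDerivAt (fun _ : ℝ × ℝ => c) (linF 0 0) p := by
  refine (hasFDerivAt_const c p).congr_fderiv ?_
  ext <;> simp

lemma linF_congr {u v : ℝ × ℝ → ℝ} {a b c d : ℝ} {p : ℝ × ℝ}
    (hu : HasFDerivAt u (linF a b) p) (h : ∀ q, v q = u q) (h1 : c = a) (h2 : d = b) :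
    HasFDerivAt v (linF c d) p := by
  have : v = u := funext h
  rw [this, h1, h2]; exact hu

/-- composition with affine maps -/
lemma linF_aff {u : ℝ × ℝ → ℝ} {a b x0 y0 m11 m12 m21 m22 : ℝ} {p : ℝ × ℝ}
    (hu : HasFDerivAt u (linF a b)
      (x0 + (m11 * p.1 + m12 * p.2), y0 + (m21 * p.1 + m22 * p.2))) :
    HasFDerivAt (fun q : ℝ × ℝ => u (x0 + (m11 * q.1 + m12 * q.2), y0 + (m21 * q.1 + m22 * q.2)))
      (linF (a * m11 + b * m21) (a * m12 + b * m22)) p := by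
  have h : HasFDerivAt (fun q : ℝ × ℝ =>
      (x0 + (m11 * q.1 + m12 * q.2), y0 + (m21 * q.1 + m22 * q.2)))
      ((linF m11 m12).prod (linF m21 m22)) p := by
    refine HasFDerivAt.prodMk ?_ ?_
    · have := (linF m11 m12).hasFDerivAt (x := p)
      have := this.const_add x0
      simpa using this
    · have := (linF m21 m22).hasFDerivAt (x := p)
      have := this.const_add y0
      simpa using this
  refine (HasFDerivAt.comp p (g := u) hu h).congr_fderiv ?_
  ext <;> simp

section kernel

noncomputable def kk (R q : ℝ) : ℝ := if q ≤ R then 6 / R^2 - 8 * q / R^3 + 3 * q^2 / R^4 else 1 / q^2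
noncomputable def kk1 (R q : ℝ) : ℝ := if q ≤ R then - 8 / R^3 + 6 * q / R^4 else - 2 / q^3
noncomputable def kk2 (R q : ℝ) : ℝ := 6 / (max q R)^4

lemma glue_deriv {f g : ℝ → ℝ} {R a q : ℝ} {b : ℝ}
    (hf : q ≤ R → HasDerivAt f a q) (hg : R ≤ q → HasDerivAt g b q) (hR : f R = g R)
    (hab : q = R → a = b) :
    HasDerivAt (fun x => if x ≤ R then f x else g x) (if q ≤ R then a else b) q := by
  rcases lt_trichotomy q R with h | h | h
  · rw [if_pos h.le]
    refine (hf h.le).congr_of_eventuallyEq ?_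
    filter_upwards [Iio_mem_nhds h] with x hx
    rw [if_pos (le_of_lt hx)]
  · subst h
    rw [if_pos le_rfl]
    have h1 : HasDerivWithinAt (fun x => if x ≤ q then f x else g x) a (Iic q) q := by
      refine (hf le_rfl).hasDerivWithinAt.congr (fun x hx => if_pos hx) (if_pos le_rfl)
    have h2 : HasDerivWithinAt (fun x => if x ≤ q then f x else g x) a (Ici q) q := by
      rw [hab rfl]
      refine (hg le_rfl).hasDerivWithinAt.congr (fun x hx => ?_) (by rw [if_pos le_rfl, hR])
      by_cases hxq : x ≤ q
      · have : x = q := le_antisymm hxq hx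
        rw [this, if_pos le_rfl, hR]
      · rw [if_neg hxq]
    have := h1.union h2
    rwa [Iic_union_Ici, hasDerivWithinAt_univ] at this
  · rw [if_neg (not_le.2 h)]
    refine (hg h.le).congr_of_eventuallyEq ?_
    filter_upwards [Ioi_mem_nhds h] with x hx
    rw [if_neg (not_le.2 hx)]

lemma kk_deriv {R : ℝ} (hR : 0 < R) (q : ℝ) : HasDerivAt (kk R) (kk1 R q) q := by
  refine glue_deriv (f := fun q => 6 / R^2 - 8 * q / R^3 + 3 * q^2 / R^4) (g := fun q => 1 / q^2) ?_ ?_ ?_ ?_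
  · intro _
    have h1 := (((hasDerivAt_id q).const_mul 8).div_const (R^3)).const_sub (6 / R^2)
    have h2 := (((hasDerivAt_id q).pow 2).const_mul 3).div_const (R^4)
    refine (h1.add h2).congr_deriv ?_
    simp; field_simp; ring
  · intro h
    have hq : q ≠ 0 := (lt_of_lt_of_le hR h).ne'
    have h1 := (hasDerivAt_const q (1:ℝ)).div ((hasDerivAt_id q).pow 2) (pow_ne_zero 2 hq)
    refine h1.congr_deriv ?_
    simp; field_simp
  · field_simp; ring
  · intro h; subst h; field_simp; ring

lemma kk1_deriv {R : ℝ} (hR : 0 < R) (q : ℝ) : HasDerivAt (kk1 R) (kk2 R q) q := by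
  have key : HasDerivAt (kk1 R) (if q ≤ R then 6 / R^4 else 6 / q^4) q := by
    refine glue_deriv (f := fun q => - 8 / R^3 + 6 * q / R^4) (g := fun q => - 2 / q^3) ?_ ?_ ?_ ?_
    · intro _
      have h1 := (((hasDerivAt_id q).const_mul 6).div_const (R^4)).const_add (-8 / R^3)
      refine h1.congr_deriv ?_
      simp
    · intro h
      have hq : q ≠ 0 := (lt_of_lt_of_le hR h).ne'
      have h1 := (hasDerivAt_const q (-2:ℝ)).div ((hasDerivAt_id q).pow 3) (pow_ne_zero 3 hq)
      refine h1.congr_deriv ?_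
      simp; field_simp; norm_num
    · field_simp; ring
    · intro h; rw [h]
  convert key using 1
  unfold kk2
  split_ifs with h
  · rw [max_eq_right h]
  · rw [max_eq_left (not_le.1 h).le]

lemma kk2_cont {R : ℝ} (hR : 0 < R) : Continuous (kk2 R) := by
  unfold kk2
  refine continuous_const.div (by fun_prop) (fun x => ?_)
  have : 0 < max x R := lt_max_of_lt_right hR
  positivity

lemma kk_bound {R q : ℝ} (hR : 0 < R) (hq : 0 ≤ q) : |kk R q| * q^2 ≤ 6 := by
  unfold kk
  split_ifs with h
  · have h1 : 6 / R^2 - 8 * q / R^3 + 3 * q^2 / R^4 = (6 * R^2 - 8 * q * R + 3 * q^2) / R^4 := by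
      field_simp
    rw [h1, abs_of_nonneg (by apply div_nonneg <;> nlinarith [sq_nonneg (q - R), sq_nonneg (3 * q - 4 * R), pow_pos hR 4]),
      div_mul_eq_mul_div, div_le_iff₀ (by positivity)]
    have h2 : q^2 ≤ R^2 := by gcongr
    nlinarith [mul_nonneg hq hR.le, sq_nonneg q, sq_nonneg R, mul_nonneg (sq_nonneg q) (sub_nonneg.2 h2), mul_nonneg (mul_nonneg (sq_nonneg q) hq) (sub_nonneg.2 h), mul_nonneg (mul_nonneg (sq_nonneg q) hR.le) (sub_nonneg.2 h), mul_nonneg (sq_nonneg R) (sub_nonneg.2 h2)]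
  · have : 0 < q := lt_trans hR (not_le.1 h)
    rw [abs_of_pos (by positivity)]
    field_simp; norm_num

lemma kk1_bound {R q : ℝ} (hR : 0 < R) (hq : 0 ≤ q) : |kk1 R q| * q^3 ≤ 8 := by
  unfold kk1
  split_ifs with h
  · have h1 : - 8 / R^3 + 6 * q / R^4 = - ((8 * R - 6 * q) / R^4) := by
      field_simp; ring
    rw [h1, abs_neg, abs_of_nonneg (by apply div_nonneg <;> nlinarith [pow_pos hR 4]),
      div_mul_eq_mul_div, div_le_iff₀ (by positivity)]
    have h2 : q^3 ≤ R^3 := by gcongr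
    have h3 : (8 * R - 6 * q) * q^3 ≤ (8 * R) * R^3 := by
      apply mul_le_mul _ h2 (by positivity) (by positivity)
      linarith
    linarith
  · have : 0 < q := lt_trans hR (not_le.1 h)
    rw [abs_div, abs_of_pos (by positivity : (0:ℝ) < q^3)]
    field_simp; norm_num

lemma kk_lap {R q : ℝ} (hR : 0 < R) :
    4 * q * kk2 R q + 12 * kk1 R q = - (96 / R^3) * max (1 - q / R) 0 := by
  unfold kk1 kk2
  split_ifs with h
  · rw [max_eq_right h, max_eq_left (by rw [sub_nonneg, div_le_one hR]; exact h)]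
    field_simp; ring
  · have h := not_le.1 h
    have : 0 < q := lt_trans hR h
    rw [max_eq_left h.le, max_eq_right (by rw [sub_nonpos, one_le_div hR]; exact h.le)]
    field_simp; ring

end kernel
end

section
lemma C2on.mul {U : Set (ℝ × ℝ)} {u ux uy uxx uxy uyy v vx vy vxx vxy vyy : ℝ × ℝ → ℝ}
    (hu : C2on U u ux uy uxx uxy uyy) (hv : C2on U v vx vy vxx vxy vyy) :
    C2on U (fun p => u p * v p) (fun p => u p * vx p + ux p * v p)
      (fun p => u p * vy p + uy p * v p)
      (fun p => u p * vxx p + 2 * (ux p * vx p) + uxx p * v p)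
      (fun p => u p * vxy p + (uy p * vx p + ux p * vy p) + uxy p * v p)
      (fun p => u p * vyy p + 2 * (uy p * vy p) + uyy p * v p) := by
  have c (w : ℝ × ℝ → ℝ) (wx wy : ℝ × ℝ → ℝ) (h : ∀ p ∈ U, HasFDerivAt w (linF (wx p) (wy p)) p) :
      ContinuousOn w U := fun p hp => (h p hp).continuousAt.continuousWithinAt
  have cu := c _ _ _ hu.d0
  have cv := c _ _ _ hv.d0
  have cux := c _ _ _ hu.d1
  have cvx := c _ _ _ hv.d1
  have cuy := c _ _ _ hu.d2
  have cvy := c _ _ _ hv.d2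
  have := hu.cxx
  have := hu.cxy
  have := hu.cyy
  have := hv.cxx
  have := hv.cxy
  have := hv.cyy
  constructor
  · intro p hp
    exact linF_mul (hu.d0 p hp) (hv.d0 p hp)
  · intro p hp
    refine linF_congr (linF_add (linF_mul (hu.d0 p hp) (hv.d1 p hp)) (linF_mul (hu.d1 p hp) (hv.d0 p hp))) (fun _ => rfl) ?_ ?_ <;> ring
  · intro p hp
    refine linF_congr (linF_add (linF_mul (hu.d0 p hp) (hv.d2 p hp)) (linF_mul (hu.d2 p hp) (hv.d0 p hp))) (fun _ => rfl) ?_ ?_ <;> ring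
  · fun_prop
  · fun_prop
  · fun_prop

lemma C2on.add {U : Set (ℝ × ℝ)} {u ux uy uxx uxy uyy v vx vy vxx vxy vyy : ℝ × ℝ → ℝ}
    (hu : C2on U u ux uy uxx uxy uyy) (hv : C2on U v vx vy vxx vxy vyy) :
    C2on U (fun p => u p + v p) (fun p => ux p + vx p) (fun p => uy p + vy p)
      (fun p => uxx p + vxx p) (fun p => uxy p + vxy p) (fun p => uyy p + vyy p) :=
  ⟨fun p hp => linF_add (hu.d0 p hp) (hv.d0 p hp), fun p hp => linF_add (hu.d1 p hp) (hv.d1 p hp),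
   fun p hp => linF_add (hu.d2 p hp) (hv.d2 p hp), hu.cxx.add hv.cxx, hu.cxy.add hv.cxy,
   hu.cyy.add hv.cyy⟩

lemma C2on.sub {U : Set (ℝ × ℝ)} {u ux uy uxx uxy uyy v vx vy vxx vxy vyy : ℝ × ℝ → ℝ}
    (hu : C2on U u ux uy uxx uxy uyy) (hv : C2on U v vx vy vxx vxy vyy) :
    C2on U (fun p => u p - v p) (fun p => ux p - vx p) (fun p => uy p - vy p)
      (fun p => uxx p - vxx p) (fun p => uxy p - vxy p) (fun p => uyy p - vyy p) :=
  ⟨fun p hp => linF_sub (hu.d0 p hp) (hv.d0 p hp), fun p hp => linF_sub (hu.d1 p hp) (hv.d1 p hp),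
   fun p hp => linF_sub (hu.d2 p hp) (hv.d2 p hp), hu.cxx.sub hv.cxx, hu.cxy.sub hv.cxy,
   hu.cyy.sub hv.cyy⟩

lemma C2on.mono {U V : Set (ℝ × ℝ)} {u ux uy uxx uxy uyy : ℝ × ℝ → ℝ}
    (hu : C2on U u ux uy uxx uxy uyy) (h : V ⊆ U) : C2on V u ux uy uxx uxy uyy :=
  ⟨fun p hp => hu.d0 p (h hp), fun p hp => hu.d1 p (h hp), fun p hp => hu.d2 p (h hp),
    hu.cxx.mono h, hu.cxy.mono h, hu.cyy.mono h⟩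

lemma C2on.of_eq {U : Set (ℝ × ℝ)} {u ux uy uxx uxy uyy v vx vy vxx vxy vyy : ℝ × ℝ → ℝ}
    (hu : C2on U u ux uy uxx uxy uyy) (h0 : ∀ p, v p = u p) (h1 : ∀ p, vx p = ux p)
    (h2 : ∀ p, vy p = uy p) (h3 : ∀ p, vxx p = uxx p) (h4 : ∀ p, vxy p = uxy p)
    (h5 : ∀ p, vyy p = uyy p) : C2on U v vx vy vxx vxy vyy := by
  rw [funext h0, funext h1, funext h2, funext h3, funext h4, funext h5]; exact hu

/-- function of the first variable -/
lemma C2on_fst {U : Set (ℝ × ℝ)} {g g1 g2 : ℝ → ℝ} (h0 : ∀ p ∈ U, HasDerivAt g (g1 p.1) p.1)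
    (h1 : ∀ p ∈ U, HasDerivAt g1 (g2 p.1) p.1) (h2 : ContinuousOn (fun p : ℝ × ℝ => g2 p.1) U) :
    C2on U (fun p => g p.1) (fun p => g1 p.1) (fun _ => 0) (fun p => g2 p.1) (fun _ => 0)
      (fun _ => 0) := by
  refine ⟨fun p hp => ?_, fun p hp => ?_, fun p hp => linF_const 0 p, h2, continuousOn_const, continuousOn_const⟩
  · exact linF_congr (linF_comp (h0 p hp) (linF_fst p)) (fun _ => rfl) (by ring) (by ring)
  · exact linF_congr (linF_comp (h1 p hp) (linF_fst p)) (fun _ => rfl) (by ring) (by ring)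

lemma C2on_snd {U : Set (ℝ × ℝ)} {g g1 g2 : ℝ → ℝ} (h0 : ∀ p ∈ U, HasDerivAt g (g1 p.2) p.2)
    (h1 : ∀ p ∈ U, HasDerivAt g1 (g2 p.2) p.2) (h2 : ContinuousOn (fun p : ℝ × ℝ => g2 p.2) U) :
    C2on U (fun p => g p.2) (fun _ => 0) (fun p => g1 p.2) (fun _ => 0) (fun _ => 0)
      (fun p => g2 p.2) := by
  refine ⟨fun p hp => ?_, fun p hp => linF_const 0 p, fun p hp => ?_, continuousOn_const, continuousOn_const, h2⟩
  · exact linF_congr (linF_comp (h0 p hp) (linF_snd p)) (fun _ => rfl) (by ring) (by ring)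
  · exact linF_congr (linF_comp (h1 p hp) (linF_snd p)) (fun _ => rfl) (by ring) (by ring)

/-- affine change of variables -/
lemma C2on.aff {U V : Set (ℝ × ℝ)} {u ux uy uxx uxy uyy : ℝ × ℝ → ℝ}
    (hu : C2on U u ux uy uxx uxy uyy) (x0 y0 m11 m12 m21 m22 : ℝ)
    (hV : ∀ p ∈ V, (x0 + (m11 * p.1 + m12 * p.2), y0 + (m21 * p.1 + m22 * p.2)) ∈ U) :
    let T : ℝ × ℝ → ℝ × ℝ := fun p =>
      (x0 + (m11 * p.1 + m12 * p.2), y0 + (m21 * p.1 + m22 * p.2))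
    C2on V (fun p => u (T p)) (fun p => ux (T p) * m11 + uy (T p) * m21)
      (fun p => ux (T p) * m12 + uy (T p) * m22)
      (fun p => uxx (T p) * m11^2 + 2 * (uxy (T p) * m11 * m21) + uyy (T p) * m21^2)
      (fun p => uxx (T p) * m11 * m12 + uxy (T p) * (m11 * m22 + m12 * m21) + uyy (T p) * m21 * m22)
      (fun p => uxx (T p) * m12^2 + 2 * (uxy (T p) * m12 * m22) + uyy (T p) * m22^2) := by
  intro T
  have hT : Continuous T := by fun_prop
  have c (w : ℝ × ℝ → ℝ) (h : ContinuousOn w U) : ContinuousOn (fun p => w (T p)) V :=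
    h.comp hT.continuousOn hV
  have cxx := c _ hu.cxx
  have cxy := c _ hu.cxy
  have cyy := c _ hu.cyy
  constructor
  · intro p hp
    exact linF_aff (hu.d0 _ (hV p hp))
  · intro p hp
    have h1 := linF_mul (linF_aff (hu.d1 _ (hV p hp))) (linF_const m11 p)
    have h2 := linF_mul (linF_aff (hu.d2 _ (hV p hp))) (linF_const m21 p)
    refine linF_congr (linF_add h1 h2) (fun _ => rfl) ?_ ?_ <;> simp only [T] <;> ring
  · intro p hp
    have h1 := linF_mul (linF_aff (hu.d1 _ (hV p hp))) (linF_const m12 p)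
    have h2 := linF_mul (linF_aff (hu.d2 _ (hV p hp))) (linF_const m22 p)
    refine linF_congr (linF_add h1 h2) (fun _ => rfl) ?_ ?_ <;> simp only [T] <;> ring
  · exact ((cxx.mul continuousOn_const).add (continuousOn_const.mul ((cxy.mul continuousOn_const).mul continuousOn_const))).add (cyy.mul continuousOn_const)
  · exact (((cxx.mul continuousOn_const).mul continuousOn_const).add (cxy.mul continuousOn_const)).add ((cyy.mul continuousOn_const).mul continuousOn_const)
  · exact ((cxx.mul continuousOn_const).add (continuousOn_const.mul ((cxy.mul continuousOn_const).mul continuousOn_const))).add (cyy.mul continuousOn_const)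

/-! The kernel -/
noncomputable def HH (α β : ℝ) (p : ℝ × ℝ) : ℝ := α * (p.1^2 - p.2^2) + 2 * β * p.1 * p.2
noncomputable def H1 (α β : ℝ) (p : ℝ × ℝ) : ℝ := 2 * α * p.1 + 2 * β * p.2
noncomputable def H2 (α β : ℝ) (p : ℝ × ℝ) : ℝ := 2 * β * p.1 - 2 * α * p.2
noncomputable def qq (p : ℝ × ℝ) : ℝ := p.1^2 + p.2^2
noncomputable def zz (α β R : ℝ) (p : ℝ × ℝ) : ℝ := HH α β p * kk R (qq p)
noncomputable def zz1 (α β R : ℝ) (p : ℝ × ℝ) : ℝ :=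
  HH α β p * (kk1 R (qq p) * (2 * p.1)) + H1 α β p * kk R (qq p)
noncomputable def zz2 (α β R : ℝ) (p : ℝ × ℝ) : ℝ :=
  HH α β p * (kk1 R (qq p) * (2 * p.2)) + H2 α β p * kk R (qq p)

lemma sq_d0 (p : ℝ × ℝ) : HasFDerivAt (fun p : ℝ × ℝ => p.1^2) (linF (2 * p.1) 0) p :=
  linF_congr (linF_mul (linF_fst p) (linF_fst p)) (fun _ => by ring) (by ring) (by ring)

lemma sq_d1 (p : ℝ × ℝ) : HasFDerivAt (fun p : ℝ × ℝ => p.2^2) (linF 0 (2 * p.2)) p :=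
  linF_congr (linF_mul (linF_snd p) (linF_snd p)) (fun _ => by ring) (by ring) (by ring)

lemma qq_d (p : ℝ × ℝ) : HasFDerivAt qq (linF (2 * p.1) (2 * p.2)) p :=
  linF_congr (linF_add (sq_d0 p) (sq_d1 p)) (fun _ => rfl) (by ring) (by ring)

lemma lin_d (a b : ℝ) (p : ℝ × ℝ) : HasFDerivAt (fun p : ℝ × ℝ => a * p.1 + b * p.2) (linF a b) p := by
  refine linF_congr (linF_add (linF_mul (linF_const a p) (linF_fst p)) (linF_mul (linF_const b p) (linF_snd p))) (fun _ => rfl) ?_ ?_ <;> ring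

lemma HH_C2 (α β : ℝ) : C2on univ (HH α β) (H1 α β) (H2 α β) (fun _ => 2 * α) (fun _ => 2 * β)
    (fun _ => - (2 * α)) := by
  refine ⟨fun p _ => ?_, fun p _ => ?_, fun p _ => ?_, continuousOn_const, continuousOn_const, continuousOn_const⟩
  · have h1 := linF_mul (linF_const α p) (linF_sub (sq_d0 p) (sq_d1 p))
    have h2 := linF_mul (linF_const (2 * β) p) (linF_mul (linF_fst p) (linF_snd p))
    refine linF_congr (linF_add h1 h2) (fun _ => ?_) ?_ ?_ <;> simp only [HH, H1, H2] <;> ring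
  · exact lin_d _ _ p
  · refine linF_congr (lin_d (2 * β) (-(2 * α)) p) (fun _ => ?_) rfl rfl
    simp only [H2]; ring

lemma kkq_C2 {R : ℝ} (hR : 0 < R) : C2on univ (fun p => kk R (qq p))
    (fun p => kk1 R (qq p) * (2 * p.1)) (fun p => kk1 R (qq p) * (2 * p.2))
    (fun p => 2 * kk1 R (qq p) + 4 * p.1^2 * kk2 R (qq p))
    (fun p => 4 * p.1 * p.2 * kk2 R (qq p))
    (fun p => 2 * kk1 R (qq p) + 4 * p.2^2 * kk2 R (qq p)) := by
  have cq : Continuous qq := by unfold qq; fun_prop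
  have ck1 : Continuous (kk1 R) := continuous_iff_continuousAt.2 fun q => (kk1_deriv hR q).continuousAt
  have ck2 := kk2_cont hR
  have a1 : Continuous (fun p => kk1 R (qq p)) := ck1.comp cq
  have a2 : Continuous (fun p => kk2 R (qq p)) := ck2.comp cq
  refine ⟨fun p _ => linF_comp (kk_deriv hR _) (qq_d p), fun p _ => ?_, fun p _ => ?_, ?_, ?_, ?_⟩
  · have h1 := linF_mul (linF_comp (kk1_deriv hR _) (qq_d p)) (linF_mul (linF_const 2 p) (linF_fst p))
    refine linF_congr h1 (fun _ => rfl) ?_ ?_ <;> ring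
  · have h1 := linF_mul (linF_comp (kk1_deriv hR _) (qq_d p)) (linF_mul (linF_const 2 p) (linF_snd p))
    refine linF_congr h1 (fun _ => rfl) ?_ ?_ <;> ring
  · fun_prop
  · fun_prop
  · fun_prop

lemma zz_C2 {R : ℝ} (hR : 0 < R) (α β : ℝ) : ∃ z11 z12 z22 : ℝ × ℝ → ℝ,
    C2on univ (zz α β R) (zz1 α β R) (zz2 α β R) z11 z12 z22 ∧
    ∀ p, z11 p + z22 p = - (96 / R^3) * (HH α β p * max (1 - qq p / R) 0) := by
  refine ⟨_, _, _, (HH_C2 α β).mul (kkq_C2 hR), ?_⟩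
  intro p
  have := kk_lap (q := qq p) hR
  have h2 : p.1 * H1 α β p + p.2 * H2 α β p = 2 * HH α β p := by simp only [HH, H1, H2]; ring
  have h3 : p.1^2 + p.2^2 = qq p := rfl
  linear_combination HH α β p * this + 4 * kk1 R (qq p) * h2 + 4 * HH α β p * kk2 R (qq p) * h3

lemma HH_bound {α β : ℝ} (h : α^2 + β^2 ≤ 1) (p : ℝ × ℝ) : |HH α β p| ≤ qq p := by
  have h1 : (HH α β p)^2 ≤ (qq p)^2 := by
    have e : (HH α β p)^2 = (α^2+β^2) * (qq p)^2 - (α * (2 * p.1 * p.2) - β * (p.1^2-p.2^2))^2 := by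
      simp only [HH, qq]; ring
    nlinarith [sq_nonneg (α * (2 * p.1 * p.2) - β * (p.1^2-p.2^2)), sq_nonneg (qq p)]
  have : 0 ≤ qq p := by unfold qq; positivity
  exact abs_le_of_sq_le_sq h1 this

lemma zz_bound {α β R : ℝ} (hR : 0 < R) (h : α^2 + β^2 ≤ 1) (p : ℝ × ℝ) :
    |zz α β R p| * qq p ≤ 6 := by
  have hq : 0 ≤ qq p := by unfold qq; positivity
  have := kk_bound hR hq
  unfold zz
  rw [abs_mul]
  calc |HH α β p| * |kk R (qq p)| * qq p ≤ qq p * |kk R (qq p)| * qq p := by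
        gcongr; exact HH_bound h p
    _ = |kk R (qq p)| * qq p ^2 := by ring
    _ ≤ 6 := this

lemma zz1_bound {α β R : ℝ} (hR : 0 < R) (h : α^2 + β^2 ≤ 1) (p : ℝ × ℝ) :
    |zz1 α β R p| * |p.1|^3 ≤ 40 := by
  have hq : 0 ≤ qq p := by unfold qq; positivity
  have k0 := kk_bound hR hq
  have k1 := kk1_bound hR hq
  have hH := HH_bound h p
  have hα : |α| ≤ 1 := abs_le_of_sq_le_sq (by nlinarith [sq_nonneg β]) zero_le_one
  have hβ : |β| ≤ 1 := abs_le_of_sq_le_sq (by nlinarith [sq_nonneg α]) zero_le_one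
  have e1 : |p.1|^2 = p.1^2 := sq_abs _
  have e2 : |p.2|^2 = p.2^2 := sq_abs _
  have hq1 : |p.1|^2 ≤ qq p := by unfold qq; nlinarith [sq_nonneg p.2]
  have hst : |p.1| * |p.2| ≤ qq p := by unfold qq; nlinarith [sq_nonneg (|p.1| - |p.2|)]
  have hH1 : |H1 α β p| ≤ 2 * |p.1| + 2 * |p.2| := by
    unfold H1
    refine (abs_add_le _ _).trans ?_
    rw [abs_mul, abs_mul, abs_mul, abs_mul]
    simp only [abs_two]
    gcongr
    · nlinarith
    · nlinarith
  unfold zz1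
  have g1 : |HH α β p * (kk1 R (qq p) * (2 * p.1))| * |p.1|^3 ≤ 16 := by
    rw [abs_mul, abs_mul, abs_mul, abs_two]
    calc |HH α β p| * (|kk1 R (qq p)| * (2 * |p.1|)) * |p.1|^3
        = 2 * |HH α β p| * |kk1 R (qq p)| * (|p.1|^2 * |p.1|^2) := by ring
      _ ≤ 2 * qq p * |kk1 R (qq p)| * (qq p * qq p) := by gcongr
      _ = 2 * (|kk1 R (qq p)| * qq p ^3) := by ring
      _ ≤ 16 := by linarith
  have g2 : |H1 α β p * kk R (qq p)| * |p.1|^3 ≤ 24 := by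
    rw [abs_mul]
    calc |H1 α β p| * |kk R (qq p)| * |p.1|^3
        ≤ (2 * |p.1| + 2 * |p.2|) * |kk R (qq p)| * |p.1|^3 := by gcongr
      _ = |kk R (qq p)| * (2 * (|p.1|^2 * |p.1|^2) + 2 * (|p.1| * |p.2|) * |p.1|^2) := by ring
      _ ≤ |kk R (qq p)| * (2 * (qq p * qq p) + 2 * qq p * qq p) := by gcongr
      _ = 4 * (|kk R (qq p)| * qq p ^2) := by ring
      _ ≤ 24 := by linarith
  calc _ ≤ (|HH α β p * (kk1 R (qq p) * (2 * p.1))| + |H1 α β p * kk R (qq p)|) * |p.1|^3 := by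
        gcongr; exact abs_add_le _ _
    _ ≤ 40 := by linarith

lemma zz2_bound {α β R : ℝ} (hR : 0 < R) (h : α^2 + β^2 ≤ 1) (p : ℝ × ℝ) :
    |zz2 α β R p| * |p.2|^3 ≤ 40 := by
  have := zz1_bound (α := -α) (β := β) hR (by nlinarith) (p.2, p.1)
  have e : zz2 α β R p = zz1 (-α) β R (p.2, p.1) := by
    have : qq p = qq (p.2, p.1) := by simp only [qq]; ring
    simp only [zz1, zz2, this, HH, H1, H2]; ring
  rw [e]; exact this

/-! cutoff -/
noncomputable def nn (s : ℝ) : ℝ := (1 - s^4)^3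
noncomputable def nn1 (s : ℝ) : ℝ := -12 * s^3 * (1 - s^4)^2
noncomputable def nn2 (s : ℝ) : ℝ := -36 * s^2 * (1 - s^4)^2 + 96 * s^6 * (1 - s^4)

lemma nn_d (s : ℝ) : HasDerivAt nn (nn1 s) s := by
  have h := (((hasDerivAt_id s).pow 4).const_sub 1).pow 3
  refine HasDerivAt.congr_deriv h ?_
  simp [nn1]; ring

lemma nn1_d (s : ℝ) : HasDerivAt nn1 (nn2 s) s := by
  have h := (((hasDerivAt_id s).pow 3).const_mul (-12)).mul ((((hasDerivAt_id s).pow 4).const_sub 1).pow 2)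
  refine HasDerivAt.congr_deriv h ?_
  simp [nn2]; ring

lemma nn2_c : Continuous nn2 := by unfold nn2; fun_prop

lemma pow4_bd {s : ℝ} (hs : |s| ≤ 1) : 0 ≤ 1 - s^4 ∧ 1 - s^4 ≤ 1 := by
  have h1 : s^2 ≤ 1 := by rw [← sq_abs]; exact pow_le_one₀ (abs_nonneg s) hs
  constructor <;> nlinarith [sq_nonneg s, sq_nonneg (s^2)]

lemma nn_bd {s : ℝ} (hs : |s| ≤ 1) : |nn s| ≤ 1 := by
  obtain ⟨h0, h1⟩ := pow4_bd hs
  unfold nn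
  rw [abs_of_nonneg (by positivity)]
  exact pow_le_one₀ h0 h1

lemma nn1_bd {s : ℝ} (hs : |s| ≤ 1) : |nn1 s| ≤ 12 * |s|^3 := by
  obtain ⟨h0, h1⟩ := pow4_bd hs
  unfold nn1
  rw [abs_mul, abs_mul, abs_pow, abs_of_nonneg (by positivity : 0 ≤ (1 - s^4)^2)]
  have : (1 - s^4)^2 ≤ 1 := pow_le_one₀ h0 h1
  norm_num
  nlinarith [pow_nonneg (abs_nonneg s) 3]

lemma nn2_bd {s : ℝ} (hs : |s| ≤ 1) : |nn2 s| ≤ 132 * s^2 := by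
  obtain ⟨h0, h1⟩ := pow4_bd hs
  have h2 : (1 - s^4)^2 ≤ 1 := pow_le_one₀ h0 h1
  have h3 : 0 ≤ (1 - s^4)^2 := by positivity
  have h4 : s^2 ≤ 1 := by rw [← sq_abs]; exact pow_le_one₀ (abs_nonneg s) hs
  have h5 : s^6 * (1 - s^4) ≤ s^2 := by
    have : s^4 * (1 - s^4) ≤ 1 := by nlinarith [sq_nonneg (s^2)]
    nlinarith [sq_nonneg s]
  have h6 : 0 ≤ s^6 * (1 - s^4) := by positivity
  have h7 : s^2 * (1 - s^4)^2 ≤ s^2 := by nlinarith [sq_nonneg s]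
  have h8 : 0 ≤ s^2 * (1 - s^4)^2 := by positivity
  unfold nn2
  rw [abs_le]; constructor <;> nlinarith
end

section
lemma C2on.c0 {U : Set (ℝ × ℝ)} {u ux uy uxx uxy uyy : ℝ × ℝ → ℝ}
    (hu : C2on U u ux uy uxx uxy uyy) : ContinuousOn u U :=
  fun p hp => (hu.d0 p hp).continuousAt.continuousWithinAt
lemma C2on.c1 {U : Set (ℝ × ℝ)} {u ux uy uxx uxy uyy : ℝ × ℝ → ℝ}
    (hu : C2on U u ux uy uxx uxy uyy) : ContinuousOn ux U :=
  fun p hp => (hu.d1 p hp).continuousAt.continuousWithinAt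
lemma C2on.c2 {U : Set (ℝ × ℝ)} {u ux uy uxx uxy uyy : ℝ × ℝ → ℝ}
    (hu : C2on U u ux uy uxx uxy uyy) : ContinuousOn uy U :=
  fun p hp => (hu.d2 p hp).continuousAt.continuousWithinAt

def BX (d : ℝ) : Set (ℝ × ℝ) := Icc (((-1:ℝ), -d) : ℝ × ℝ) ((1:ℝ), (1:ℝ))

lemma mem_BX {d : ℝ} {p : ℝ × ℝ} : p ∈ BX d ↔ -1 ≤ p.1 ∧ -d ≤ p.2 ∧ p.1 ≤ 1 ∧ p.2 ≤ 1 := by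
  simp [BX, Prod.le_def, and_assoc]

lemma BX_compact (d : ℝ) : IsCompact (BX d) := isCompact_Icc

lemma green {d : ℝ} (hd : 0 < d) {u ux uy uxx uxy uyy v vx vy vxx vxy vyy : ℝ × ℝ → ℝ}
    (hu : C2on (BX d) u ux uy uxx uxy uyy) (hv : C2on (BX d) v vx vy vxx vxy vyy)
    (h1 : ∀ t, v (1, t) = 0) (h1' : ∀ t, vx (1, t) = 0)
    (h2 : ∀ t, v (-1, t) = 0) (h2' : ∀ t, vx (-1, t) = 0)
    (h3 : ∀ s, v (s, 1) = 0) (h3' : ∀ s, vy (s, 1) = 0) :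
    ∫ p in BX d, (v p * (uxx p + uyy p) - u p * (vxx p + vyy p)) =
      - ∫ s in (-1:ℝ)..1, (v (s, -d) * uy (s, -d) - vy (s, -d) * u (s, -d)) := by
  have hle : (((-1:ℝ), -d) : ℝ × ℝ) ≤ ((1:ℝ), (1:ℝ)) := by
    rw [Prod.le_def]; constructor <;> simp; linarith
  have cu := hu.c0
  have cv := hv.c0
  have cux := hu.c1
  have cvx := hv.c1
  have cuy := hu.c2
  have cvy := hv.c2
  have := hu.cxx
  have := hu.cyy
  have := hu.cxy
  have := hv.cxx
  have := hv.cyy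
  have := hv.cxy
  have key := MeasureTheory.integral_divergence_prod_Icc_of_hasFDerivAt_of_le
    (fun p => v p * ux p - vx p * u p) (fun p => v p * uy p - vy p * u p)
    (fun p => linF (v p * uxx p + vx p * ux p - (vx p * ux p + vxx p * u p))
      (v p * uxy p + vy p * ux p - (vx p * uy p + vxy p * u p)))
    (fun p => linF (v p * uxy p + vx p * uy p - (vy p * ux p + vxy p * u p))
      (v p * uyy p + vy p * uy p - (vy p * uy p + vyy p * u p)))
    ((-1:ℝ), -d) ((1:ℝ), (1:ℝ)) hle (by change ContinuousOn _ (BX d); fun_prop) (by change ContinuousOn _ (BX d); fun_prop)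
    ?_ ?_ ?_
  · simp only [h1, h1', h2, h2', h3, h3'] at key
    simp only [linF_apply] at key
    rw [BX]
    convert key using 1
    · refine MeasureTheory.setIntegral_congr_fun measurableSet_Icc (fun p _ => ?_)
      ring
    · simp
  · intro p hp
    have hp' : p ∈ BX d := mem_BX.2 ⟨hp.1.1.le, hp.2.1.le, hp.1.2.le, hp.2.2.le⟩
    exact linF_sub (linF_mul (hv.d0 p hp') (hu.d1 p hp')) (linF_mul (hv.d1 p hp') (hu.d0 p hp'))
  · intro p hp
    have hp' : p ∈ BX d := mem_BX.2 ⟨hp.1.1.le, hp.2.1.le, hp.1.2.le, hp.2.2.le⟩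
    exact linF_sub (linF_mul (hv.d0 p hp') (hu.d2 p hp')) (linF_mul (hv.d2 p hp') (hu.d0 p hp'))
  · refine ContinuousOn.integrableOn_compact (BX_compact d) ?_
    simp only [linF_apply]
    change ContinuousOn _ (BX d)
    fun_prop

/-- one-dimensional integrable bound -/
lemma abs_rpow_int : MeasureTheory.IntegrableOn (fun s : ℝ => |s| ^ (-(7/8:ℝ))) (Icc (-1) 1) := by
  rw [integrableOn_Icc_iff_integrableOn_Ioc, ← intervalIntegrable_iff_integrableOn_Ioc_of_le (by norm_num)]
  have h1 : IntervalIntegrable (fun s : ℝ => |s| ^ (-(7/8:ℝ))) MeasureTheory.volume 0 1 := by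
    have := intervalIntegral.intervalIntegrable_rpow' (a := 0) (b := 1) (r := -(7/8:ℝ)) (by norm_num)
    refine this.congr ?_
    intro s hs
    rw [uIoc_of_le zero_le_one] at hs
    simp only [abs_of_pos hs.1]
  have h2 : IntervalIntegrable (fun s : ℝ => |s| ^ (-(7/8:ℝ))) MeasureTheory.volume (-1) 0 := by
    have := (IntervalIntegrable.iff_comp_neg (by simp)).1 h1
    simp only [abs_neg, neg_zero] at this
    exact this.symm
  exact h2.trans h1

lemma qq_rpow_bound {p : ℝ × ℝ} (h1 : p.1 ≠ 0) (h2 : p.2 ≠ 0) :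
    (qq p) ^ (1/8:ℝ) / qq p ≤ |p.1| ^ (-(7/8:ℝ)) * |p.2| ^ (-(7/8:ℝ)) := by
  have a1 := abs_pos.2 h1
  have a2 := abs_pos.2 h2
  have hle : |p.1| * |p.2| ≤ qq p := by
    have e1 : |p.1|^2 = p.1^2 := sq_abs _
    have e2 : |p.2|^2 = p.2^2 := sq_abs _
    unfold qq; nlinarith [sq_nonneg (|p.1| - |p.2|)]
  have hq : 0 < qq p := lt_of_lt_of_le (by positivity) hle
  rw [← Real.mul_rpow a1.le a2.le]
  have : (qq p) ^ (1/8:ℝ) / qq p = (qq p) ^ (-(7/8:ℝ)) := by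
    rw [show (-(7/8:ℝ)) = 1/8 - 1 by norm_num, Real.rpow_sub_one hq.ne']
  rw [this]
  exact Real.rpow_le_rpow_of_nonpos (by positivity) hle (by norm_num)

/-- The universal constant of the singular integral -/
lemma sing_int : ∃ C0 : ℝ, 0 ≤ C0 ∧ ∀ d : ℝ, 0 < d → d ≤ 1 → ∀ F : ℝ × ℝ → ℝ, ∀ M : ℝ, 0 ≤ M →
    (∀ p ∈ BX d, |F p| * qq p ≤ M * (qq p) ^ (1/8:ℝ)) → |∫ p in BX d, F p| ≤ C0 * M := by
  set w : ℝ × ℝ → ℝ := fun p => |p.1| ^ (-(7/8:ℝ)) * |p.2| ^ (-(7/8:ℝ)) with hw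
  have hwi : MeasureTheory.IntegrableOn w (BX 1) := by
    have : BX 1 = Icc (-1:ℝ) 1 ×ˢ Icc (-1:ℝ) 1 := by rw [BX, Icc_prod_eq]
    rw [this, MeasureTheory.IntegrableOn, MeasureTheory.Measure.volume_eq_prod, ← MeasureTheory.Measure.prod_restrict]
    exact MeasureTheory.Integrable.mul_prod (f := fun s : ℝ => |s| ^ (-(7/8:ℝ))) (g := fun s : ℝ => |s| ^ (-(7/8:ℝ))) abs_rpow_int abs_rpow_int
  have hw0 : ∀ p, 0 ≤ w p := fun p => by positivity
  refine ⟨∫ p in BX 1, w p, MeasureTheory.setIntegral_nonneg measurableSet_Icc (fun p _ => hw0 p), ?_⟩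
  intro d hd hd1 F M hM hF
  have hsub : BX d ⊆ BX 1 := by
    intro p hp; rw [mem_BX] at hp ⊢; exact ⟨hp.1, by linarith [hp.2.1], hp.2.2⟩
  have hwd := hwi.mono_set hsub
  have hae : ∀ᵐ p ∂(MeasureTheory.volume.restrict (BX d)), ‖F p‖ ≤ M * w p := by
    have z1 : ∀ᵐ p : ℝ × ℝ, p.1 ≠ 0 := by
      have : ∀ᵐ x : ℝ, x ≠ 0 := by
        simp [MeasureTheory.ae_iff]
      exact MeasureTheory.Measure.quasiMeasurePreserving_fst.ae this
    have z2 : ∀ᵐ p : ℝ × ℝ, p.2 ≠ 0 := by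
      have : ∀ᵐ x : ℝ, x ≠ 0 := by
        simp [MeasureTheory.ae_iff]
      exact MeasureTheory.Measure.quasiMeasurePreserving_snd.ae this
    filter_upwards [MeasureTheory.ae_restrict_mem (measurableSet_Icc : MeasurableSet (BX d)), MeasureTheory.ae_restrict_of_ae z1, MeasureTheory.ae_restrict_of_ae z2] with p hp h1 h2
    have hq : 0 < qq p := by unfold qq; positivity
    have := hF p hp
    rw [Real.norm_eq_abs]
    calc |F p| ≤ M * ((qq p) ^ (1/8:ℝ) / qq p) := by
          rw [← mul_div_assoc, le_div_iff₀ hq]; exact this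
      _ ≤ M * w p := by gcongr; exact qq_rpow_bound h1 h2
  calc |∫ p in BX d, F p| ≤ ∫ p in BX d, M * w p :=
        MeasureTheory.norm_integral_le_of_norm_le (hwd.const_mul M) hae
    _ = M * ∫ p in BX d, w p := MeasureTheory.integral_const_mul _ _
    _ ≤ M * ∫ p in BX 1, w p := by
        refine mul_le_mul_of_nonneg_left ?_ hM
        exact MeasureTheory.setIntegral_mono_set hwi (Eventually.of_forall hw0) (LE.le.eventuallyLE hsub)
    _ = _ := mul_comm _ _
end

section
lemma C2on.shift {u ux uy uxx uxy uyy : ℝ × ℝ → ℝ}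
    (hu : C2on univ u ux uy uxx uxy uyy) (e : ℝ) :
    C2on univ (fun p => u (p.1, p.2 + e)) (fun p => ux (p.1, p.2 + e)) (fun p => uy (p.1, p.2 + e))
      (fun p => uxx (p.1, p.2 + e)) (fun p => uxy (p.1, p.2 + e)) (fun p => uyy (p.1, p.2 + e)) := by
  have h := hu.aff (V := univ) 0 e 1 0 0 1 (fun _ _ => mem_univ _)
  refine h.of_eq ?_ ?_ ?_ ?_ ?_ ?_ <;> intro p <;> simp [add_comm]

lemma kk_out {R q : ℝ} (hR : 0 < R) (h : R ≤ q) : kk R q = 1 / q^2 ∧ kk1 R q = -2 / q^3 := by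
  rcases h.lt_or_eq with h | h
  · simp [kk, kk1, not_le.2 h]
  · subst h
    simp only [kk, kk1, le_refl, if_true]
    constructor <;> field_simp <;> ring

noncomputable def imA (α β c : ℝ) : ℝ := -(α * ((c^2-1)/(c^2+1)) - β * (2*c/(c^2+1)))
noncomputable def imB (α β c : ℝ) : ℝ := α * (2*c/(c^2+1)) + β * ((c^2-1)/(c^2+1))

lemma im_sq (α β c : ℝ) : (imA α β c)^2 + (imB α β c)^2 = α^2 + β^2 := by
  have : c^2 + 1 ≠ 0 := by positivity
  unfold imA imB; field_simp; ring

lemma im_bdry {α β c d R s : ℝ} (hR : 0 < R) (hd : R ≤ d^2) :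
    zz2 α β R (s, -d) + zz2 (imA α β c) (imB α β c) R (s, d) +
      c * (zz1 α β R (s, -d) + zz1 (imA α β c) (imB α β c) R (s, d)) = 0 := by
  have hq1 : qq (s, -d) = s^2 + d^2 := by simp [qq]
  have hq2 : qq (s, d) = s^2 + d^2 := by simp [qq]
  have h : R ≤ s^2 + d^2 := by nlinarith [sq_nonneg s]
  obtain ⟨k0, k1⟩ := kk_out hR h
  have hp : s^2 + d^2 ≠ 0 := (lt_of_lt_of_le hR h).ne'
  have : c^2 + 1 ≠ 0 := by positivity
  simp only [zz1, zz2, hq1, hq2, k0, k1, HH, H1, H2, imA, imB]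
  field_simp
  ring

noncomputable def ZZ (α β c d R : ℝ) (p : ℝ × ℝ) : ℝ :=
  zz α β R p + zz (imA α β c) (imB α β c) R (p.1, p.2 + 2 * d)
noncomputable def ZZ1 (α β c d R : ℝ) (p : ℝ × ℝ) : ℝ :=
  zz1 α β R p + zz1 (imA α β c) (imB α β c) R (p.1, p.2 + 2 * d)
noncomputable def ZZ2 (α β c d R : ℝ) (p : ℝ × ℝ) : ℝ :=
  zz2 α β R p + zz2 (imA α β c) (imB α β c) R (p.1, p.2 + 2 * d)

lemma ZZ_C2 {R : ℝ} (hR : 0 < R) (α β c d : ℝ) (hd : 0 < d) (hRd : R ≤ d^2) :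
    ∃ z11 z12 z22 : ℝ × ℝ → ℝ,
    C2on univ (ZZ α β c d R) (ZZ1 α β c d R) (ZZ2 α β c d R) z11 z12 z22 ∧
    ∀ p ∈ BX d, z11 p + z22 p = - (96 / R^3) * (HH α β p * max (1 - qq p / R) 0) := by
  obtain ⟨a1, a2, a3, ha, ha'⟩ := zz_C2 hR α β
  obtain ⟨b1, b2, b3, hb, hb'⟩ := zz_C2 hR (imA α β c) (imB α β c)
  refine ⟨_, _, _, ha.add (hb.shift (2 * d)), fun p hp => ?_⟩
  have h1 := ha' p
  have h2 := hb' (p.1, p.2 + 2 * d)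
  have h3 : max (1 - qq (p.1, p.2 + 2 * d) / R) 0 = 0 := by
    refine max_eq_right ?_
    rw [sub_nonpos, one_le_div hR]
    have := (mem_BX.1 hp).2.1
    simp only [qq]
    nlinarith [sq_nonneg p.1]
  rw [h3] at h2
  linear_combination h1 + h2

lemma shift_le {d : ℝ} (hd : 0 < d) {p : ℝ × ℝ} (hp : p ∈ BX d) : |p.2| ≤ |p.2 + 2 * d| := by
  have := (mem_BX.1 hp).2.1
  rw [abs_of_nonneg (by linarith : 0 ≤ p.2 + 2 * d), abs_le]
  constructor <;> linarith

lemma ZZ_bound {α β c d R : ℝ} (hR : 0 < R) (h : α^2 + β^2 ≤ 1) (hd : 0 < d)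
    {p : ℝ × ℝ} (hp : p ∈ BX d) : |ZZ α β c d R p| * qq p ≤ 12 := by
  have h1 := zz_bound hR h p
  have h2 := zz_bound (α := imA α β c) (β := imB α β c) hR (by rw [im_sq]; exact h) (p.1, p.2 + 2 * d)
  have h3 : qq p ≤ qq (p.1, p.2 + 2 * d) := by
    simp only [qq]
    have := sq_le_sq.2 (shift_le hd hp)
    linarith
  have h0 : 0 ≤ qq p := by unfold qq; positivity
  calc |ZZ α β c d R p| * qq p ≤ (|zz α β R p| + |zz (imA α β c) (imB α β c) R (p.1, p.2 + 2 * d)|) * qq p := by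
        gcongr; exact abs_add_le _ _
    _ ≤ |zz α β R p| * qq p + |zz (imA α β c) (imB α β c) R (p.1, p.2 + 2 * d)| * qq (p.1, p.2 + 2 * d) := by
        rw [add_mul]; gcongr
    _ ≤ 12 := by linarith

lemma ZZ1_bound {α β c d R : ℝ} (hR : 0 < R) (h : α^2 + β^2 ≤ 1)
    {p : ℝ × ℝ} : |ZZ1 α β c d R p| * |p.1|^3 ≤ 80 := by
  have h1 := zz1_bound hR h p
  have h2 := zz1_bound (α := imA α β c) (β := imB α β c) hR (by rw [im_sq]; exact h) (p.1, p.2 + 2 * d)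
  calc |ZZ1 α β c d R p| * |p.1|^3 ≤ (|zz1 α β R p| + |zz1 (imA α β c) (imB α β c) R (p.1, p.2 + 2 * d)|) * |p.1|^3 := by
        gcongr; exact abs_add_le _ _
    _ ≤ 80 := by rw [add_mul]; simp only at h2; linarith

lemma ZZ2_bound {α β c d R : ℝ} (hR : 0 < R) (h : α^2 + β^2 ≤ 1) (hd : 0 < d)
    {p : ℝ × ℝ} (hp : p ∈ BX d) : |ZZ2 α β c d R p| * |p.2|^3 ≤ 80 := by
  have h1 := zz2_bound hR h p
  have h2 := zz2_bound (α := imA α β c) (β := imB α β c) hR (by rw [im_sq]; exact h) (p.1, p.2 + 2 * d)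
  have h3 := shift_le hd hp
  simp only at h2
  calc |ZZ2 α β c d R p| * |p.2|^3 ≤ (|zz2 α β R p| + |zz2 (imA α β c) (imB α β c) R (p.1, p.2 + 2 * d)|) * |p.2|^3 := by
        gcongr; exact abs_add_le _ _
    _ ≤ |zz2 α β R p| * |p.2|^3 + |zz2 (imA α β c) (imB α β c) R (p.1, p.2 + 2 * d)| * |p.2 + 2 * d|^3 := by
        rw [add_mul]; gcongr
    _ ≤ 80 := by linarith

lemma NN_C2 : C2on univ (fun p : ℝ × ℝ => nn p.1 * nn p.2) (fun p => nn1 p.1 * nn p.2)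
    (fun p => nn p.1 * nn1 p.2) (fun p => nn2 p.1 * nn p.2) (fun p => nn1 p.1 * nn1 p.2)
    (fun p => nn p.1 * nn2 p.2) := by
  have c1 : Continuous nn2 := nn2_c
  have h1 := C2on_fst (U := univ) (fun p _ => nn_d p.1) (fun p _ => nn1_d p.1) (by fun_prop)
  have h2 := C2on_snd (U := univ) (fun p _ => nn_d p.2) (fun p _ => nn1_d p.2) (by fun_prop)
  refine (h1.mul h2).of_eq ?_ ?_ ?_ ?_ ?_ ?_ <;> intro p <;> simp

lemma BX_abs {d : ℝ} (hd1 : d ≤ 1) {p : ℝ × ℝ} (hp : p ∈ BX d) : |p.1| ≤ 1 ∧ |p.2| ≤ 1 := by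
  rw [mem_BX] at hp
  rw [abs_le, abs_le]
  refine ⟨⟨hp.1, hp.2.2.1⟩, by linarith [hp.2.1], hp.2.2.2⟩

lemma rest_bound {α β c d R : ℝ} (hR : 0 < R) (h : α^2 + β^2 ≤ 1) (hd : 0 < d) (hd1 : d ≤ 1)
    {p : ℝ × ℝ} (hp : p ∈ BX d) :
    |2 * (nn1 p.1 * nn p.2 * ZZ1 α β c d R p + nn p.1 * nn1 p.2 * ZZ2 α β c d R p) +
      (nn2 p.1 * nn p.2 + nn p.1 * nn2 p.2) * ZZ α β c d R p| ≤ 7008 := by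
  obtain ⟨a1, a2⟩ := BX_abs hd1 hp
  have b0 := ZZ_bound (c := c) hR h hd hp
  have b1 := ZZ1_bound (c := c) (d := d) hR h (p := p)
  have b2 := ZZ2_bound (c := c) hR h hd hp
  have n1 := nn_bd a1
  have n2 := nn_bd a2
  have t1 : |nn1 p.1 * nn p.2 * ZZ1 α β c d R p| ≤ 960 := by
    rw [abs_mul, abs_mul]
    calc _ ≤ 12 * |p.1|^3 * 1 * |ZZ1 α β c d R p| := by gcongr; exact nn1_bd a1
      _ ≤ _ := by linarith
  have t2 : |nn p.1 * nn1 p.2 * ZZ2 α β c d R p| ≤ 960 := by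
    rw [abs_mul, abs_mul]
    calc _ ≤ 1 * (12 * |p.2|^3) * |ZZ2 α β c d R p| := by gcongr; exact nn1_bd a2
      _ ≤ _ := by linarith
  have t3 : |(nn2 p.1 * nn p.2 + nn p.1 * nn2 p.2) * ZZ α β c d R p| ≤ 132 * 12 := by
    rw [abs_mul]
    calc _ ≤ (132 * p.1^2 * 1 + 1 * (132 * p.2^2)) * |ZZ α β c d R p| := by
          gcongr
          refine (abs_add_le _ _).trans ?_
          rw [abs_mul, abs_mul]
          gcongr
          · exact nn2_bd a1
          · exact nn2_bd a2
      _ = 132 * (|ZZ α β c d R p| * qq p) := by unfold qq; ring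
      _ ≤ _ := by gcongr
  rw [abs_le] at *
  constructor <;> linarith [t1.1, t1.2, t2.1, t2.2, t3.1, t3.2]
end

section
lemma ptw {ns nd ms md Z U D c s d m e : ℝ} (n1 : |ns| ≤ 1) (n2 : |nd| ≤ 1) (n3 : |ms| ≤ 12 * |s|^3)
    (n4 : |md| ≤ 12 * d^3) (hz : |Z| * (s^2 + d^2) ≤ 12) (hs : |s| ≤ 1) (hd : 0 < d) (hd1 : d ≤ 1)
    (hU : |U| ≤ m) (hD : |D| ≤ e * d^2) (hc : |c| ≤ 1) (he : 0 ≤ e) (hm : 0 ≤ m) :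
    |ns * nd * (Z * D) - U * (ns * (md * Z)) - U * (c * (nd * (ms * Z)))| ≤ 12 * e + 288 * m := by
  have hZ := abs_nonneg Z
  have t1 : |Z * D| ≤ 12 * e := by
    rw [abs_mul]
    calc _ ≤ |Z| * (e * d^2) := by gcongr
      _ = e * (|Z| * d^2) := by ring
      _ ≤ e * (|Z| * (s^2 + d^2)) := by
          gcongr; nlinarith [sq_nonneg s]
      _ ≤ e * 12 := by gcongr
      _ = _ := by ring
  have t2 : |md * Z| ≤ 144 := by
    rw [abs_mul]
    have : d^3 ≤ s^2 + d^2 := by nlinarith [sq_nonneg s, sq_nonneg d]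
    calc _ ≤ (12 * d^3) * |Z| := by gcongr
      _ ≤ (12 * (s^2 + d^2)) * |Z| := by gcongr
      _ ≤ 144 := by linarith
  have t3 : |ms * Z| ≤ 144 := by
    rw [abs_mul]
    have : |s|^3 ≤ s^2 + d^2 := by
      have e1 := sq_abs s
      have : |s|^3 ≤ |s|^2 := pow_le_pow_of_le_one (abs_nonneg s) hs (by norm_num)
      nlinarith [sq_nonneg d]
    calc _ ≤ (12 * |s|^3) * |Z| := by gcongr
      _ ≤ (12 * (s^2 + d^2)) * |Z| := by gcongr
      _ ≤ 144 := by linarith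
  have g1 : |ns * nd * (Z * D)| ≤ 1 * 1 * (12 * e) := by
    rw [abs_mul, abs_mul]; gcongr
  have g2 : |U * (ns * (md * Z))| ≤ m * (1 * 144) := by
    rw [abs_mul, abs_mul ns]; gcongr
  have g3 : |U * (c * (nd * (ms * Z)))| ≤ m * (1 * (1 * 144)) := by
    rw [abs_mul, abs_mul c, abs_mul nd]; gcongr
  rw [abs_le] at g1 g2 g3 ⊢
  constructor <;> linarith [g1.1, g1.2, g2.1, g2.2, g3.1, g3.2]

lemma bdry_bound {α β c d R m e : ℝ} (hR : 0 < R) (h : α^2 + β^2 ≤ 1) (hd : 0 < d) (hd1 : d ≤ 1)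
    (hRd : R ≤ d^2) (hc : |c| ≤ 1) (hm : 0 ≤ m) (he : 0 ≤ e)
    {u ux uy uxx uxy uyy v vx vy vxx vxy vyy : ℝ × ℝ → ℝ}
    (hu : C2on (BX d) u ux uy uxx uxy uyy) (hv : C2on (BX d) v vx vy vxx vxy vyy)
    (hum : ∀ p ∈ BX d, |u p| ≤ m)
    (v0 : ∀ p, v p = nn p.1 * nn p.2 * ZZ α β c d R p)
    (v1 : ∀ p, vx p = nn p.1 * nn p.2 * ZZ1 α β c d R p + nn1 p.1 * nn p.2 * ZZ α β c d R p)
    (v2 : ∀ p, vy p = nn p.1 * nn p.2 * ZZ2 α β c d R p + nn p.1 * nn1 p.2 * ZZ α β c d R p)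
    (hb : d = 1 ∨ ∀ s ∈ Icc (-1:ℝ) 1, |uy (s, -d) - c * ux (s, -d)| ≤ e * d^2) :
    |∫ s in (-1:ℝ)..1, (v (s, -d) * uy (s, -d) - vy (s, -d) * u (s, -d))| ≤ 24 * e + 576 * m := by
  rcases hb with hb | hb
  · have : ∀ s : ℝ, v (s, -d) * uy (s, -d) - vy (s, -d) * u (s, -d) = 0 := by
      intro s
      rw [v0, v2, hb]
      have e1 : nn (-1) = 0 := by norm_num [nn]
      have e2 : nn1 (-1) = 0 := by norm_num [nn1]
      simp [e1, e2]
    simp only [this, intervalIntegral.integral_zero, abs_zero]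
    positivity
  have hmem : ∀ s ∈ Icc (-1:ℝ) 1, (s, -d) ∈ BX d := by
    intro s hs
    rw [mem_BX]
    exact ⟨hs.1, le_rfl, hs.2, by simp only; linarith⟩
  have hmaps : MapsTo (fun s : ℝ => (s, -d)) (Icc (-1:ℝ) 1) (BX d) := hmem
  have cc : ContinuousOn (fun s : ℝ => (s, -d)) (Icc (-1:ℝ) 1) := by fun_prop
  have cu : ContinuousOn (fun s => u (s, -d)) (Icc (-1:ℝ) 1) := hu.c0.comp cc hmaps
  have cux : ContinuousOn (fun s => ux (s, -d)) (Icc (-1:ℝ) 1) := hu.c1.comp cc hmaps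
  have cuy : ContinuousOn (fun s => uy (s, -d)) (Icc (-1:ℝ) 1) := hu.c2.comp cc hmaps
  have cv : ContinuousOn (fun s => v (s, -d)) (Icc (-1:ℝ) 1) := hv.c0.comp cc hmaps
  have cvx : ContinuousOn (fun s => vx (s, -d)) (Icc (-1:ℝ) 1) := hv.c1.comp cc hmaps
  have cvy : ContinuousOn (fun s => vy (s, -d)) (Icc (-1:ℝ) 1) := hv.c2.comp cc hmaps
  have hle : (-1:ℝ) ≤ 1 := by norm_num
  have i1 : IntervalIntegrable (fun s => v (s, -d) * ux (s, -d) + vx (s, -d) * u (s, -d)) MeasureTheory.volume (-1) 1 := by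
    apply ContinuousOn.intervalIntegrable
    rw [uIcc_of_le hle]
    exact (cv.mul cux).add (cvx.mul cu)
  have i2 : IntervalIntegrable (fun s => v (s, -d) * uy (s, -d) - vy (s, -d) * u (s, -d)) MeasureTheory.volume (-1) 1 := by
    apply ContinuousOn.intervalIntegrable
    rw [uIcc_of_le hle]
    exact (cv.mul cuy).sub (cvy.mul cu)
  have hz : ∫ s in (-1:ℝ)..1, (v (s, -d) * ux (s, -d) + vx (s, -d) * u (s, -d)) = 0 := by
    have := intervalIntegral.integral_eq_sub_of_hasDerivAt (a := -1) (b := 1)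
      (f := fun s => v (s, -d) * u (s, -d))
      (f' := fun s => v (s, -d) * ux (s, -d) + vx (s, -d) * u (s, -d)) ?_ i1
    · rw [this, v0, v0]; norm_num [nn]
    · intro s hs
      rw [uIcc_of_le hle] at hs
      exact linF_dx (linF_mul (hv.d0 _ (hmem s hs)) (hu.d0 _ (hmem s hs)))
  have hrew : ∫ s in (-1:ℝ)..1, (v (s, -d) * uy (s, -d) - vy (s, -d) * u (s, -d)) =
      ∫ s in (-1:ℝ)..1, ((v (s, -d) * uy (s, -d) - vy (s, -d) * u (s, -d)) -
        c * (v (s, -d) * ux (s, -d) + vx (s, -d) * u (s, -d))) := by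
    rw [intervalIntegral.integral_sub i2 (i1.const_mul c), intervalIntegral.integral_const_mul, hz]
    simp
  rw [hrew]
  have := intervalIntegral.norm_integral_le_of_norm_le_const (a := -1) (b := 1) (C := 12 * e + 288 * m)
    (f := fun s => ((v (s, -d) * uy (s, -d) - vy (s, -d) * u (s, -d)) -
        c * (v (s, -d) * ux (s, -d) + vx (s, -d) * u (s, -d)))) ?_
  · refine this.trans ?_
    norm_num; linarith
  · intro s hs
    rw [uIoc_of_le hle] at hs
    have hs' : s ∈ Icc (-1:ℝ) 1 := ⟨hs.1.le, hs.2⟩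
    have hp := hmem s hs'
    obtain ⟨a1, a2⟩ := BX_abs hd1 hp
    have n1 := nn_bd a1
    have n2 := nn_bd a2
    have n3 := nn1_bd a1
    have n4 := nn1_bd a2
    have hq : qq (s, -d) = s^2 + d^2 := by simp [qq]
    have hz := ZZ_bound (c := c) hR h hd hp
    have him := im_bdry (α := α) (β := β) (c := c) (s := s) hR hRd
    have hZ : ZZ2 α β c d R (s, -d) + c * ZZ1 α β c d R (s, -d) = 0 := by
      unfold ZZ2 ZZ1
      rw [show (-d + 2 * d) = d by ring]
      linarith
    have expr : ((v (s, -d) * uy (s, -d) - vy (s, -d) * u (s, -d)) -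
        c * (v (s, -d) * ux (s, -d) + vx (s, -d) * u (s, -d))) =
        nn s * nn (-d) * (ZZ α β c d R (s, -d) * (uy (s, -d) - c * ux (s, -d)))
        - u (s, -d) * (nn s * (nn1 (-d) * ZZ α β c d R (s, -d)))
        - u (s, -d) * (c * (nn (-d) * (nn1 s * ZZ α β c d R (s, -d)))) := by
      rw [v0, v1, v2]
      linear_combination (- nn s * nn (-d) * u (s, -d)) * hZ
    rw [expr]
    simp only at a1 a2 n1 n2 n3 n4
    rw [hq] at hz
    rw [abs_neg, abs_of_pos hd] at n4
    exact ptw n1 n2 n3 n4 hz a1 hd hd1 (hum _ hp) (hb s hs') hc he hm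

lemma abs_helper {A B k : ℝ} (h : A = -B) (h2 : |B| ≤ k) : |A| ≤ k := by
  rw [h, abs_neg]; exact h2

lemma est1 : ∃ C1 : ℝ, 0 ≤ C1 ∧ ∀ (α β c d R m G e : ℝ), 0 < R → α^2 + β^2 ≤ 1 → 0 < d → d ≤ 1 →
    R ≤ d^2 → |c| ≤ 1 → 0 ≤ m → 0 ≤ G → 0 ≤ e →
    ∀ u ux uy uxx uxy uyy : ℝ × ℝ → ℝ, C2on (BX d) u ux uy uxx uxy uyy →
    (∀ p ∈ BX d, |u p| ≤ m) → (∀ p ∈ BX d, |uxx p + uyy p| ≤ G * (qq p) ^ (1/8:ℝ)) →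
    (d = 1 ∨ ∀ s ∈ Icc (-1:ℝ) 1, |uy (s, -d) - c * ux (s, -d)| ≤ e * d^2) →
    |(96 / R^3) * ∫ p in BX d, nn p.1 * nn p.2 * u p * (HH α β p * max (1 - qq p / R) 0)| ≤
      C1 * (m + G + e) := by
  obtain ⟨C0, hC0, hsing⟩ := sing_int
  set V := MeasureTheory.volume.real (BX 1) with hV
  have hV0 : 0 ≤ V := MeasureTheory.measureReal_nonneg
  refine ⟨12 * C0 + 7008 * V + 576, by positivity, ?_⟩
  intro α β c d R m G e hR hαβ hd hd1 hRd hc hm hG he u ux uy uxx uxy uyy hu hum hlap hb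
  obtain ⟨z11, z12, z22, hZ, hZlap⟩ := ZZ_C2 hR α β c d hd hRd
  have hv := (NN_C2.mul hZ).mono (subset_univ (BX d))
  have hbd := bdry_bound (v := fun p => nn p.1 * nn p.2 * ZZ α β c d R p) hR hαβ hd hd1 hRd hc hm he hu hv hum
    (fun _ => rfl) (fun _ => rfl) (fun _ => rfl) hb
  have e1 : nn 1 = 0 := by norm_num [nn]
  have e2 : nn1 1 = 0 := by norm_num [nn1]
  have e3 : nn (-1) = 0 := by norm_num [nn]
  have e4 : nn1 (-1) = 0 := by norm_num [nn1]
  have hg := green hd hu hv (by simp [e1]) (by simp [e1, e2]) (by simp [e3]) (by simp [e3, e4])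
    (by simp [e1]) (by simp [e1, e2])
  have hA := abs_helper hg hbd
  set F1 : ℝ × ℝ → ℝ := fun p => nn p.1 * nn p.2 * ZZ α β c d R p * (uxx p + uyy p) with hF1
  set F2 : ℝ × ℝ → ℝ := fun p => u p * (2 * (nn1 p.1 * nn p.2 * ZZ1 α β c d R p + nn p.1 * nn1 p.2 * ZZ2 α β c d R p) +
      (nn2 p.1 * nn p.2 + nn p.1 * nn2 p.2) * ZZ α β c d R p) with hF2
  set F3 : ℝ × ℝ → ℝ := fun p => nn p.1 * nn p.2 * u p * (HH α β p * max (1 - qq p / R) 0) with hF3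
  have cN := NN_C2.c0
  have cn : Continuous nn := continuous_iff_continuousAt.2 fun q => (nn_d q).continuousAt
  have cn1 : Continuous nn1 := continuous_iff_continuousAt.2 fun q => (nn1_d q).continuousAt
  have cn2 := nn2_c
  have cZ := hZ.c0.mono (subset_univ (BX d))
  have cZ1 := hZ.c1.mono (subset_univ (BX d))
  have cZ2 := hZ.c2.mono (subset_univ (BX d))
  have cu := hu.c0
  have cxx := hu.cxx
  have cyy := hu.cyy
  have cH : Continuous (HH α β) := by unfold HH; fun_prop
  have cq : Continuous qq := by unfold qq; fun_prop
  have i1 : MeasureTheory.IntegrableOn F1 (BX d) :=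
    ContinuousOn.integrableOn_compact (BX_compact d) (by fun_prop)
  have i2 : MeasureTheory.IntegrableOn F2 (BX d) :=
    ContinuousOn.integrableOn_compact (BX_compact d) (by fun_prop)
  have i3 : MeasureTheory.IntegrableOn F3 (BX d) :=
    ContinuousOn.integrableOn_compact (BX_compact d) (by fun_prop)
  have hEq : (∫ p in BX d, (nn p.1 * nn p.2 * ZZ α β c d R p * (uxx p + uyy p) -
          u p *
            (nn p.1 * nn p.2 * z11 p + 2 * (nn1 p.1 * nn p.2 * ZZ1 α β c d R p) + nn2 p.1 * nn p.2 * ZZ α β c d R p +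
              (nn p.1 * nn p.2 * z22 p + 2 * (nn p.1 * nn1 p.2 * ZZ2 α β c d R p) +
                nn p.1 * nn2 p.2 * ZZ α β c d R p)))) = ∫ p in BX d, (F1 p - F2 p + (96 / R^3) * F3 p) := by
    refine MeasureTheory.setIntegral_congr_fun measurableSet_Icc (fun p hp => ?_)
    have := hZlap p hp
    simp only [hF1, hF2, hF3]
    linear_combination (-(nn p.1 * nn p.2 * u p)) * this
  have i12 : MeasureTheory.IntegrableOn (fun p => F1 p - F2 p) (BX d) := i1.sub i2
  rw [hEq, MeasureTheory.integral_add i12 (i3.const_mul _),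
    MeasureTheory.integral_sub i1 i2, MeasureTheory.integral_const_mul] at hA
  have b1 : |∫ p in BX d, F1 p| ≤ C0 * (12 * G) := by
    refine hsing d hd hd1 F1 (12 * G) (by positivity) (fun p hp => ?_)
    obtain ⟨a1, a2⟩ := BX_abs hd1 hp
    have hz := ZZ_bound (c := c) hR hαβ hd hp
    have hq0 : 0 ≤ qq p := by unfold qq; positivity
    have hl := hlap p hp
    simp only [hF1]
    rw [abs_mul, abs_mul, abs_mul]
    calc _ ≤ 1 * 1 * |ZZ α β c d R p| * (G * (qq p) ^ (1/8:ℝ)) * qq p := by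
          gcongr
          · exact nn_bd a1
          · exact nn_bd a2
      _ = (|ZZ α β c d R p| * qq p) * (G * (qq p) ^ (1/8:ℝ)) := by ring
      _ ≤ 12 * (G * (qq p) ^ (1/8:ℝ)) := by gcongr
      _ = _ := by ring
  have b2 : |∫ p in BX d, F2 p| ≤ 7008 * m * V := by
    have hsub : BX d ⊆ BX 1 := by
      intro p hp; rw [mem_BX] at hp ⊢; exact ⟨hp.1, by linarith [hp.2.1], hp.2.2⟩
    have := MeasureTheory.norm_setIntegral_le_of_norm_le_const (μ := MeasureTheory.volume) (s := BX d) (f := F2) (C := 7008 * m)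
      (BX_compact d).measure_lt_top (fun p hp => by
        have h1 := rest_bound (c := c) hR hαβ hd hd1 hp
        rw [Real.norm_eq_abs]
        simp only [hF2]
        rw [abs_mul, mul_comm 7008]
        gcongr
        exact hum p hp)
    refine this.trans ?_
    have hmono : MeasureTheory.volume.real (BX d) ≤ V :=
      MeasureTheory.measureReal_mono hsub (BX_compact 1).measure_lt_top.ne
    gcongr
  have k1 : 0 ≤ C0 * m := by positivity
  have k2 : 0 ≤ C0 * e := by positivity
  have k3 : 0 ≤ V * G := by positivity
  have k4 : 0 ≤ V * e := by positivity
  rw [abs_le] at *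
  constructor <;> nlinarith [b1.1, b1.2, b2.1, b2.2, hA.1, hA.2]
end

section
lemma linF_norm (a b : ℝ) : ‖linF a b‖ ≤ |a| + |b| := by
  refine ContinuousLinearMap.opNorm_le_bound _ (by positivity) (fun p => ?_)
  rw [linF_apply, Real.norm_eq_abs]
  have h1 : |p.1| ≤ ‖p‖ := norm_fst_le p
  have h2 : |p.2| ≤ ‖p‖ := norm_snd_le p
  calc |a * p.1 + b * p.2| ≤ |a| * |p.1| + |b| * |p.2| := by
        rw [← abs_mul, ← abs_mul]; exact abs_add_le _ _
    _ ≤ |a| * ‖p‖ + |b| * ‖p‖ := by gcongr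
    _ = _ := by ring

lemma norm_sq_le_qq (p : ℝ × ℝ) : ‖p‖^2 ≤ qq p := by
  rw [Prod.norm_def]
  unfold qq
  rcases max_choice ‖p.1‖ ‖p.2‖ with h | h <;> rw [h, Real.norm_eq_abs, sq_abs] <;> nlinarith [sq_nonneg p.1, sq_nonneg p.2]

lemma qq_le_norm (p : ℝ × ℝ) : qq p ≤ 2 * ‖p‖^2 := by
  have h1 : |p.1| ≤ ‖p‖ := norm_fst_le p
  have h2 : |p.2| ≤ ‖p‖ := norm_snd_le p
  unfold qq
  rw [← sq_abs p.1, ← sq_abs p.2]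
  nlinarith [abs_nonneg p.1, abs_nonneg p.2, norm_nonneg p]

/-- second-order Taylor -/
lemma taylor2 {d : ℝ} (hd : 0 < d) {u ux uy uxx uxy uyy : ℝ × ℝ → ℝ}
    (hu : C2on (BX d) u ux uy uxx uxy uyy) {ε : ℝ} (hε : 0 < ε) :
    ∃ η > 0, ∀ p : ℝ × ℝ, ‖p‖ < η → |u p - (u 0 + (ux 0 * p.1 + uy 0 * p.2) +
      (uxx 0 * p.1^2 + 2 * uxy 0 * p.1 * p.2 + uyy 0 * p.2^2) / 2)| ≤ ε * qq p := by
  have h0 : (0 : ℝ × ℝ) ∈ BX d := by rw [mem_BX]; simp; linarith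
  have hB : BX d ⊇ Metric.ball (0 : ℝ × ℝ) (min d 1) := by
    intro p hp
    rw [mem_ball_zero_iff] at hp
    have h1 : |p.1| ≤ ‖p‖ := norm_fst_le p
    have h2 : |p.2| ≤ ‖p‖ := norm_snd_le p
    have h3 := min_le_left d 1
    have h4 := min_le_right d 1
    rw [abs_le] at h1 h2
    rw [mem_BX]
    refine ⟨?_, ?_, ?_, ?_⟩ <;> linarith
  have e1 := (hu.d1 0 h0).isLittleO
  have e2 := (hu.d2 0 h0).isLittleO
  have b1 := e1.bound (half_pos hε)
  have b2 := e2.bound (half_pos hε)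
  simp only [sub_zero, linF_apply, Real.norm_eq_abs] at b1 b2
  obtain ⟨η1, hη1, g1⟩ := Metric.eventually_nhds_iff_ball.1 b1
  obtain ⟨η2, hη2, g2⟩ := Metric.eventually_nhds_iff_ball.1 b2
  refine ⟨min (min η1 η2) (min d 1), by positivity, fun p hp => ?_⟩
  have hlt1 : ‖p‖ < η1 := hp.trans_le ((min_le_left _ _).trans (min_le_left _ _))
  have hlt2 : ‖p‖ < η2 := hp.trans_le ((min_le_left _ _).trans (min_le_right _ _))
  have hlt3 : ‖p‖ < min d 1 := hp.trans_le (min_le_right _ _)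
  set g : ℝ × ℝ → ℝ := fun p => u p - (u 0 + (ux 0 * p.1 + uy 0 * p.2) +
      (uxx 0 * p.1^2 + 2 * uxy 0 * p.1 * p.2 + uyy 0 * p.2^2) / 2) with hg
  have hgd : ∀ q ∈ Metric.closedBall (0 : ℝ × ℝ) ‖p‖, HasFDerivWithinAt g
      (linF (ux q - ux 0 - (uxx 0 * q.1 + uxy 0 * q.2)) (uy q - uy 0 - (uxy 0 * q.1 + uyy 0 * q.2)))
      (Metric.closedBall (0 : ℝ × ℝ) ‖p‖) q := by
    intro q hq
    rw [mem_closedBall_zero_iff] at hq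
    have hqB : q ∈ BX d := hB (by rw [mem_ball_zero_iff]; linarith)
    refine HasFDerivAt.hasFDerivWithinAt ?_
    have k1 := linF_mul (linF_const (uxx 0 / 2) q) (sq_d0 q)
    have k2 := linF_mul (linF_const (uxy 0) q) (linF_mul (linF_fst q) (linF_snd q))
    have k3 := linF_mul (linF_const (uyy 0 / 2) q) (sq_d1 q)
    have k4 := linF_add (linF_const (u 0) q) (lin_d (ux 0) (uy 0) q)
    refine linF_congr (linF_sub (hu.d0 q hqB) (linF_add k4 (linF_add k1 (linF_add k2 k3)))) (fun q => ?_) ?_ ?_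
    · simp only [hg]; ring
    · ring
    · ring
  have hbound : ∀ q ∈ Metric.closedBall (0 : ℝ × ℝ) ‖p‖,
      ‖linF (ux q - ux 0 - (uxx 0 * q.1 + uxy 0 * q.2)) (uy q - uy 0 - (uxy 0 * q.1 + uyy 0 * q.2))‖ ≤ ε * ‖p‖ := by
    intro q hq
    rw [mem_closedBall_zero_iff] at hq
    have c1 := g1 q (by rw [mem_ball_zero_iff]; linarith)
    have c2 := g2 q (by rw [mem_ball_zero_iff]; linarith)
    refine (linF_norm _ _).trans ?_
    nlinarith
  have := (convex_closedBall (0 : ℝ × ℝ) ‖p‖).norm_image_sub_le_of_norm_hasFDerivWithin_le hgd hbound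
    (x := 0) (y := p) (by simp) (by simp)
  have hg0 : g 0 = 0 := by simp [hg]
  rw [hg0, sub_zero, sub_zero, Real.norm_eq_abs] at this
  calc |g p| ≤ ε * ‖p‖ * ‖p‖ := this
    _ = ε * ‖p‖^2 := by ring
    _ ≤ ε * qq p := by gcongr; exact norm_sq_le_qq p

noncomputable def wR (r : ℝ) (p : ℝ × ℝ) : ℝ := max (1 - qq p / r^2) 0
def SQ (r : ℝ) : Set (ℝ × ℝ) := Icc ((-r, -r) : ℝ × ℝ) (r, r)

lemma mem_SQ {r : ℝ} {p : ℝ × ℝ} : p ∈ SQ r ↔ -r ≤ p.1 ∧ -r ≤ p.2 ∧ p.1 ≤ r ∧ p.2 ≤ r := by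
  simp [SQ, Prod.le_def, and_assoc]

lemma wR_zero {r : ℝ} (hr : 0 < r) {p : ℝ × ℝ} (h : r^2 ≤ qq p) : wR r p = 0 := by
  unfold wR
  refine max_eq_right ?_
  rw [sub_nonpos, one_le_div (by positivity)]; exact h

lemma wR_out {r : ℝ} (hr : 0 < r) {p : ℝ × ℝ} (h : p ∉ SQ r) : wR r p = 0 := by
  apply wR_zero hr
  by_contra hc
  apply h
  push Not at hc
  unfold qq at hc
  have h1 : |p.1| ≤ r := abs_le_of_sq_le_sq (by nlinarith [sq_nonneg p.2]) hr.le
  have h2 : |p.2| ≤ r := abs_le_of_sq_le_sq (by nlinarith [sq_nonneg p.1]) hr.le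
  rw [abs_le] at h1 h2
  exact mem_SQ.2 ⟨h1.1, h2.1, h1.2, h2.2⟩

lemma wR_cont (r : ℝ) : Continuous (wR r) := by unfold wR qq; fun_prop
lemma wR_nonneg (r : ℝ) (p : ℝ × ℝ) : 0 ≤ wR r p := le_max_right _ _
lemma wR_le (r : ℝ) (p : ℝ × ℝ) : wR r p ≤ 1 := by
  refine max_le ?_ zero_le_one
  have : 0 ≤ qq p / r^2 := by unfold qq; positivity
  linarith

lemma anti_int {r : ℝ} (T : ℝ × ℝ ≃ᵐ ℝ × ℝ) (hT : MeasureTheory.MeasurePreserving T)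
    (hS : ∀ p, T p ∈ SQ r ↔ p ∈ SQ r) {F : ℝ × ℝ → ℝ} (hF : ∀ p, F (T p) = - F p) :
    ∫ p in SQ r, F p = 0 := by
  have h := hT.setIntegral_preimage_emb T.measurableEmbedding F (SQ r)
  have hpre : T ⁻¹' SQ r = SQ r := by ext p; exact hS p
  rw [hpre] at h
  simp only [hF] at h
  rw [MeasureTheory.integral_neg] at h
  linarith

lemma anti_neg {r : ℝ} {F : ℝ × ℝ → ℝ} (hF : ∀ p, F (-p) = - F p) : ∫ p in SQ r, F p = 0 := by
  refine anti_int (MeasurableEquiv.neg (ℝ × ℝ)) (MeasureTheory.Measure.measurePreserving_neg _) (fun p => ?_) hF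
  simp only [mem_SQ, MeasurableEquiv.neg_apply, Prod.fst_neg, Prod.snd_neg]
  constructor <;> rintro ⟨a, b, c, d⟩ <;> refine ⟨?_, ?_, ?_, ?_⟩ <;> linarith

lemma anti_swap {r : ℝ} {F : ℝ × ℝ → ℝ} (hF : ∀ p : ℝ × ℝ, F (p.2, p.1) = - F p) : ∫ p in SQ r, F p = 0 := by
  refine anti_int (MeasurableEquiv.prodComm) (MeasureTheory.Measure.measurePreserving_swap) (fun p => ?_) hF
  simp only [mem_SQ, MeasurableEquiv.prodComm, MeasurableEquiv.coe_mk, Equiv.prodComm_apply, Prod.fst_swap, Prod.snd_swap]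
  constructor <;> rintro ⟨a, b, c, d⟩ <;> exact ⟨b, a, d, c⟩

lemma anti_refl {r : ℝ} {F : ℝ × ℝ → ℝ} (hF : ∀ p : ℝ × ℝ, F (-p.1, p.2) = - F p) : ∫ p in SQ r, F p = 0 := by
  refine anti_int (MeasurableEquiv.prodCongr (MeasurableEquiv.neg ℝ) (MeasurableEquiv.refl ℝ))
    ((MeasureTheory.Measure.measurePreserving_neg _).prod (MeasureTheory.MeasurePreserving.id _)) (fun p => ?_) hF
  change (-p.1, p.2) ∈ SQ r ↔ _
  simp only [mem_SQ]
  constructor <;> rintro ⟨a, b, c, d⟩ <;> refine ⟨?_, ?_, ?_, ?_⟩ <;> linarith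

lemma vol_rect {a b c d : ℝ} (h1 : a ≤ c) (h2 : b ≤ d) :
    MeasureTheory.volume.real (Icc ((a, b) : ℝ × ℝ) (c, d)) = (c - a) * (d - b) := by
  rw [Icc_prod_eq, MeasureTheory.Measure.volume_eq_prod, MeasureTheory.measureReal_prod_prod]
  simp [h1, h2]

lemma J_low {r α β : ℝ} (hr : 0 < r) (h : (α = 1 ∧ β = 0) ∨ (α = 0 ∧ β = 1)) :
    1 / 100 ≤ (96 / (r^2)^3) * ∫ p in SQ r, (HH α β p)^2 * wR r p := by
  have cH : Continuous (HH α β) := by unfold HH; fun_prop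
  have cw := wR_cont r
  have hint : MeasureTheory.IntegrableOn (fun p => (HH α β p)^2 * wR r p) (SQ r) :=
    ContinuousOn.integrableOn_compact isCompact_Icc (by fun_prop)
  have main : ∀ a b c d : ℝ, c = a + r / 4 → d = b + r / 4 → -r ≤ a → -r ≤ b → c ≤ r → d ≤ r →
      (∀ p ∈ Icc ((a, b) : ℝ × ℝ) (c, d), r^4 / 256 ≤ (HH α β p)^2 * wR r p) →
      r^6 / 4096 ≤ ∫ p in SQ r, (HH α β p)^2 * wR r p := by
    intro a b c d hc hd ha hb hc' hd' hp
    have hsub : Icc ((a, b) : ℝ × ℝ) (c, d) ⊆ SQ r := by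
      intro p hp
      rw [mem_Icc, Prod.le_def, Prod.le_def] at hp
      simp only at hp
      rw [mem_SQ]; refine ⟨?_, ?_, ?_, ?_⟩ <;> linarith [hp.1.1, hp.1.2, hp.2.1, hp.2.2]
    have h1 : ∫ p in Icc ((a, b) : ℝ × ℝ) (c, d), (HH α β p)^2 * wR r p ≤ ∫ p in SQ r, (HH α β p)^2 * wR r p := by
      refine MeasureTheory.setIntegral_mono_set hint (Eventually.of_forall fun p => ?_) (LE.le.eventuallyLE hsub)
      exact mul_nonneg (sq_nonneg _) (wR_nonneg _ _)
    have h2 := MeasureTheory.setIntegral_ge_of_const_le_real (c := r^4/256) (measurableSet_Icc (a := ((a, b) : ℝ × ℝ)) (b := (c, d)))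
      (isCompact_Icc.measure_lt_top.ne) hp (hint.mono_set hsub)
    rw [vol_rect (by linarith) (by linarith)] at h2
    have : r^4/256 * ((c - a) * (d - b)) = r^6/4096 := by rw [hc, hd]; ring
    linarith
  have key : r^6 / 4096 ≤ ∫ p in SQ r, (HH α β p)^2 * wR r p := by
    have wlow : ∀ p, qq p ≤ 5/8 * r^2 → 3/8 ≤ wR r p := by
      intro p hp
      refine le_trans ?_ (le_max_left _ _)
      have : qq p / r^2 ≤ 5/8 := by rw [div_le_iff₀ (by positivity)]; exact hp
      linarith
    rcases h with ⟨rfl, rfl⟩ | ⟨rfl, rfl⟩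
    · refine main (r/2) 0 (3*r/4) (r/4) (by ring) (by ring) (by linarith) (by linarith) (by linarith) (by linarith) ?_
      intro p hp
      rw [mem_Icc, Prod.le_def, Prod.le_def] at hp
      obtain ⟨⟨p1, p2⟩, p3, p4⟩ := hp
      simp only at p1 p2 p3 p4
      have hH : r^2 * (3/16) ≤ HH 1 0 p := by unfold HH; nlinarith
      have hw := wlow p (by unfold qq; nlinarith)
      have : (r^2 * (3/16))^2 ≤ (HH 1 0 p)^2 := by gcongr
      have : (r^2 * (3/16))^2 * (3/8) ≤ (HH 1 0 p)^2 * wR r p := by gcongr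
      nlinarith [pow_pos hr 4]
    · refine main (r/4) (r/4) (r/2) (r/2) (by ring) (by ring) (by linarith) (by linarith) (by linarith) (by linarith) ?_
      intro p hp
      rw [mem_Icc, Prod.le_def, Prod.le_def] at hp
      obtain ⟨⟨p1, p2⟩, p3, p4⟩ := hp
      simp only at p1 p2 p3 p4
      have hH : r^2 * (1/8) ≤ HH 0 1 p := by unfold HH; nlinarith
      have hw := wlow p (by unfold qq; nlinarith)
      have : (r^2 * (1/8))^2 ≤ (HH 0 1 p)^2 := by gcongr
      have : (r^2 * (1/8))^2 * (3/8) ≤ (HH 0 1 p)^2 * wR r p := by gcongr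
      nlinarith [pow_pos hr 4]
  rw [div_mul_eq_mul_div, le_div_iff₀ (by positivity)]
  nlinarith [pow_pos hr 6]
end

section
lemma coef {d : ℝ} (hd : 0 < d) (hd1 : d ≤ 1) {v vx vy vxx vxy vyy : ℝ × ℝ → ℝ}
    (hv : C2on (BX d) v vx vy vxx vxy vyy) {α β κ : ℝ} (hαβ : α^2 + β^2 ≤ 1)
    (hκ : (α = 1 ∧ β = 0 ∧ κ = (vxx 0 - vyy 0) / 4) ∨ (α = 0 ∧ β = 1 ∧ κ = vxy 0 / 2))
    {ε : ℝ} (hε : 0 < ε) :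
    ∃ r > 0, r ≤ d ∧ |κ| / 100 ≤ |(96 / (r^2)^3) * ∫ p in BX d, v p * (HH α β p * max (1 - qq p / r^2) 0)| + 1536 * ε := by
  obtain ⟨η, hη, hT⟩ := taylor2 hd hv hε
  set r := min (η / 2) d with hr
  have hr0 : 0 < r := by positivity
  have hrη : r < η := (min_le_left _ _).trans_lt (by linarith)
  have hrd : r ≤ d := min_le_right _ _
  refine ⟨r, hr0, hrd, ?_⟩
  have hsub : SQ r ⊆ BX d := by
    intro p hp
    rw [mem_SQ] at hp
    rw [mem_BX]
    refine ⟨?_, ?_, ?_, ?_⟩ <;> linarith [hp.1, hp.2.1, hp.2.2.1, hp.2.2.2]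
  have e1 : ∫ p in BX d, v p * (HH α β p * max (1 - qq p / r^2) 0) =
      ∫ p in SQ r, v p * (HH α β p * wR r p) := by
    refine (MeasureTheory.setIntegral_eq_of_subset_of_forall_sdiff_eq_zero measurableSet_Icc hsub ?_)
    intro p hp
    have := wR_out hr0 hp.2
    unfold wR at this
    rw [this]; ring
  rw [e1]
  set T : ℝ × ℝ → ℝ := fun p => v 0 + (vx 0 * p.1 + vy 0 * p.2) +
      (vxx 0 * p.1^2 + 2 * vxy 0 * p.1 * p.2 + vyy 0 * p.2^2) / 2 with hTdef
  have cH : Continuous (HH α β) := by unfold HH; fun_prop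
  have cw := wR_cont r
  have cv : ContinuousOn v (SQ r) := fun p hp => (hv.d0 p (hsub hp)).continuousAt.continuousWithinAt
  have cT : Continuous T := by rw [hTdef]; fun_prop
  have i1 : MeasureTheory.IntegrableOn (fun p => (v p - T p) * (HH α β p * wR r p)) (SQ r) :=
    ContinuousOn.integrableOn_compact isCompact_Icc (by fun_prop)
  have i2 : MeasureTheory.IntegrableOn (fun p => κ * ((HH α β p)^2 * wR r p)) (SQ r) :=
    ContinuousOn.integrableOn_compact isCompact_Icc (by fun_prop)
  have i3 : MeasureTheory.IntegrableOn (fun p => (vx 0 * p.1 + vy 0 * p.2) * (HH α β p * wR r p)) (SQ r) :=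
    ContinuousOn.integrableOn_compact isCompact_Icc (by fun_prop)
  have i4 : MeasureTheory.IntegrableOn (fun p => (T p - (vx 0 * p.1 + vy 0 * p.2) - κ * HH α β p) * (HH α β p * wR r p)) (SQ r) :=
    ContinuousOn.integrableOn_compact isCompact_Icc (by fun_prop)
  have wneg : ∀ p : ℝ × ℝ, wR r (-p) = wR r p := by intro p; simp [wR, qq]
  have wsw : ∀ p : ℝ × ℝ, wR r (p.2, p.1) = wR r p := by intro p; simp [wR, qq, add_comm]
  have wre : ∀ p : ℝ × ℝ, wR r (-p.1, p.2) = wR r p := by intro p; simp [wR, qq]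
  have z3 : ∫ p in SQ r, (vx 0 * p.1 + vy 0 * p.2) * (HH α β p * wR r p) = 0 := by
    apply anti_neg
    intro p; rw [wneg]; simp only [HH, Prod.fst_neg, Prod.snd_neg]; ring
  have z4 : ∫ p in SQ r, (T p - (vx 0 * p.1 + vy 0 * p.2) - κ * HH α β p) * (HH α β p * wR r p) = 0 := by
    rcases hκ with ⟨rfl, rfl, rfl⟩ | ⟨rfl, rfl, rfl⟩
    · apply anti_swap
      intro p; rw [wsw]; simp only [HH, hTdef]; ring
    · apply anti_refl
      intro p; rw [wre]; simp only [HH, hTdef]; ring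
  have split : ∫ p in SQ r, v p * (HH α β p * wR r p) =
      (∫ p in SQ r, (v p - T p) * (HH α β p * wR r p)) + κ * ∫ p in SQ r, (HH α β p)^2 * wR r p := by
    have : (fun p => v p * (HH α β p * wR r p)) = fun p => (((v p - T p) * (HH α β p * wR r p) + κ * ((HH α β p)^2 * wR r p))
        + (vx 0 * p.1 + vy 0 * p.2) * (HH α β p * wR r p)) + (T p - (vx 0 * p.1 + vy 0 * p.2) - κ * HH α β p) * (HH α β p * wR r p) := by
      funext p; ring
    have i12 : MeasureTheory.IntegrableOn (fun p => (v p - T p) * (HH α β p * wR r p) + κ * ((HH α β p)^2 * wR r p)) (SQ r) := i1.add i2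
    have i123 : MeasureTheory.IntegrableOn (fun p => ((v p - T p) * (HH α β p * wR r p) + κ * ((HH α β p)^2 * wR r p)) + (vx 0 * p.1 + vy 0 * p.2) * (HH α β p * wR r p)) (SQ r) := i12.add i3
    rw [this, MeasureTheory.integral_add i123 i4, MeasureTheory.integral_add i12 i3,
      MeasureTheory.integral_add i1 i2, z3, z4, MeasureTheory.integral_const_mul]
    ring
  have rem : |∫ p in SQ r, (v p - T p) * (HH α β p * wR r p)| ≤ (4 * ε * r^4) * (4 * r^2) := by
    have hvol : MeasureTheory.volume.real (SQ r) = 4 * r^2 := by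
      unfold SQ; rw [vol_rect (by linarith) (by linarith)]; ring
    rw [← hvol, ← Real.norm_eq_abs]
    refine MeasureTheory.norm_setIntegral_le_of_norm_le_const (isCompact_Icc.measure_lt_top) ?_
    intro p hp
    have hp' := mem_SQ.1 hp
    have n1 : |p.1| ≤ r := abs_le.2 ⟨hp'.1, hp'.2.2.1⟩
    have n2 : |p.2| ≤ r := abs_le.2 ⟨hp'.2.1, hp'.2.2.2⟩
    have hn : ‖p‖ ≤ r := by rw [Prod.norm_def]; exact max_le n1 n2
    have t := hT p (by linarith)
    have hq0 : 0 ≤ qq p := by unfold qq; positivity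
    have hq : qq p ≤ 2 * r^2 := (qq_le_norm p).trans (by gcongr)
    have hh := HH_bound hαβ p
    have w1 : |wR r p| ≤ 1 := by rw [abs_of_nonneg (wR_nonneg _ _)]; exact wR_le _ _
    rw [Real.norm_eq_abs, abs_mul, abs_mul]
    calc _ ≤ (ε * qq p) * (qq p * 1) := by gcongr
      _ ≤ (ε * (2*r^2)) * ((2 * r^2) * 1) := by gcongr
      _ = _ := by ring
  have J := J_low (α := α) (β := β) hr0 (by tauto)
  set Jv := ∫ p in SQ r, (HH α β p)^2 * wR r p
  set Rv := ∫ p in SQ r, (v p - T p) * (HH α β p * wR r p)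
  rw [split]
  have hrem : |(96 / (r^2)^3) * Rv| ≤ 1536 * ε := by
    rw [abs_mul, abs_of_pos (by positivity)]
    calc _ ≤ 96 / (r^2)^3 * ((4 * ε * r^4) * (4 * r^2)) := by gcongr
      _ = _ := by field_simp; ring
  have hk : |κ| / 100 ≤ |(96 / (r^2)^3) * (κ * Jv)| := by
    have : (96 / (r^2)^3) * (κ * Jv) = κ * ((96 / (r^2)^3) * Jv) := by ring
    rw [this, abs_mul]
    have h2 := le_abs_self ((96 / (r^2)^3) * Jv)
    nlinarith [abs_nonneg κ]
  rw [mul_add]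
  have := abs_sub_abs_le_abs_sub ((96 / (r^2)^3) * (κ * Jv)) (-((96 / (r^2)^3) * Rv))
  rw [sub_neg_eq_add, abs_neg, add_comm ((96 / (r^2)^3) * (κ * Jv))] at this
  linarith

/-- Lemma S -/
lemma lemS : ∃ C : ℝ, 0 < C ∧ ∀ (c d m G e : ℝ), 0 < d → d ≤ 1 →
    |c| ≤ 1 → 0 ≤ m → 0 ≤ G → 0 ≤ e →
    ∀ u ux uy uxx uxy uyy : ℝ × ℝ → ℝ, C2on (BX d) u ux uy uxx uxy uyy →
    (∀ p ∈ BX d, |u p| ≤ m) → (∀ p ∈ BX d, |uxx p + uyy p| ≤ G * (qq p) ^ (1/8:ℝ)) →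
    (d = 1 ∨ ∀ s ∈ Icc (-1:ℝ) 1, |uy (s, -d) - c * ux (s, -d)| ≤ e * d^2) →
    |uxy 0| ≤ C * (m + G + e) ∧ |uxx 0 - uyy 0| ≤ C * (m + G + e) := by
  obtain ⟨C1, hC1, H⟩ := est1
  refine ⟨400 * C1 + 1, by positivity, ?_⟩
  intro c d m G e hd hd1 hc hm hG he u ux uy uxx uxy uyy hu hum hlap hb
  have hv := (NN_C2.mono (subset_univ (BX d))).mul hu
  have key : ∀ α β κ : ℝ, α^2 + β^2 ≤ 1 → ((α = 1 ∧ β = 0 ∧ κ = (uxx 0 - uyy 0) / 4) ∨ (α = 0 ∧ β = 1 ∧ κ = uxy 0 / 2)) →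
      |κ| / 100 ≤ C1 * (m + G + e) := by
    intro α β κ hαβ hκ
    refine le_of_forall_pos_le_add (fun ε' hε' => ?_)
    have hnn : nn 0 = 1 := by norm_num [nn]
    have hnn1 : nn1 0 = 0 := by norm_num [nn1]
    have hnn2 : nn2 0 = 0 := by norm_num [nn2]
    obtain ⟨r, hr, hrd, h⟩ := coef (κ := κ) hd hd1 hv hαβ
      (by simpa [hnn, hnn1, hnn2] using hκ) (show 0 < ε' / 1536 by positivity)
    have h2 := H α β c d (r^2) m G e (by positivity) hαβ hd hd1 (by gcongr) hc hm hG he u ux uy uxx uxy uyy hu hum hlap hb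
    linarith
  have k1 := key 1 0 _ (by norm_num) (Or.inl ⟨rfl, rfl, rfl⟩)
  have k2 := key 0 1 _ (by norm_num) (Or.inr ⟨rfl, rfl, rfl⟩)
  rw [abs_div] at k1 k2
  norm_num at k1 k2
  have : 0 ≤ m + G + e := by positivity
  constructor <;> nlinarith [mul_nonneg hC1 this]
end

section
def Strp (X Y : ℝ) : Set (ℝ × ℝ) := {p | 0 < p.1 ∧ p.1 < X ∧ 0 < p.2 ∧ p.2 < Y}

lemma Strp_open (X Y : ℝ) : IsOpen (Strp X Y) := by
  have : Strp X Y = Ioo 0 X ×ˢ Ioo 0 Y := by ext p; simp [Strp, and_assoc]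
  rw [this]; exact isOpen_Ioo.prod isOpen_Ioo

structure SP (X Y a b δ K : ℝ) (O₁ O₂ O₃ O₄ O₅ u ux uy uxx uxy uyy : ℝ × ℝ → ℝ) : Prop where
  hX : 0 < X
  hX1 : X ≤ 1
  hY : 0 < Y
  ha : 0 < a
  hb : 0 < b
  hδ : 0 < δ
  hδ1 : δ < 1
  hK : 1 ≤ K
  s1 : K * X ≤ δ / 2
  s2 : K * X ≤ b / 2
  s3 : K ^ 2 * X ≤ δ * b / 2
  c2 : C2on (Strp X Y) u ux uy uxx uxy uyy
  cont : ContinuousOn u {p | 0 ≤ p.1 ∧ p.1 < X ∧ 0 ≤ p.2 ∧ p.2 < Y}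
  pos : ∀ p ∈ Strp X Y, 0 < u p
  ub : ∀ p : ℝ × ℝ, 0 ≤ p.1 → p.1 < X → 0 ≤ p.2 → p.2 < Y → 0 ≤ u p ∧ a * u p ≤ p.1 ^ 2
  bxx : ∀ p ∈ Strp X Y, |uxx p| ≤ K
  bxy : ∀ p ∈ Strp X Y, |uxy p| ≤ K
  byy : ∀ p ∈ Strp X Y, |uyy p| ≤ K
  bx : ∀ p ∈ Strp X Y, |ux p| ≤ K * p.1 ∧ a * ux p ≤ (2 - δ) * p.1
  bY : ∀ p ∈ Strp X Y, |uy p| ≤ K * p.2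
  o1 : ∀ p ∈ Strp X Y, |O₁ p| ≤ K * p.1 ^ 2
  o2 : ∀ p ∈ Strp X Y, |O₂ p| ≤ K * p.1
  o3 : ∀ p ∈ Strp X Y, |O₃ p| ≤ K * p.1
  o4 : ∀ p ∈ Strp X Y, |O₄ p| ≤ K * p.1
  o5 : ∀ p ∈ Strp X Y, |O₅ p| ≤ K * p.1
  l1 : ∀ p ∈ Strp X Y, ∀ q ∈ Strp X Y, |O₁ p - O₁ q| ≤ K * max p.1 q.1 * (|p.1 - q.1| + |p.2 - q.2|)
  l2 : ∀ p ∈ Strp X Y, ∀ q ∈ Strp X Y, |O₂ p - O₂ q| ≤ K * (|p.1 - q.1| + |p.2 - q.2|)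
  l3 : ∀ p ∈ Strp X Y, ∀ q ∈ Strp X Y, |O₃ p - O₃ q| ≤ K * (|p.1 - q.1| + |p.2 - q.2|)
  l4 : ∀ p ∈ Strp X Y, ∀ q ∈ Strp X Y, |O₄ p - O₄ q| ≤ K * (|p.1 - q.1| + |p.2 - q.2|)
  l5 : ∀ p ∈ Strp X Y, ∀ q ∈ Strp X Y, |O₅ p - O₅ q| ≤ K * (|p.1 - q.1| + |p.2 - q.2|)
  eq : ∀ p ∈ Strp X Y, (2 * p.1 - a * ux p + O₁ p) * uxx p + O₂ p * uxy p + (b + O₃ p) * uyy p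
    - (1 + O₄ p) * ux p + O₅ p * uy p = 0

lemma min_1d {g g' : ℝ → ℝ} {g2 : ℝ} (h1 : ∀ᶠ t in nhds 0, HasDerivAt g (g' t) t) (h2 : HasDerivAt g' g2 0)
    (hm : IsLocalMin g 0) : g' 0 = 0 ∧ 0 ≤ g2 := by
  have h10 := h1.self_of_nhds
  have e0 : g' 0 = 0 := hm.hasDerivAt_eq_zero h10
  refine ⟨e0, ?_⟩
  by_contra hneg
  push Not at hneg
  have hd : deriv g =ᶠ[nhds 0] g' := h1.mono fun t ht => ht.deriv
  have hdd : deriv (deriv g) 0 = g2 := by rw [hd.deriv_eq, h2.deriv]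
  have hM : IsLocalMax g 0 := isLocalMax_of_deriv_deriv_neg (by rw [hdd]; exact hneg) (by rw [h10.deriv, e0]) h10.continuousAt
  have hc : g =ᶠ[nhds 0] fun _ => g 0 := by
    filter_upwards [hm, hM] with t ha hb
    exact le_antisymm hb ha
  have : deriv g =ᶠ[nhds 0] fun _ => 0 := by
    have := hc.deriv
    simpa using this
  have h3 := this.deriv_eq
  rw [hdd] at h3
  simp at h3
  linarith

lemma min_2d {U : Set (ℝ × ℝ)} (hU : IsOpen U) {w wx wy wxx wxy wyy : ℝ × ℝ → ℝ}
    (hw : C2on U w wx wy wxx wxy wyy) {p : ℝ × ℝ} (hp : p ∈ U) (hm : IsLocalMin w p) :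
    wx p = 0 ∧ wy p = 0 ∧ ∀ A E B : ℝ, 0 < A → 0 < B → E^2 ≤ 4 * A * B →
      0 ≤ A * wxx p + E * wxy p + B * wyy p := by
  have dir : ∀ v1 v2 : ℝ, wx p * v1 + wy p * v2 = 0 ∧
      0 ≤ (wxx p * v1 + wxy p * v2) * v1 + (wxy p * v1 + wyy p * v2) * v2 := by
    intro v1 v2
    have hl : ∀ t : ℝ, HasDerivAt (fun t : ℝ => ((p.1 + t * v1, p.2 + t * v2) : ℝ × ℝ)) (v1, v2) t := by
      intro t
      have a1 := ((hasDerivAt_id t).mul_const v1).const_add p.1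
      have a2 := ((hasDerivAt_id t).mul_const v2).const_add p.2
      simpa using a1.prodMk a2
    have hlc : Continuous (fun t : ℝ => ((p.1 + t * v1, p.2 + t * v2) : ℝ × ℝ)) := by fun_prop
    have h0 : ((p.1 + 0 * v1, p.2 + 0 * v2) : ℝ × ℝ) = p := by simp
    have hin : ∀ᶠ t in nhds (0:ℝ), ((p.1 + t * v1, p.2 + t * v2) : ℝ × ℝ) ∈ U :=
      hlc.continuousAt.eventually (by beta_reduce; rw [h0]; exact hU.mem_nhds hp)
    have comp : ∀ (v va vb : ℝ × ℝ → ℝ) (t : ℝ), HasFDerivAt v (linF (va (p.1 + t * v1, p.2 + t * v2)) (vb (p.1 + t * v1, p.2 + t * v2))) (p.1 + t * v1, p.2 + t * v2) →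
        HasDerivAt (fun t : ℝ => v (p.1 + t * v1, p.2 + t * v2))
          (va (p.1 + t * v1, p.2 + t * v2) * v1 + vb (p.1 + t * v1, p.2 + t * v2) * v2) t := by
      intro v va vb t h
      refine HasDerivAt.congr_deriv (HasFDerivAt.comp_hasDerivAt (l := v) t h (hl t)) ?_
      simp
    have h1 : ∀ᶠ t in nhds (0:ℝ), HasDerivAt (fun t : ℝ => w (p.1 + t * v1, p.2 + t * v2))
        (wx (p.1 + t * v1, p.2 + t * v2) * v1 + wy (p.1 + t * v1, p.2 + t * v2) * v2) t :=
      hin.mono fun t ht => comp w wx wy t (hw.d0 _ ht)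
    have h2 := ((comp wx wxx wxy 0 (by rw [h0]; exact hw.d1 _ hp)).mul_const v1).add
      ((comp wy wxy wyy 0 (by rw [h0]; exact hw.d2 _ hp)).mul_const v2)
    have hmin : IsLocalMin (fun t : ℝ => w (p.1 + t * v1, p.2 + t * v2)) 0 := by
      have : Tendsto (fun t : ℝ => ((p.1 + t * v1, p.2 + t * v2) : ℝ × ℝ)) (nhds 0) (nhds p) := by
        have := hlc.tendsto 0
        rwa [h0] at this
      have h3 := this.eventually hm
      unfold IsLocalMin IsMinFilter
      simpa using h3
    have := min_1d h1 h2 hmin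
    simpa using this
  have hx : wx p = 0 := by simpa using (dir 1 0).1
  have hy : wy p = 0 := by simpa using (dir 0 1).1
  refine ⟨hx, hy, fun A E B hA hB hE => ?_⟩
  have d1 := (dir (E/2) B).2
  have d2 := (dir 1 0).2
  simp only [mul_one, mul_zero, add_zero] at d2
  have : 0 ≤ B * (A * wxx p + E * wxy p + B * wyy p) := by
    have : 0 ≤ (A * B - E^2/4) * wxx p := mul_nonneg (by linarith) d2
    nlinarith
  exact nonneg_of_mul_nonneg_right (by linarith) hB

lemma cmp_rect {X0 X1 Y1 : ℝ} {w : ℝ × ℝ → ℝ}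
    (hc : ContinuousOn w (Icc X0 X1 ×ˢ Icc 0 Y1))
    (hl : ∀ y ∈ Icc 0 Y1, 0 ≤ w (X0, y)) (hr : ∀ y ∈ Icc 0 Y1, 0 ≤ w (X1, y))
    (ht : ∀ x ∈ Icc X0 X1, 0 ≤ w (x, Y1))
    (hb : ∀ x ∈ Ioo X0 X1, ∃ h ∈ Icc 0 Y1, w (x, h) < w (x, 0))
    (hi : ∀ p : ℝ × ℝ, X0 < p.1 → p.1 < X1 → 0 < p.2 → p.2 < Y1 → IsLocalMin w p → w p < 0 → False) :
    ∀ p : ℝ × ℝ, p.1 ∈ Icc X0 X1 → p.2 ∈ Icc 0 Y1 → 0 ≤ w p := by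
  intro p0 h1 h2
  by_contra hneg
  push Not at hneg
  obtain ⟨p, hp, hmin⟩ := (isCompact_Icc.prod isCompact_Icc).exists_isMinOn ⟨p0, h1, h2⟩ hc
  have hpneg : w p < 0 := (hmin (show p0 ∈ _ from ⟨h1, h2⟩)).trans_lt hneg
  obtain ⟨x, y⟩ := p
  obtain ⟨hx, hy⟩ := hp
  simp only at hx hy
  have nx0 : x ≠ X0 := by rintro rfl; linarith [hl y hy]
  have nx1 : x ≠ X1 := by rintro rfl; linarith [hr y hy]
  have ny1 : y ≠ Y1 := by rintro rfl; linarith [ht x hx]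
  have gx0 : X0 < x := lt_of_le_of_ne hx.1 (Ne.symm nx0)
  have gx1 : x < X1 := lt_of_le_of_ne hx.2 nx1
  have gy1 : y < Y1 := lt_of_le_of_ne hy.2 ny1
  have ny0 : y ≠ 0 := by
    rintro rfl
    obtain ⟨h, hh, hlt⟩ := hb x ⟨gx0, gx1⟩
    have := hmin (show (x, h) ∈ Icc X0 X1 ×ˢ Icc 0 Y1 from ⟨hx, hh⟩)
    simp only [mem_ofPred_eq] at this
    linarith
  have gy0 : 0 < y := lt_of_le_of_ne hy.1 (Ne.symm ny0)
  refine hi (x, y) gx0 gx1 gy0 gy1 ?_ hpneg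
  exact hmin.isLocalMin (prod_mem_nhds (Icc_mem_nhds gx0 gx1) (Icc_mem_nhds gy0 gy1))

section
variable {X Y a b δ K : ℝ} {O₁ O₂ O₃ O₄ O₅ u ux uy uxx uxy uyy : ℝ × ℝ → ℝ}

lemma SP.A_low (h : SP X Y a b δ K O₁ O₂ O₃ O₄ O₅ u ux uy uxx uxy uyy) {p : ℝ × ℝ} (hp : p ∈ Strp X Y) :
    δ / 2 * p.1 ≤ 2 * p.1 - a * ux p + O₁ p := by
  have h1 := (h.bx p hp).2
  have h2 := (abs_le.1 (h.o1 p hp)).1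
  have h3 : K * p.1 ≤ δ / 2 := (mul_le_mul_of_nonneg_left hp.2.1.le (by linarith [h.hK])).trans h.s1
  nlinarith [hp.1]

lemma SP.A_up (h : SP X Y a b δ K O₁ O₂ O₃ O₄ O₅ u ux uy uxx uxy uyy) {p : ℝ × ℝ} (hp : p ∈ Strp X Y) :
    2 * p.1 - a * ux p + O₁ p ≤ (3 + a * K) * p.1 := by
  have h1 := (abs_le.1 (h.bx p hp).1).1
  have h2 := (abs_le.1 (h.o1 p hp)).2
  have h3 : K * p.1 ≤ δ / 2 := (mul_le_mul_of_nonneg_left hp.2.1.le (by linarith [h.hK])).trans h.s1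
  nlinarith [hp.1, h.hδ1, mul_le_mul_of_nonneg_left h1 h.ha.le]

lemma SP.Kx (h : SP X Y a b δ K O₁ O₂ O₃ O₄ O₅ u ux uy uxx uxy uyy) {p : ℝ × ℝ} (hp : p ∈ Strp X Y) :
    K * p.1 ≤ δ / 2 ∧ K * p.1 ≤ b / 2 ∧ K * p.1 ≤ 1 / 2 ∧ K^2 * p.1 ≤ δ * b / 2 := by
  have h3 : K * p.1 ≤ K * X := mul_le_mul_of_nonneg_left hp.2.1.le (by linarith [h.hK])
  have h4 : K^2 * p.1 ≤ K^2 * X := mul_le_mul_of_nonneg_left hp.2.1.le (by positivity)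
  refine ⟨h3.trans h.s1, h3.trans h.s2, ?_, h4.trans h.s3⟩
  linarith [h.s1, h.hδ1]

lemma SP.B_bd (h : SP X Y a b δ K O₁ O₂ O₃ O₄ O₅ u ux uy uxx uxy uyy) {p : ℝ × ℝ} (hp : p ∈ Strp X Y) :
    b / 2 ≤ b + O₃ p ∧ b + O₃ p ≤ 2 * b := by
  have h2 := abs_le.1 (h.o3 p hp)
  have h3 := (h.Kx hp).2.1
  have := h.hb
  constructor <;> linarith [h2.1, h2.2]

lemma SP.ell (h : SP X Y a b δ K O₁ O₂ O₃ O₄ O₅ u ux uy uxx uxy uyy) {p : ℝ × ℝ} (hp : p ∈ Strp X Y) :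
    (O₂ p)^2 ≤ 2 * ((2 * p.1 - a * ux p + O₁ p) * (b + O₃ p)) := by
  have h1 := h.A_low hp
  have h2 := (h.B_bd hp).1
  have h3 := h.o2 p hp
  have h4 := (h.Kx hp).2.2.2
  have hb := h.hb
  have hd := h.hδ
  have hx := hp.1
  have h5 : (O₂ p)^2 ≤ (K * p.1)^2 := by rw [← sq_abs]; gcongr
  calc _ ≤ (K * p.1)^2 := h5
    _ = K^2 * p.1 * p.1 := by ring
    _ ≤ (δ * b / 2) * p.1 := by gcongr
    _ = 2 * ((δ / 2 * p.1) * (b/2)) := by ring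
    _ ≤ _ := by
      have : 0 ≤ 2 * p.1 - a * ux p + O₁ p := le_trans (by positivity) h1
      gcongr

lemma SP.u_y0 (h : SP X Y a b δ K O₁ O₂ O₃ O₄ O₅ u ux uy uxx uxy uyy) {x t : ℝ} (hx : 0 < x) (hxX : x < X)
    (ht : 0 ≤ t) (htY : t < Y) : |u (x, t) - u (x, 0)| ≤ K * t * t := by
  have hc : ContinuousOn (fun s => u (x, s)) (Icc 0 t) := by
    refine h.cont.comp (by fun_prop) ?_
    intro s hs
    exact ⟨hx.le, hxX, hs.1, hs.2.trans_lt htY⟩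
  have hd : ∀ s ∈ Ico (0:ℝ) t, True := fun _ _ => trivial
  rcases ht.eq_or_lt with rfl | ht0
  · simp
  obtain ⟨s, hs, e⟩ := exists_hasDerivAt_eq_slope (fun s => u (x, s)) (fun s => uy (x, s)) ht0 hc
    (fun s hs => linF_dy (h.c2.d0 (x, s) ⟨hx, hxX, hs.1, hs.2.trans htY⟩))
  have hb := h.bY (x, s) ⟨hx, hxX, hs.1, hs.2.trans htY⟩
  rw [e, abs_div, sub_zero, abs_of_pos ht0, div_le_iff₀ ht0] at hb
  refine hb.trans ?_
  have := h.hK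
  have := hs.2.le
  simp only
  gcongr

lemma SP.cmp (h : SP X Y a b δ K O₁ O₂ O₃ O₄ O₅ u ux uy uxx uxy uyy) {σ : ℝ} (hσ : σ = 1 ∨ σ = -1)
    {X0 X1 Y1 : ℝ} (hX0 : 0 ≤ X0) (hX1 : X1 < X) (hY1 : 0 < Y1) (hY1Y : Y1 < Y)
    {φ φx φy φxx φxy φyy : ℝ × ℝ → ℝ} (hφ : C2on {p | 0 < p.1} φ φx φy φxx φxy φyy)
    (hφc : ContinuousOn φ (Icc X0 X1 ×ˢ Icc 0 Y1))
    (hl : ∀ y ∈ Icc 0 Y1, 0 ≤ σ * (u (X0, y) - φ (X0, y)))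
    (hr : ∀ y ∈ Icc 0 Y1, 0 ≤ σ * (u (X1, y) - φ (X1, y)))
    (ht : ∀ x ∈ Icc X0 X1, 0 ≤ σ * (u (x, Y1) - φ (x, Y1)))
    (hb : ∀ x ∈ Ioo X0 X1, 0 < σ * φy (x, 0))
    (hN : ∀ p : ℝ × ℝ, p ∈ Strp X Y → X0 < p.1 → p.1 < X1 → p.2 < Y1 → σ * (u p - φ p) < 0 →
      ux p = φx p → uy p = φy p →
      0 < σ * ((2 * p.1 - a * φx p + O₁ p) * φxx p + O₂ p * φxy p + (b + O₃ p) * φyy p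
    - (1 + O₄ p) * φx p + O₅ p * φy p)) :
    ∀ p : ℝ × ℝ, p.1 ∈ Icc X0 X1 → p.2 ∈ Icc 0 Y1 → 0 ≤ σ * (u p - φ p) := by
  have hσ2 : σ * σ = 1 := by rcases hσ with rfl | rfl <;> norm_num
  have hσa : |σ| = 1 := by rcases hσ with rfl | rfl <;> norm_num
  refine cmp_rect (w := fun p => σ * (u p - φ p)) ?_ hl hr ht ?_ ?_
  · refine ContinuousOn.mul continuousOn_const (ContinuousOn.sub (h.cont.mono ?_) hφc)
    rintro p ⟨h1, h2⟩
    exact ⟨hX0.trans h1.1, h1.2.trans_lt hX1, h2.1, h2.2.trans_lt hY1Y⟩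
  · intro x hx
    have hx0 : 0 < x := hX0.trans_lt hx.1
    have hxX : x < X := hx.2.trans hX1
    have hd := linF_dy (hφ.d0 (x, 0) hx0)
    have hc := hb x hx
    set c := σ * φy (x, 0) with hcdef
    have hbd := hd.isLittleO.bound (show 0 < c / 4 by positivity)
    obtain ⟨η, hη, hbd⟩ := Metric.eventually_nhds_iff_ball.1 hbd
    have hK := h.hK
    set t := min (min (η/2) Y1) (c / (4 * K)) with htdef
    have ht0 : 0 < t := by positivity
    have t1 : t ≤ η / 2 := (min_le_left _ _).trans (min_le_left _ _)
    have t2 : t ≤ Y1 := (min_le_left _ _).trans (min_le_right _ _)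
    have t3 : K * t ≤ c / 4 := by
      calc K * t ≤ K * (c / (4 * K)) := by gcongr; exact min_le_right _ _
        _ = _ := by field_simp
    refine ⟨t, ⟨ht0.le, t2⟩, ?_⟩
    have e1 := hbd t (by rw [mem_ball_zero_iff, Real.norm_eq_abs, abs_of_pos ht0]; linarith)
    have e2 := h.u_y0 hx0 hxX ht0.le (t2.trans_lt hY1Y)
    simp only [sub_zero, Real.norm_eq_abs, smul_eq_mul, abs_of_pos ht0] at e1
    have e3 : |σ * (φ (x, t) - φ (x, 0) - t * φy (x, 0))| ≤ c / 4 * t := by rw [abs_mul, hσa, one_mul]; exact e1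
    have e4 : |σ * (u (x, t) - u (x, 0))| ≤ K * t * t := by rw [abs_mul, hσa, one_mul]; exact e2
    have e5 := (abs_le.1 e3).1
    have e6 := (abs_le.1 e4).2
    have e7 : K * t * t ≤ c / 4 * t := by gcongr
    have e8 : 0 < c * t := by positivity
    have e9 : σ * (φ (x, t) - φ (x, 0) - t * φy (x, 0)) = σ * (φ (x, t) - φ (x, 0)) - c * t := by rw [hcdef]; ring
    rw [e9] at e5
    nlinarith
  · intro p p1 p2 p3 p4 hmin hneg
    have hp : p ∈ Strp X Y := ⟨hX0.trans_lt p1, p2.trans hX1, p3, p4.trans hY1Y⟩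
    have hw := (C2on_fst (U := Strp X Y) (g := fun _ => σ) (g1 := fun _ => 0) (g2 := fun _ => 0)
      (fun p _ => hasDerivAt_const _ _) (fun p _ => hasDerivAt_const _ _) continuousOn_const).mul (h.c2.sub (hφ.mono (fun q hq => hq.1)))
    obtain ⟨w1, w2, w3⟩ := min_2d (Strp_open X Y) hw hp hmin
    have hs0 : σ ≠ 0 := by rintro rfl; norm_num at hσ2
    simp only [zero_mul, add_zero, mul_zero, zero_add] at w1 w2 w3
    have wx : ux p = φx p := by
      rcases mul_eq_zero.1 w1 with h1 | h1
      · exact absurd h1 hs0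
      · linarith
    have wy : uy p = φy p := by
      rcases mul_eq_zero.1 w2 with h1 | h1
      · exact absurd h1 hs0
      · linarith
    have hb := h.hb
    have hAl : 0 < 2 * p.1 - a * ux p + O₁ p := lt_of_lt_of_le (mul_pos (by linarith [h.hδ]) hp.1) (h.A_low hp)
    have hB : 0 < b + O₃ p := lt_of_lt_of_le (by linarith) (h.B_bd hp).1
    have key := w3 _ (O₂ p) _ hAl hB (by nlinarith [h.ell hp, mul_pos hAl hB])
    have n := hN p hp p1 p2 p4 hneg wx wy
    have e := h.eq p hp
    rw [← wx, ← wy] at n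
    have : σ * ((2 * p.1 - a * ux p + O₁ p) * uxx p + O₂ p * uxy p + (b + O₃ p) * uyy p
    - (1 + O₄ p) * ux p + O₅ p * uy p) = 0 := by rw [e]; ring
    nlinarith

end
end

section
lemma hopf_alg {a b K L M μ A B v o4 o5 y : ℝ} (hb : 0 < b) (ha : 0 < a) (hK0 : 0 < K) (hL0 : 0 < L) (hM0 : 1 ≤ M) (hμ0 : 0 < μ)
    (hbM : b * M = b + L * (8 + 2 * a * K) * 2) (hA1 : A ≤ 3 + a * K) (hB : b / 2 ≤ B)
    (uxb : |v| ≤ μ * L) (h4 : |1 + o4| ≤ 2) (h5 : -(b/2) ≤ o5) (hy : 0 ≤ y) (hy1 : y ≤ 1/4) :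
    0 < A * (-2 * μ * L) + B * (2 * μ * M) - (1 + o4) * v + o5 * (μ * (2 * M * y + 1)) := by
  have t1 : A * (-2 * μ * L) ≥ -(3 + a * K) * (2 * μ * L) := by
    have : 0 < 2 * μ * L := by positivity
    nlinarith
  have t2 : B * (2 * μ * M) ≥ b / 2 * (2 * μ * M) := by gcongr
  have t3 : |(1 + o4) * v| ≤ 2 * (μ * L) := by
    rw [abs_mul]
    gcongr
  have t4 : o5 * (μ * (2 * M * y + 1)) ≥ -(b/2) * (μ * (M / 2 + 1)) := by
    have g1 : 0 ≤ μ * (2 * M * y + 1) := by positivity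
    have g2 : μ * (2 * M * y + 1) ≤ μ * (M / 2 + 1) := by gcongr; nlinarith
    nlinarith
  have t3' := (abs_le.1 t3).2
  have fin : 0 < μ * (-(3 + a * K) * (2 * L) + b * M - 2 * L - (b/2) * (M/2+1)) := by
    apply mul_pos hμ0
    have : 0 < L * (a * K) := by positivity
    nlinarith
  have e : μ * (-(3 + a * K) * (2 * L) + b * M - 2 * L - (b/2) * (M/2+1)) =
    -(3 + a * K) * (2 * μ * L) + b / 2 * (2 * μ * M) - 2 * (μ * L) + -(b/2) * (μ * (M / 2 + 1)) := by ring
  linarith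

section
variable {X Y a b δ K : ℝ} {O₁ O₂ O₃ O₄ O₅ u ux uy uxx uxy uyy : ℝ × ℝ → ℝ}

lemma SP.hopf (h : SP X Y a b δ K O₁ O₂ O₃ O₄ O₅ u ux uy uxx uxy uyy) {ξ : ℝ} (hξ : 0 < ξ) (hξX : 2 * ξ < X) :
    0 < u (ξ, 0) := by
  have ha := h.ha
  have hb := h.hb
  have hK := h.hK
  have hY := h.hY
  have hX1 := h.hX1
  have hK0 : 0 < K := by linarith
  set L := 12 / ξ^2 with hL
  have hL0 : 0 < L := by positivity
  set M := 1 + L * (8 + 2 * a * K) * 2 / b with hM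
  have hM0 : 1 ≤ M := by rw [hM]; have : 0 ≤ L * (8 + 2 * a * K) * 2 / b := by positivity
                         linarith
  have hbM : b * M = b + L * (8 + 2 * a * K) * 2 := by rw [hM]; field_simp
  set η := min (min (1/4) (1/M)) (Y/2) with hη
  have hη0 : 0 < η := by positivity
  have η1 : η ≤ 1/4 := (min_le_left _ _).trans (min_le_left _ _)
  have η2 : M * η ≤ 1 := by
    calc M * η ≤ M * (1/M) := by gcongr; exact (min_le_left _ _).trans (min_le_right _ _)
      _ = 1 := by field_simp
  have η3 : η < Y := (min_le_right _ _).trans_lt (by linarith)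
  have cm : ContinuousOn (fun x => u (x, η)) (Icc (ξ/2) (3*ξ/2)) := by
    refine h.cont.comp (by fun_prop) ?_
    intro x hx
    exact ⟨by linarith [hx.1], by linarith [hx.2], hη0.le, η3⟩
  obtain ⟨xm, hxm, hmin⟩ := isCompact_Icc.exists_isMinOn (nonempty_Icc.2 (by linarith)) cm
  have m0 : 0 < u (xm, η) := h.pos _ ⟨by simp only; linarith [hxm.1], by simp only; linarith [hxm.2], hη0, η3⟩
  set μ := u (xm, η) / 3 with hμ
  have hμ0 : 0 < μ := by positivity
  have C1 := C2on_fst (U := {p : ℝ × ℝ | 0 < p.1}) (g := fun x => μ * (1 - L * (x - ξ)^2)) (g1 := fun x => -2 * μ * L * (x - ξ))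
    (g2 := fun _ => -2 * μ * L) (fun p _ => by
      have := ((((hasDerivAt_id p.1).sub_const ξ).pow 2).const_mul L).const_sub 1 |>.const_mul μ
      refine this.congr_deriv ?_
      simp only [id, Nat.cast_ofNat, Nat.add_one_sub_one, pow_one]; ring) (fun p _ => by
      have := ((hasDerivAt_id p.1).sub_const ξ).const_mul (-2 * μ * L)
      simpa using this) continuousOn_const
  have C2 := C2on_snd (U := {p : ℝ × ℝ | 0 < p.1}) (g := fun y => μ * (M * y^2 + y)) (g1 := fun y => μ * (2 * M * y + 1))
    (g2 := fun _ => 2 * μ * M) (fun p _ => by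
      have := ((((hasDerivAt_id p.2).pow 2).const_mul M).add (hasDerivAt_id p.2)).const_mul μ
      refine this.congr_deriv ?_
      simp only [id, Nat.cast_ofNat, Nat.add_one_sub_one, pow_one]; ring) (fun p _ => by
      have := (((hasDerivAt_id p.2).const_mul (2 * M)).add_const 1).const_mul μ
      refine this.congr_deriv ?_
      ring) continuousOn_const
  have top : ∀ y ∈ Icc 0 η, μ * (M * y^2 + y) ≤ 2 * μ := by
    intro y hy
    have : M * y^2 + y ≤ 2 := by
      have : M * y * y ≤ M * η * η := by
        have := hy.1; have := hy.2; gcongr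
      nlinarith [hy.2]
    calc μ * (M * y^2 + y) ≤ μ * 2 := mul_le_mul_of_nonneg_left this hμ0.le
      _ = 2 * μ := mul_comm _ _
  have key := h.cmp (σ := 1) (Or.inl rfl) (X0 := ξ/2) (X1 := 3*ξ/2) (Y1 := η) (by linarith) (by linarith) hη0 η3
    (C1.add C2) (((continuous_const.mul (continuous_const.sub (continuous_const.mul ((continuous_fst.sub continuous_const).pow 2)))).add (continuous_const.mul ((continuous_const.mul (continuous_snd.pow 2)).add continuous_snd))).continuousOn) ?_ ?_ ?_ ?_ ?_ (ξ, 0) ⟨by simp only; linarith, by simp only; linarith⟩ ⟨le_rfl, hη0.le⟩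
  · simp at key
    have : 0 < μ := hμ0
    linarith
  · intro y hy
    have h1 := (h.ub (ξ/2, y) (by simp only; linarith) (by simp only; linarith) hy.1 (hy.2.trans_lt η3)).1
    have h2 := top y hy
    have h3 : μ * (1 - L * (ξ/2 - ξ)^2) = - 2 * μ := by rw [hL]; field_simp; ring
    simp only [h3]
    linarith
  · intro y hy
    have h1 := (h.ub (3*ξ/2, y) (by simp only; linarith) (by simp only; linarith) hy.1 (hy.2.trans_lt η3)).1
    have h2 := top y hy
    have h3 : μ * (1 - L * (3*ξ/2 - ξ)^2) = - 2 * μ := by rw [hL]; field_simp; ring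
    simp only [h3]
    linarith
  · intro x hx
    have h1 : u (xm, η) ≤ u (x, η) := hmin hx
    have h2 := top η ⟨hη0.le, le_rfl⟩
    have h3 : μ * (1 - L * (x - ξ)^2) ≤ μ := by linarith only [mul_nonneg hμ0.le (mul_nonneg hL0.le (sq_nonneg (x - ξ)))]
    have h4 : u (xm, η) = 3 * μ := by rw [hμ]; ring
    simp only
    linarith
  · intro x hx
    simp [hμ0]
  · intro p hp q1 q2 q3 _ e1 _
    have hA := h.A_up hp
    have hx1 : p.1 ≤ 1 := hp.2.1.le.trans hX1
    have hA1 : 2 * p.1 - a * ux p + O₁ p ≤ 3 + a * K := by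
      refine hA.trans ?_
      have : 0 ≤ 3 + a * K := by positivity
      exact (mul_le_of_le_one_right this hx1)
    have hB := (h.B_bd hp).1
    have o4 := h.o4 p hp
    have o5 := abs_le.1 (h.o5 p hp)
    have kx := h.Kx hp
    simp only [add_zero] at e1 ⊢
    rw [← e1]
    have uxb : |ux p| ≤ μ * L := by
      rw [e1, abs_mul, show |(-2 * μ * L)| = 2 * μ * L by rw [show -2 * μ * L = -(2 * μ * L) by ring, abs_neg, abs_of_pos (by positivity)]]
      have : |p.1 - ξ| ≤ 1/2 := by rw [abs_le]; constructor <;> linarith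
      have h2 := mul_le_mul_of_nonneg_left this (show 0 ≤ 2 * μ * L by positivity)
      linarith only [h2]
    have o4b : |1 + O₄ p| ≤ 2 := by rw [abs_le] at o4 ⊢; constructor <;> linarith [o4.1, o4.2]
    have := hopf_alg (o5 := O₅ p) (y := p.2) hb ha hK0 hL0 hM0 hμ0 hbM hA1 hB uxb o4b (by linarith [o5.1]) hp.2.2.1.le (by linarith)
    linarith

lemma SP.u_pos (h : SP X Y a b δ K O₁ O₂ O₃ O₄ O₅ u ux uy uxx uxy uyy) {ξ y : ℝ} (hξ : 0 < ξ) (hξX : 2 * ξ < X)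
    (hy : 0 ≤ y) (hyY : y < Y) : 0 < u (ξ, y) := by
  rcases hy.eq_or_lt with rfl | hy
  · exact h.hopf hξ hξX
  · exact h.pos _ ⟨hξ, by simp only; linarith, hy, hyY⟩

lemma nd_alg {a b K y1 x μ k k' o1 o2 B3 o4 o5 : ℝ} (hb : 0 < b) (hK : 0 < K) (hx : 0 < x) (hx1 : x ≤ 1) (hμ : 0 < μ) (hk : 0 < k)
    (hkk : k'^2 = 16 * y1^2 - 12 * k) (hk4 : |k'| ≤ 4 * y1) (hy1 : 0 < y1)
    (hs : a * μ * k^2 ≤ 1/8) (hKx : K * x ≤ 1/8)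
    (hR : x * (18 * b + 12 * K * y1)^2 < 8 * b * y1^2)
    (h1 : |o1| ≤ K * x^2) (h2 : |o2| ≤ K * x) (h3 : b / 2 ≤ B3) (h3' : B3 ≤ 2 * b) (h4 : |o4| ≤ K * x) (h5 : |o5| ≤ K * x) :
    0 < (2 * x - a * (2 * x * (μ * k^2)) + o1) * (2 * (μ * k^2)) + o2 * (2 * x * (μ * (2 * k * k'))) +
      B3 * (x^2 * (μ * (2 * k'^2 - 12 * k))) - (1 + o4) * (2 * x * (μ * k^2)) + o5 * (x^2 * (μ * (2 * k * k'))) := by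
  have e1 : -(2 * K * x^2 * k^2) ≤ (o1 - o4 * x) * k^2 := by
    have : -(2 * K * x^2) ≤ o1 - o4 * x := by
      have i1 := (abs_le.1 h1).1
      have i2 := mul_le_mul_of_nonneg_right (abs_le.1 h4).2 hx.le
      linarith only [i1, i2]
    have := mul_le_mul_of_nonneg_right this (sq_nonneg k)
    linarith only [this]
  have e2 : -(3 * K * x^2 * (k * (4 * y1))) ≤ (2 * o2 * x + o5 * x^2) * (k * k') := by
    have g1 : |2 * o2 * x + o5 * x^2| ≤ 3 * K * x^2 := by
      have : |2 * o2 * x + o5 * x^2| ≤ 2 * |o2| * x + |o5| * x^2 := by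
        refine (abs_add_le _ _).trans ?_
        rw [abs_mul, abs_mul, abs_mul, abs_of_pos hx, abs_of_pos (show (0:ℝ) < 2 by norm_num), abs_of_pos (show 0 < x^2 by positivity)]
      have g3 : |o5| * x^2 ≤ K * x * x^2 := by gcongr
      have g4 : K * x * x^2 ≤ K * x^2 := by
        have : 0 < K * x^2 := by positivity
        have := mul_le_mul_of_nonneg_left hx1 this.le
        linarith only [this]
      have g5 := mul_le_mul_of_nonneg_right h2 hx.le
      linarith only [this, g3, g4, g5]
    have g2 : |(2 * o2 * x + o5 * x^2) * (k * k')| ≤ 3 * K * x^2 * (k * (4 * y1)) := by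
      rw [abs_mul, abs_mul, abs_of_pos hk]
      gcongr
    exact (abs_le.1 g2).1
  have e3 : x^2 * (b / 2 * k'^2) - x^2 * (12 * b * k) ≤ B3 * (x^2 * (k'^2 - 6 * k)) := by
    have g1 : b / 2 * k'^2 ≤ B3 * k'^2 := by gcongr
    have g2 : B3 * (6 * k) ≤ 2 * b * (6 * k) := by gcongr
    have : b / 2 * k'^2 - 12 * b * k ≤ B3 * (k'^2 - 6 * k) := by linarith
    have hx2 : 0 < x^2 := by positivity
    have := mul_le_mul_of_nonneg_left this hx2.le
    linarith only [this]
  have e4 : 0 ≤ x * k^2 * (1/8 - a * μ * k^2) := by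
    apply mul_nonneg (by positivity) (by linarith)
  have e5 : 0 ≤ x * k^2 * (1/8 - K * x) := mul_nonneg (by positivity) (by linarith)
  set Rr := 18 * b + 12 * K * y1 with hRr
  have e6 : 0 ≤ x * (k / 2 - x * Rr)^2 := by positivity
  have e7 : 0 < x^2 * (8 * b * y1^2 - x * Rr^2) := mul_pos (by positivity) (by linarith)
  have main : 0 < x * k^2 * (1 - 2 * (a * μ * k^2)) + (o1 - o4 * x) * k^2 + (2 * o2 * x + o5 * x^2) * (k * k') +
      B3 * (x^2 * (k'^2 - 6 * k)) := by
    rw [hkk] at e3 ⊢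
    rw [hRr] at e6 e7
    have e8 : 0 ≤ x * k^2 := by positivity
    linarith only [e1, e2, e3, e4, e5, e6, e7, e8]
  have := mul_pos (show 0 < 2 * μ by positivity) main
  refine lt_of_lt_of_eq this ?_
  ring

lemma SP.nondeg (h : SP X Y a b δ K O₁ O₂ O₃ O₄ O₅ u ux uy uxx uxy uyy) {Y2 : ℝ} (hY2 : 0 < Y2) (hY2Y : Y2 < Y) :
    ∃ ξ > 0, ξ < X ∧ ∃ μ > 0, ∀ x ∈ Icc 0 ξ, ∀ y ∈ Icc 0 Y2, μ * x^2 ≤ u (x, y) := by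
  have ha := h.ha
  have hb := h.hb
  have hK := h.hK
  have hX := h.hX
  have hX1 := h.hX1
  have hK0 : 0 < K := by linarith
  set y1 := (Y2 + Y) / 2 with hy1
  have hy10 : 0 < y1 := by rw [hy1]; linarith
  have hy1Y : y1 < Y := by rw [hy1]; linarith
  have hy12 : Y2 < y1 := by rw [hy1]; linarith
  set Rr := 18 * b + 12 * K * y1 with hRr
  have hRr0 : 0 < Rr := by positivity
  set ξ := min (min (X/4) (1/(8*K))) (4 * b * y1^2 / Rr^2) with hξ
  have hξ0 : 0 < ξ := by positivity
  have ξ1 : ξ ≤ X / 4 := (min_le_left _ _).trans (min_le_left _ _)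
  have ξ2 : K * ξ ≤ 1/8 := by
    calc K * ξ ≤ K * (1/(8*K)) := by gcongr; exact (min_le_left _ _).trans (min_le_right _ _)
      _ = _ := by field_simp
  have ξ3 : ξ * Rr^2 ≤ 4 * b * y1^2 := by
    rw [← le_div_iff₀ (by positivity)]; exact min_le_right _ _
  have cm : ContinuousOn (fun y => u (ξ, y)) (Icc 0 y1) := by
    refine h.cont.comp (by fun_prop) ?_
    intro y hy
    exact ⟨hξ0.le, by simp only; linarith, hy.1, hy.2.trans_lt hy1Y⟩
  obtain ⟨ym, hym, hmin⟩ := isCompact_Icc.exists_isMinOn (nonempty_Icc.2 hy10.le) cm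
  have m0 : 0 < u (ξ, ym) := h.u_pos hξ0 (by linarith) hym.1 (hym.2.trans_lt hy1Y)
  set kM := 2 * y1^2 with hkM
  set μ := min (1 / (8 * a * kM^2)) (u (ξ, ym) / kM^2) with hμ
  have hkM0 : 0 < kM := by positivity
  have hμ0 : 0 < μ := by positivity
  have μ1 : a * μ * kM^2 ≤ 1/8 := by
    calc a * μ * kM^2 ≤ a * (1 / (8 * a * kM^2)) * kM^2 := by gcongr; exact min_le_left _ _
      _ = _ := by field_simp
  have μ2 : μ * kM^2 ≤ u (ξ, ym) := by
    rw [← le_div_iff₀ (by positivity)]; exact min_le_right _ _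
  set k : ℝ → ℝ := fun y => y1^2 + 2 * y1 * y - 3 * y^2 with hk
  set k' : ℝ → ℝ := fun y => 2 * y1 - 6 * y with hk'
  have kd : ∀ y, HasDerivAt k (k' y) y := by
    intro y
    have := (((hasDerivAt_id y).const_mul (2 * y1)).const_add (y1^2)).sub (((hasDerivAt_id y).pow 2).const_mul 3)
    refine this.congr_deriv ?_
    simp only [id, Nat.cast_ofNat, Nat.add_one_sub_one, pow_one, hk']; ring
  have kd' : ∀ y, HasDerivAt k' (-6) y := by
    intro y
    have := ((hasDerivAt_id y).const_mul 6).const_sub (2 * y1)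
    refine this.congr_deriv ?_
    ring
  have kc : Continuous k := by rw [hk]; fun_prop
  have kc' : Continuous k' := by rw [hk']; fun_prop
  have C1 := C2on_fst (U := {p : ℝ × ℝ | 0 < p.1}) (g := fun x => x^2) (g1 := fun x => 2 * x)
    (g2 := fun _ => 2) (fun p _ => by simpa using hasDerivAt_pow 2 p.1) (fun p _ => by
      simpa using (hasDerivAt_id p.1).const_mul 2) continuousOn_const
  have C2 := C2on_snd (U := {p : ℝ × ℝ | 0 < p.1}) (g := fun y => μ * (k y)^2) (g1 := fun y => μ * (2 * k y * k' y))
    (g2 := fun y => μ * (2 * (k' y)^2 - 12 * k y)) (fun p _ => by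
      have := ((kd p.2).pow 2).const_mul μ
      refine this.congr_deriv ?_
      simp only [Nat.cast_ofNat, Nat.add_one_sub_one, pow_one]) (fun p _ => by
      have := (((kd p.2).const_mul 2).mul (kd' p.2)).const_mul μ
      refine this.congr_deriv ?_
      ring) (continuousOn_const.mul ((continuousOn_const.mul ((kc'.comp continuous_snd).pow 2).continuousOn).sub (continuousOn_const.mul (kc.comp continuous_snd).continuousOn)))
  have kpos : ∀ y, 0 ≤ y → y < y1 → 0 < k y := by
    intro y h1 h2
    have : k y = (y1 - y) * (y1 + 3 * y) := by simp only [hk]; ring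
    rw [this]; exact mul_pos (by linarith) (by linarith)
  have kle : ∀ y, k y ≤ kM := by
    intro y
    simp only [hk, hkM]
    linarith only [sq_nonneg (y1 - 3 * y), sq_nonneg y1]
  have ky1 : k y1 = 0 := by simp only [hk]; ring
  have key := h.cmp (σ := 1) (Or.inl rfl) (X0 := 0) (X1 := ξ) (Y1 := y1) le_rfl (by linarith) hy10 hy1Y
    (C1.mul C2) (((continuous_fst.pow 2).mul (continuous_const.mul ((kc.comp continuous_snd).pow 2))).continuousOn) ?_ ?_ ?_ ?_ ?_
  · refine ⟨ξ, hξ0, by linarith, μ * ((y1 - Y2) * y1)^2, by have : 0 < y1 - Y2 := by linarith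
                                                            positivity, ?_⟩
    intro x hx y hy
    have h1 := key (x, y) hx ⟨hy.1, hy.2.trans hy12.le⟩
    simp only at h1
    have h2 : (y1 - Y2) * y1 ≤ k y := by
      have : k y = (y1 - y) * (y1 + 3 * y) := by simp only [hk]; ring
      rw [this]
      have := hy.1; have := hy.2
      exact mul_le_mul (by linarith) (by linarith) hy10.le (by linarith)
    have h4 : 0 ≤ (y1 - Y2) * y1 := mul_nonneg (by linarith) hy10.le
    have h3 : μ * ((y1 - Y2) * y1)^2 * x^2 ≤ μ * (k y)^2 * x^2 := by gcongr
    linarith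
  · intro y hy
    have := (h.ub (0, y) le_rfl hX hy.1 (hy.2.trans_lt hy1Y)).1
    simpa using this
  · intro y hy
    have h1 : u (ξ, ym) ≤ u (ξ, y) := hmin hy
    have h2 : (k y)^2 ≤ kM^2 := by
      rcases hy.2.eq_or_lt with h | h
      · rw [h, ky1, zero_pow two_ne_zero]; exact sq_nonneg kM
      · have := (kpos y hy.1 h).le
        have := kle y
        gcongr
    have h3 : μ * (k y)^2 ≤ μ * kM^2 := by gcongr
    have h4 : ξ^2 ≤ 1 := pow_le_one₀ hξ0.le (by linarith only [ξ1, hX1, hX])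
    have h5 : 0 ≤ μ * (k y)^2 := by positivity
    have h6 : ξ^2 * (μ * (k y)^2) ≤ 1 * (μ * (k y)^2) := by gcongr
    simp only
    linarith
  · intro x hx
    have := (h.ub (x, y1) hx.1 (by simp only; linarith [hx.2]) hy10.le hy1Y).1
    simp only [ky1]
    simpa using this
  · intro x hx
    have : 0 < x := hx.1
    have h1 : 0 < k 0 := kpos 0 le_rfl hy10
    have h2 : 0 < k' 0 := by simp only [hk']; linarith
    simp only [one_mul, zero_mul, add_zero]
    positivity
  · intro p hp q1 q2 q3 _ _ _
    have hx1 : p.1 ≤ 1 := hp.2.1.le.trans hX1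
    have hKx : K * p.1 ≤ 1/8 := le_trans (by gcongr) ξ2
    have hk0 := kpos p.2 hp.2.2.1.le q3
    have := nd_alg (a := a) (y1 := y1) (k' := k' p.2) hb hK0 hp.1 hx1 hμ0 hk0 (by simp only [hk, hk']; ring)
      (by simp only [hk']; rw [abs_le]; constructor <;> linarith [hp.2.2.1]) hy10
      (le_trans (by have := kle p.2; gcongr) μ1) hKx
      (by
        have : p.1 * Rr^2 ≤ ξ * Rr^2 := by gcongr
        have : 0 < b * y1^2 := by positivity
        linarith)
      (h.o1 p hp) (h.o2 p hp) (h.B_bd hp).1 (h.B_bd hp).2 (h.o4 p hp) (h.o5 p hp)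
    simp only [zero_mul, mul_zero, add_zero, zero_add]
    linarith

end
end

section
lemma as_alg {a b K x c T S A2 Cc c1 Y1 γ τ η o1 o2 B3 o4 o5 : ℝ} (ha : 0 < a) (hb : 0 < b) (hK : 0 < K) (hx : 0 < x) (hx1 : x ≤ 1)
    (hKx : K * x ≤ 1) (hA2 : 0 ≤ A2) (hc1 : 0 ≤ c1) (hY1 : 0 ≤ Y1) (hγ : 0 ≤ γ) (hγ1 : γ ≤ 1) (hτ : |τ| ≤ 1)
    (hc : |c| ≤ Cc) (hT : |T| ≤ c1 * γ) (hS : |S| ≤ 4 * c1 * γ) (hη : |η| ≤ Y1)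
    (h1 : |o1| ≤ K * x^2) (h2 : |o2| ≤ K * x) (h3 : |B3| ≤ 2 * b) (h4 : |o4| ≤ K * x) (h5 : |o5| ≤ K * x) :
    |((2 * x - a * (x * (2 * c - T)) + o1) * (2 * c - S) + o2 * (x * (4 * τ * A2 * η)) + B3 * (x^2 * (2 * τ * A2))
      - (1 + o4) * (x * (2 * c - T)) + o5 * (x^2 * (2 * τ * A2 * η))) - x * (2 * c * (1 - 2 * a * c))| ≤
    x * (((2 + 2 * a * Cc) * (4 * c1) + (a * c1 + K) * (2 * Cc + 4 * c1) + 2 * K * Cc + 2 * c1 + 4 * K * A2 * Y1 + 4 * b * A2 + 2 * K * A2 * Y1) * (γ + x)) := by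
  have hCc : 0 ≤ Cc := (abs_nonneg _).trans hc
  set g := γ + x with hg
  have hg0 : 0 ≤ g := by positivity
  have gγ : γ ≤ g := by rw [hg]; linarith
  have gx : x ≤ g := by rw [hg]; linarith
  have t1 : |x * ((2 - 2 * a * c) * S)| ≤ x * ((2 + 2 * a * Cc) * (4 * c1 * g)) := by
    rw [abs_mul, abs_mul, abs_of_pos hx]
    have e1 : |2 - 2 * a * c| ≤ 2 + 2 * a * Cc := by
      refine (abs_sub _ _).trans ?_
      rw [abs_mul, abs_of_pos (show 0 < 2 * a by positivity), abs_of_pos (show (0:ℝ) < 2 by norm_num)]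
      gcongr
    have e2 : |S| ≤ 4 * c1 * g := hS.trans (by gcongr)
    gcongr
  have t2 : |(a * x * T + o1) * (2 * c - S)| ≤ (x * ((a * c1 + K) * g)) * (2 * Cc + 4 * c1) := by
    rw [abs_mul]
    have e1 : |a * x * T + o1| ≤ x * ((a * c1 + K) * g) := by
      refine (abs_add_le _ _).trans ?_
      rw [abs_mul, abs_of_pos (show 0 < a * x by positivity)]
      have : a * x * |T| ≤ a * x * (c1 * g) := by gcongr; exact hT.trans (by gcongr)
      have h2 : K * x^2 ≤ K * x * g := by rw [pow_two, ← mul_assoc]; gcongr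
      linarith only [this, h2, h1]
    have e2 : |2 * c - S| ≤ 2 * Cc + 4 * c1 := by
      refine (abs_sub _ _).trans ?_
      rw [abs_mul, abs_of_pos (show (0:ℝ) < 2 by norm_num)]
      have : 4 * c1 * γ ≤ 4 * c1 := mul_le_of_le_one_right (by positivity) hγ1
      linarith only [this, hc, hS]
    gcongr
  have t3 : |o4 * (x * (2 * c))| ≤ (K * g) * (x * (2 * Cc)) := by
    rw [abs_mul, abs_mul, abs_mul, abs_of_pos hx, abs_of_pos (show (0:ℝ) < 2 by norm_num)]
    have : |o4| ≤ K * g := h4.trans (by gcongr)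
    gcongr
  have t4 : |(1 + o4) * (x * T)| ≤ 2 * (x * (c1 * g)) := by
    rw [abs_mul, abs_mul, abs_of_pos hx]
    have e1 : |1 + o4| ≤ 2 := by rw [abs_le] at h4 ⊢; constructor <;> linarith [h4.1, h4.2]
    have e2 : |T| ≤ c1 * g := hT.trans (by gcongr)
    gcongr
  have tη : |τ * A2 * η| ≤ A2 * Y1 := by
    rw [abs_mul, abs_mul, abs_of_nonneg hA2]
    have : |τ| * A2 ≤ 1 * A2 := by gcongr
    calc |τ| * A2 * |η| ≤ (1 * A2) * Y1 := by gcongr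
      _ = _ := by ring
  have tA : |τ * A2| ≤ A2 := by
    rw [abs_mul, abs_of_nonneg hA2]
    have : |τ| * A2 ≤ 1 * A2 := by gcongr
    linarith
  have t5 : |o2 * (x * (4 * (τ * A2 * η)))| ≤ (K * g) * (x * (4 * (A2 * Y1))) := by
    rw [abs_mul, abs_mul, abs_mul, abs_of_pos hx, abs_of_pos (show (0:ℝ) < 4 by norm_num)]
    have : |o2| ≤ K * g := h2.trans (by gcongr)
    gcongr
  have t6 : |B3 * (x * x * (2 * (τ * A2)))| ≤ (2 * b) * (x * g * (2 * A2)) := by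
    rw [abs_mul, abs_mul, abs_mul, abs_mul, abs_of_pos hx, abs_of_pos (show (0:ℝ) < 2 by norm_num)]
    gcongr
  have t7 : |o5 * (x * x * (2 * (τ * A2 * η)))| ≤ (K * g) * (x * 1 * (2 * (A2 * Y1))) := by
    rw [abs_mul, abs_mul, abs_mul, abs_mul, abs_of_pos hx, abs_of_pos (show (0:ℝ) < 2 by norm_num)]
    have : |o5| ≤ K * g := h5.trans (by gcongr)
    gcongr
  have e : ((2 * x - a * (x * (2 * c - T)) + o1) * (2 * c - S) + o2 * (x * (4 * τ * A2 * η)) + B3 * (x^2 * (2 * τ * A2))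
      - (1 + o4) * (x * (2 * c - T)) + o5 * (x^2 * (2 * τ * A2 * η))) - x * (2 * c * (1 - 2 * a * c)) =
      -(x * ((2 - 2 * a * c) * S)) + (a * x * T + o1) * (2 * c - S) - o4 * (x * (2 * c)) + (1 + o4) * (x * T) +
      o2 * (x * (4 * (τ * A2 * η))) + B3 * (x * x * (2 * (τ * A2))) + o5 * (x * x * (2 * (τ * A2 * η))) := by ring
  rw [e]
  rw [abs_le] at *
  constructor <;> linarith only [t1.1, t1.2, t2.1, t2.2, t3.1, t3.2, t4.1, t4.2, t5.1, t5.2, t6.1, t6.2, t7.1, t7.2]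

section
variable {X Y a b δ K : ℝ} {O₁ O₂ O₃ O₄ O₅ u ux uy uxx uxy uyy : ℝ × ℝ → ℝ}

lemma rp_d {γ c1 e x : ℝ} (he : 0 < e) (hx : 0 < x) :
    HasDerivAt (fun x => c1 * (x / e) ^ γ) (γ * (c1 * (x / e) ^ γ) / x) x := by
  have h1 : HasDerivAt (fun x => x / e) (1 / e) x := (hasDerivAt_id x).div_const e
  have := (h1.rpow_const (p := γ) (Or.inl (by positivity))).const_mul c1
  refine this.congr_deriv ?_
  rw [Real.rpow_sub_one (by positivity)]
  field_simp

lemma rp_d2 {γ c1 e x : ℝ} (he : 0 < e) (hx : 0 < x) :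
    HasDerivAt (fun x => γ * (c1 * (x / e) ^ γ) / x) (γ * (γ - 1) * (c1 * (x / e) ^ γ) / x^2) x := by
  have := ((rp_d (γ := γ) (c1 := c1) he hx).const_mul γ).div (hasDerivAt_id x) hx.ne'
  refine this.congr_deriv ?_
  simp only [id]
  field_simp

set_option maxHeartbeats 4000000 in
lemma SP.asym1 (h : SP X Y a b δ K O₁ O₂ O₃ O₄ O₅ u ux uy uxx uxy uyy) {Y2 : ℝ} (hY2 : 0 < Y2) (hY2Y : Y2 < Y)
    {σ : ℝ} (hσ : σ = 1 ∨ σ = -1) {ε : ℝ} (hε : 0 < ε) :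
    ∃ x0 > 0, ∀ x, 0 < x → x < x0 → ∀ y, 0 < y → y ≤ Y2 → -(2 * ε * x^2) ≤ σ * (u (x, y) - x^2 / (2 * a)) := by
  have ha := h.ha
  have hb := h.hb
  have hK := h.hK
  have hX := h.hX
  have hX1 := h.hX1
  have hK0 : 0 < K := by linarith
  have hσ2 : σ * σ = 1 := by rcases hσ with rfl | rfl <;> norm_num
  have hσa : |σ| = 1 := by rcases hσ with rfl | rfl <;> norm_num
  set Y1 := (Y2 + Y) / 2 with hY1
  have hY10 : 0 < Y1 := by rw [hY1]; linarith
  have hY1Y : Y1 < Y := by rw [hY1]; linarith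
  have hY12 : Y2 < Y1 := by rw [hY1]; linarith
  obtain ⟨ξ, hξ0, hξX, μ, hμ0, hnd⟩ := h.nondeg hY10 hY1Y
  set c1 := 1 / a with hc1
  have hc10 : 0 < c1 := by positivity
  set A2 := c1 / (Y1 - Y2)^2 with hA2
  have hd0 : 0 < Y1 - Y2 := by linarith
  have hA20 : 0 < A2 := by positivity
  set Cc := 1 / (2 * a) + ε + A2 * Y1^2 + c1 with hCc
  set C := (2 + 2 * a * Cc) * (4 * c1) + (a * c1 + K) * (2 * Cc + 4 * c1) + 2 * K * Cc + 2 * c1 + 4 * K * A2 * Y1 + 4 * b * A2 + 2 * K * A2 * Y1 with hC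
  have hCc0 : 0 < Cc := by positivity
  have hC0 : 0 < C := by positivity
  set κ := min (4 * a * μ * ε) (2 * ε) with hκ
  have hκ0 : 0 < κ := by positivity
  set γ := min 1 (κ / (4 * C)) with hγ
  have hγ0 : 0 < γ := by positivity
  have hγ1 : γ ≤ 1 := min_le_left _ _
  have hγC : C * γ ≤ κ / 4 := by
    calc C * γ ≤ C * (κ / (4 * C)) := by gcongr; exact min_le_right _ _
      _ = _ := by field_simp
  set e := min (min ξ (X/2)) (κ / (4 * C)) with he
  have he0 : 0 < e := by positivity
  have e1 : e ≤ ξ := (min_le_left _ _).trans (min_le_left _ _)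
  have e2 : e < X := (min_le_left _ _).trans_lt ((min_le_right _ _).trans_lt (by linarith))
  have e3 : C * e ≤ κ / 4 := by
    calc C * e ≤ C * (κ / (4 * C)) := by gcongr; exact min_le_right _ _
      _ = _ := by field_simp
  set θ : ℝ → ℝ := fun x => c1 * (x / e) ^ γ with hθ
  have θc : Continuous θ := by
    rw [hθ]
    refine continuous_const.mul (Continuous.rpow_const (by fun_prop) (fun x => Or.inr hγ0.le))
  have θ0 : θ 0 = 0 := by simp [hθ, Real.zero_rpow hγ0.ne']
  have θe : θ e = c1 := by simp [hθ, div_self he0.ne']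
  have θnn : ∀ x, 0 ≤ x → 0 ≤ θ x := fun x hx => by simp only [hθ]; positivity
  have θle : ∀ x, 0 ≤ x → x ≤ e → θ x ≤ c1 := fun x hx hxe => by
    simp only [hθ]
    have : (x / e) ^ γ ≤ 1 := Real.rpow_le_one (by positivity) ((div_le_one he0).2 hxe) hγ0.le
    calc c1 * (x / e) ^ γ ≤ c1 * 1 := mul_le_mul_of_nonneg_left this hc10.le
      _ = c1 := mul_one _
  have hev : ∀ᶠ x in nhds (0:ℝ), θ x < ε := by
    have := θc.tendsto 0
    rw [θ0] at this
    exact this.eventually (gt_mem_nhds hε)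
  obtain ⟨η, hη, hηb⟩ := Metric.eventually_nhds_iff_ball.1 hev
  refine ⟨min η e, by positivity, ?_⟩
  intro x hx0 hx y hy0 hyY2
  have hxη : x < η := hx.trans_le (min_le_left _ _)
  have hxe : x < e := hx.trans_le (min_le_right _ _)
  have hθx : θ x < ε := hηb x (by rw [mem_ball_zero_iff, Real.norm_eq_abs, abs_of_pos hx0]; exact hxη)
  set ci := 1 / (2 * a) - σ * ε with hci
  have C1 := C2on_fst (U := {p : ℝ × ℝ | 0 < p.1}) (g := fun x => x^2) (g1 := fun x => 2 * x)
    (g2 := fun _ => 2) (fun p _ => by simpa using hasDerivAt_pow 2 p.1) (fun p _ => by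
      simpa using (hasDerivAt_id p.1).const_mul 2) continuousOn_const
  have C2 := C2on_fst (U := {p : ℝ × ℝ | 0 < p.1}) (g := fun x => -σ * θ x) (g1 := fun x => -σ * (γ * θ x / x))
    (g2 := fun x => -σ * (γ * (γ - 1) * θ x / x^2)) (fun p hp => (rp_d he0 hp).const_mul _)
    (fun p hp => (rp_d2 he0 hp).const_mul _) (by
      refine ContinuousOn.mul continuousOn_const (ContinuousOn.div (continuousOn_const.mul (θc.comp continuous_fst).continuousOn) (continuous_fst.pow 2).continuousOn (fun p hp => ?_))
      exact pow_ne_zero _ (ne_of_gt hp))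
  have C3 := C2on_snd (U := {p : ℝ × ℝ | 0 < p.1}) (g := fun t => ci - σ * (A2 * (t - y)^2)) (g1 := fun t => -σ * (2 * A2 * (t - y)))
    (g2 := fun t => -σ * (2 * A2)) (fun p _ => by
      have := ((((((hasDerivAt_id p.2).sub_const y).pow 2).const_mul A2).const_mul σ).const_sub ci)
      refine this.congr_deriv ?_
      simp only [id, Nat.cast_ofNat, Nat.add_one_sub_one, pow_one]; ring) (fun p _ => by
      have := (((hasDerivAt_id p.2).sub_const y).const_mul (2 * A2)).const_mul (-σ)
      refine this.congr_deriv ?_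
      ring) continuousOn_const
  clear_value θ e γ κ C Cc A2 c1 ci Y1
  have wall : ∀ p : ℝ × ℝ, 0 ≤ p.1 → p.1 < X → 0 ≤ p.2 → p.2 < Y → ∀ D, c1 ≤ D →
      0 ≤ σ * (u p - p.1^2 * (ci - σ * D)) := by
    intro p h1 h2 h3 h4 D hD
    have hu := h.ub p h1 h2 h3 h4
    have e : σ * (u p - p.1^2 * (ci - σ * D)) = σ * (u p - p.1^2 * (1/(2*a))) + (σ * σ) * (p.1^2 * (ε + D)) := by rw [hci]; ring
    rw [e, hσ2, one_mul]
    have h5 : p.1^2 * c1 ≤ p.1^2 * (ε + D) := by gcongr; linarith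
    have hu2 : u p ≤ p.1^2 * c1 := by
      rw [hc1, mul_one_div, le_div_iff₀ ha]; linarith [hu.2]
    have h6 : p.1^2 * (1/(2*a)) ≤ p.1^2 * c1 := by
      rw [hc1]; gcongr; linarith
    have h7 : 0 ≤ p.1^2 * (1/(2*a)) := by positivity
    rcases hσ with rfl | rfl
    · linarith [hu.1]
    · linarith
  have key := h.cmp hσ (X0 := 0) (X1 := e) (Y1 := Y1) le_rfl e2 hY10 hY1Y
    (C1.mul (C2.add C3)) (((continuous_fst.pow 2).mul ((continuous_const.mul (θc.comp continuous_fst)).add (by fun_prop))).continuousOn) ?_ ?_ ?_ ?_ ?_ (x, y) ⟨hx0.le, hxe.le⟩ ⟨hy0.le, hyY2.trans hY12.le⟩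
  · simp only [sub_self] at key
    have e : σ * (u (x, y) - x^2 * (-σ * θ x + (ci - σ * (A2 * 0^2)))) = σ * (u (x, y) - x^2 / (2*a)) + (σ * σ) * (x^2 * (ε + θ x)) := by rw [hci]; ring
    rw [e, hσ2, one_mul] at key
    have : x^2 * (ε + θ x) ≤ x^2 * (2 * ε) := by gcongr; linarith
    linarith
  · intro t ht
    have h1 := h.ub (0, t) le_rfl hX ht.1 (ht.2.trans_lt hY1Y)
    simp only at h1
    have h2 : u (0, t) = 0 := by
      have : a * u (0, t) ≤ 0 := by linarith [h1.2]
      have := nonpos_of_mul_nonpos_right this ha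
      linarith [h1.1]
    simp [h2]
  · intro t ht
    have := wall (e, t) he0.le e2 ht.1 (ht.2.trans_lt hY1Y) (c1 + A2 * (t - y)^2) (by have : 0 ≤ A2 * (t - y)^2 := by positivity
                                                                                      linarith)
    refine this.trans_eq ?_
    simp only [θe]; ring
  · intro s hs
    have := wall (s, Y1) hs.1 (hs.2.trans_lt e2) hY10.le hY1Y (θ s + A2 * (Y1 - y)^2) (by
      have h1 := θnn s hs.1
      have h2 : A2 * (Y1 - Y2)^2 = c1 := by rw [hA2]; field_simp
      have h3 : A2 * (Y1 - Y2)^2 ≤ A2 * (Y1 - y)^2 := by gcongr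
      linarith)
    refine this.trans_eq ?_
    simp only; ring
  · intro s hs
    have hs0 : 0 < s := hs.1
    have : σ * (s^2 * (0 + -σ * (2 * A2 * (0 - y))) + 0 * (-σ * θ s + (ci - σ * (A2 * (0 - y)^2)))) = (σ * σ) * (s^2 * (2 * A2 * y)) := by ring
    simp only [this, hσ2]
    positivity
  · intro p hp q1 q2 q3 hneg _ _
    have hx1 : p.1 ≤ 1 := hp.2.1.le.trans hX1
    have hp1 := hp.1
    set D := A2 * (p.2 - y)^2 with hD
    have hD0 : 0 ≤ D := by positivity
    have hyy : |p.2 - y| ≤ Y1 := by rw [abs_le]; constructor <;> linarith [hp.2.2.1]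
    have hD1 : D ≤ A2 * Y1^2 := by
      rw [hD, ← sq_abs]; gcongr
    have ht0 := θnn p.1 hp.1.le
    have ht1 := θle p.1 hp.1.le q2.le
    set c := -σ * θ p.1 + (ci - σ * D) with hc
    have hcD : c = 1 / (2 * a) - σ * (ε + θ p.1 + D) := by rw [hc, hci]; ring
    have hcb : |c| ≤ Cc := by
      rw [hcD]
      refine (abs_sub _ _).trans ?_
      rw [abs_mul, hσa, one_mul, abs_of_pos (by positivity), abs_of_pos (by positivity)]
      linarith
    have kx := h.Kx hp
    have B := h.B_bd hp
    have alg := as_alg (τ := -σ) (T := σ * γ * θ p.1) (S := σ * γ * (3 + γ) * θ p.1) (η := p.2 - y) ha hb hK0 hp.1 hx1 (by linarith [kx.2.2.1]) hA20.le hc10.le hY10.le hγ0.le hγ1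
      (by rw [abs_neg, hσa]) hcb (by
        rw [abs_mul, abs_mul, hσa, one_mul, abs_of_pos hγ0, abs_of_nonneg ht0, mul_comm]; gcongr)
      (by
        rw [abs_mul, abs_mul, abs_mul, hσa, one_mul, abs_of_pos hγ0, abs_of_nonneg ht0, abs_of_pos (by positivity)]
        calc γ * (3 + γ) * θ p.1 ≤ γ * (3 + 1) * c1 := by gcongr
          _ = _ := by ring) hyy (h.o1 p hp) (h.o2 p hp) (abs_le.2 ⟨by linarith [B.1], B.2⟩) (h.o4 p hp) (h.o5 p hp)
    rw [← hC] at alg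
    have main : κ ≤ σ * (2 * c * (1 - 2 * a * c)) := by
      have hDt : ε ≤ ε + θ p.1 + D := by linarith
      have h2ac : 1 - 2 * a * c = 2 * a * (σ * (ε + θ p.1 + D)) := by rw [hcD]; field_simp; ring
      have hex : σ * (2 * c * (1 - 2 * a * c)) = 4 * a * c * (ε + θ p.1 + D) := by
        rw [h2ac]; linear_combination (4 * a * c * (ε + θ p.1 + D)) * hσ2
      rw [hex]
      rcases hσ with hs | hs
      · rw [hs, one_mul] at hneg
        have h1 := hnd p.1 ⟨hp.1.le, q2.le.trans e1⟩ p.2 ⟨hp.2.2.1.le, q3.le⟩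
        have h2 : μ < c := by
          have : μ * p.1^2 < c * p.1^2 := by
            change μ * p.1^2 ≤ u p at h1
            linarith
          exact lt_of_mul_lt_mul_right this (by positivity)
        have hc0 : 0 < c := hμ0.trans h2
        calc κ ≤ 4 * a * μ * ε := hκ.trans_le (min_le_left _ _)
          _ ≤ _ := by gcongr
      · have h1 : 1 / (2 * a) ≤ c := by rw [hcD, hs]; linarith
        have hc0 : 0 < c := lt_of_lt_of_le (by positivity) h1
        calc κ ≤ 2 * ε := hκ.trans_le (min_le_right _ _)
          _ = 4 * a * (1 / (2 * a)) * ε := by field_simp; norm_num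
          _ ≤ _ := by gcongr
    have fin : 0 < p.1 * (κ - C * (γ + p.1)) := by
      apply mul_pos hp.1
      have : C * p.1 ≤ C * e := by gcongr
      rw [mul_add]
      linarith only [this, hγC, e3, hκ0]
    have hm := mul_le_mul_of_nonneg_left main hp.1.le
    set NN := ((2 * p.1 - a * (p.1 * (2 * c - σ * γ * θ p.1)) + O₁ p) * (2 * c - σ * γ * (3 + γ) * θ p.1) + O₂ p * (p.1 * (4 * (-σ) * A2 * (p.2 - y))) + (b + O₃ p) * (p.1^2 * (2 * (-σ) * A2))
      - (1 + O₄ p) * (p.1 * (2 * c - σ * γ * θ p.1)) + O₅ p * (p.1^2 * (2 * (-σ) * A2 * (p.2 - y)))) with hNN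
    have hσN : |σ * NN - σ * (p.1 * (2 * c * (1 - 2 * a * c)))| ≤ p.1 * (C * (γ + p.1)) := by
      rw [← mul_sub, abs_mul, hσa, one_mul]; exact alg
    have := (abs_le.1 hσN).1
    have eZ : σ * (p.1 * (2 * c * (1 - 2 * a * c))) = p.1 * (σ * (2 * c * (1 - 2 * a * c))) := by ring
    rw [eZ] at this
    rw [mul_sub] at fin
    have pos : 0 < σ * NN := by linarith only [this, hm, fin]
    refine pos.trans_eq ?_
    congr 1
    rw [hNN]
    field_simp
    ring

lemma SP.asym (h : SP X Y a b δ K O₁ O₂ O₃ O₄ O₅ u ux uy uxx uxy uyy) {Y2 : ℝ} (hY2 : 0 < Y2) (hY2Y : Y2 < Y)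
    {ε : ℝ} (hε : 0 < ε) :
    ∃ x0 > 0, ∀ x, 0 < x → x < x0 → ∀ y, 0 < y → y ≤ Y2 → |u (x, y) - x^2 / (2 * a)| ≤ ε * x^2 := by
  obtain ⟨x1, h1, H1⟩ := h.asym1 hY2 hY2Y (Or.inl rfl) (half_pos hε)
  obtain ⟨x2, h2, H2⟩ := h.asym1 hY2 hY2Y (Or.inr rfl) (half_pos hε)
  refine ⟨min x1 x2, by positivity, fun x hx hx' y hy hy' => ?_⟩
  have a1 := H1 x hx (hx'.trans_le (min_le_left _ _)) y hy hy'
  have a2 := H2 x hx (hx'.trans_le (min_le_right _ _)) y hy hy'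
  rw [abs_le]; constructor <;> linarith

end
end

section
lemma mvt1 {g g' : ℝ → ℝ} {s t C : ℝ} (h : ∀ r ∈ uIcc s t, HasDerivAt g (g' r) r)
    (hb : ∀ r ∈ uIcc s t, |g' r| ≤ C) : |g t - g s| ≤ C * |t - s| :=
  Convex.norm_image_sub_le_of_norm_hasDerivWithin_le (f := g) (f' := g') (s := uIcc s t)
    (fun r hr => (h r hr).hasDerivWithinAt) hb (convex_uIcc s t) left_mem_uIcc right_mem_uIcc

lemma interp1 {g g' g2 : ℝ → ℝ} {s h m L : ℝ} (hh : 0 < h) (h1 : ∀ r ∈ Icc s (s + h), HasDerivAt g (g' r) r)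
    (h2 : ∀ r ∈ Icc s (s + h), HasDerivAt g' (g2 r) r) (hL : ∀ r ∈ Icc s (s + h), |g2 r| ≤ L)
    (m1 : |g s| ≤ m) (m2 : |g (s + h)| ≤ m) : h * |g' s| ≤ 2 * m + L * h^2 := by
  have hs : s < s + h := by linarith
  obtain ⟨ξ, hξ, e⟩ := exists_hasDerivAt_eq_slope g g' hs (fun r hr => (h1 r hr).continuousAt.continuousWithinAt)
    (fun r hr => h1 r ⟨hr.1.le, hr.2.le⟩)
  have hsub : uIcc ξ s ⊆ Icc s (s + h) := by
    rw [uIcc_of_ge hξ.1.le]; exact Icc_subset_Icc le_rfl hξ.2.le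
  have hm := mvt1 (g := g') (g' := g2) (s := ξ) (t := s) (C := L) (fun r hr => h2 r (hsub hr)) (fun r hr => hL r (hsub hr))
  have hL0 : 0 ≤ L := (abs_nonneg _).trans (hL s ⟨le_rfl, hs.le⟩)
  have hd : |s - ξ| ≤ h := by rw [abs_le]; constructor <;> linarith [hξ.1, hξ.2]
  have e2 : h * g' ξ = g (s + h) - g s := by rw [e, add_sub_cancel_left]; field_simp
  have e3 : |h * g' ξ| ≤ 2 * m := by rw [e2]; exact (abs_sub _ _).trans (by linarith)
  have e4 : |h * (g' s - g' ξ)| ≤ L * h^2 := by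
    rw [abs_mul, abs_of_pos hh]
    calc h * |g' s - g' ξ| ≤ h * (L * h) := by gcongr; exact hm.trans (by gcongr)
      _ = _ := by ring
  calc h * |g' s| = |h * g' ξ + h * (g' s - g' ξ)| := by rw [← abs_of_pos hh, ← abs_mul, abs_of_pos hh]; ring_nf
    _ ≤ _ := (abs_add_le _ _).trans (by linarith)

section
variable {X Y a b δ K : ℝ} {O₁ O₂ O₃ O₄ O₅ u ux uy uxx uxy uyy : ℝ × ℝ → ℝ}

lemma SP.vseg {x y y' : ℝ} (h1 : (x, y) ∈ Strp X Y) (h2 : (x, y') ∈ Strp X Y) {r : ℝ} (hr : r ∈ uIcc y y') : (x, r) ∈ Strp X Y := by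
  obtain ⟨a1, a2, a3, a4⟩ := h1
  obtain ⟨b1, b2, b3, b4⟩ := h2
  rw [mem_uIcc] at hr
  simp only at *
  refine ⟨a1, a2, ?_, ?_⟩ <;> simp only <;> rcases hr with hr | hr <;> linarith [hr.1, hr.2]

lemma SP.hseg {x x' y : ℝ} (h1 : (x, y) ∈ Strp X Y) (h2 : (x', y) ∈ Strp X Y) {r : ℝ} (hr : r ∈ uIcc x x') : (r, y) ∈ Strp X Y := by
  obtain ⟨a1, a2, a3, a4⟩ := h1
  obtain ⟨b1, b2, b3, b4⟩ := h2
  rw [mem_uIcc] at hr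
  simp only at *
  refine ⟨?_, ?_, a3, a4⟩ <;> simp only <;> rcases hr with hr | hr <;> linarith [hr.1, hr.2]

lemma SP.uyy_bd (h : SP X Y a b δ K O₁ O₂ O₃ O₄ O₅ u ux uy uxx uxy uyy) :
    ∃ C ≥ 1, ∀ p ∈ Strp X Y, |uyy p| ≤ C * p.1 := by
  have ha := h.ha
  have hb := h.hb
  have hK := h.hK
  have hY := h.hY
  have hδ := h.hδ
  set C0 := (3 + a * K) * K + K * K + 2 * K + K * (K * Y) with hC0
  have : 0 ≤ C0 := by positivity
  refine ⟨2 / b * C0 + 1, by have : 0 ≤ 2 / b * C0 := by positivity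
                             linarith, fun p hp => ?_⟩
  have hp1 := hp.1
  have t1 : |(2 * p.1 - a * ux p + O₁ p) * uxx p| ≤ ((3 + a * K) * p.1) * K := by
    rw [abs_mul, abs_of_nonneg ((by positivity : 0 ≤ δ / 2 * p.1).trans (h.A_low hp))]
    gcongr
    · exact h.A_up hp
    · exact h.bxx p hp
  have t2 : |O₂ p * uxy p| ≤ (K * p.1) * K := by
    rw [abs_mul]; gcongr
    · exact h.o2 p hp
    · exact h.bxy p hp
  have t3 : |(1 + O₄ p) * ux p| ≤ 2 * (K * p.1) := by
    rw [abs_mul]; gcongr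
    · have := h.o4 p hp
      have k := (h.Kx hp).2.2.1
      rw [abs_le] at this ⊢; constructor <;> linarith [this.1, this.2]
    · exact (h.bx p hp).1
  have t4 : |O₅ p * uy p| ≤ (K * p.1) * (K * Y) := by
    rw [abs_mul]; gcongr
    · exact h.o5 p hp
    · exact (h.bY p hp).trans (by have := hp.2.2.2.le; gcongr)
  have e : (b + O₃ p) * uyy p = -((2 * p.1 - a * ux p + O₁ p) * uxx p) - O₂ p * uxy p + (1 + O₄ p) * ux p - O₅ p * uy p := by
    linear_combination h.eq p hp
  have B := h.B_bd hp
  have t5 : |(b + O₃ p) * uyy p| ≤ C0 * p.1 := by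
    rw [e, hC0]
    rw [abs_le] at *
    constructor <;> linarith [t1.1, t1.2, t2.1, t2.2, t3.1, t3.2, t4.1, t4.2]
  rw [abs_mul, abs_of_pos (by linarith [B.1])] at t5
  have t6 : b / 2 * |uyy p| ≤ C0 * p.1 := le_trans (by gcongr; exact B.1) t5
  have : |uyy p| ≤ 2 / b * (C0 * p.1) := by
    rw [div_mul_eq_mul_div, le_div_iff₀ hb]; linarith
  linarith

lemma SP.uy_bd (h : SP X Y a b δ K O₁ O₂ O₃ O₄ O₅ u ux uy uxx uxy uyy) (Y3 : ℝ) :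
    ∃ C ≥ 1, ∀ τ > 0, τ < Y - Y3 → ∀ x y, 0 < x → x ≤ 3 * τ^2 → x < X → 0 < y → y ≤ Y3 → |uy (x, y)| ≤ C * τ^3 := by
  have ha := h.ha
  obtain ⟨C1, hC1, H⟩ := h.uyy_bd
  refine ⟨18 / a + 3 * C1, by have : 0 ≤ 18 / a := by positivity
                              linarith, fun τ hτ hτY x y hx hx3 hxX hy hy3 => ?_⟩
  have hin : ∀ r ∈ Icc y (y + τ), (x, r) ∈ Strp X Y := fun r hr => ⟨hx, hxX, hy.trans_le hr.1, by simp only; linarith [hr.2]⟩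
  have hu : ∀ r ∈ Icc y (y + τ), |u (x, r)| ≤ 9 * τ^4 / a := fun r hr => by
    have hi := hin r hr
    have := h.ub (x, r) hx.le hxX hi.2.2.1.le hi.2.2.2
    rw [abs_of_nonneg this.1, le_div_iff₀ ha]
    have e : x^2 ≤ (3 * τ^2)^2 := by gcongr
    simp only at this
    nlinarith [this.2]
  have := interp1 (g := fun r => u (x, r)) (g' := fun r => uy (x, r)) (g2 := fun r => uyy (x, r)) (L := C1 * (3 * τ^2)) hτ
    (fun r hr => linF_dy (h.c2.d0 _ (hin r hr))) (fun r hr => linF_dy (h.c2.d2 _ (hin r hr)))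
    (fun r hr => (H _ (hin r hr)).trans (by simp only; gcongr)) (hu y ⟨le_rfl, by linarith⟩) (hu _ ⟨by linarith, le_rfl⟩)
  have e : 2 * (9 * τ^4 / a) + C1 * (3 * τ^2) * τ^2 = τ * ((18 / a + 3 * C1) * τ^3) := by ring
  rw [e] at this
  exact le_of_mul_le_mul_left this hτ

lemma SP.ux_hol (h : SP X Y a b δ K O₁ O₂ O₃ O₄ O₅ u ux uy uxx uxy uyy) (Y3 : ℝ) :
    ∃ C ≥ 1, ∀ σ > 0, σ ≤ 1 → σ^2 < Y - Y3 → 3 * σ^4 < X → ∀ x y y' v, 0 < x → x ≤ 2 * σ^4 → 0 ≤ v → v ≤ 1 → 0 < y → y ≤ Y3 →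
      0 < y' → y' ≤ Y3 → |y - y'| ≤ σ^2 * v^2 → |ux (x, y) - ux (x, y')| ≤ C * (σ^4 * v) := by
  have hK := h.hK
  obtain ⟨C2, hC2, H⟩ := h.uy_bd Y3
  refine ⟨2 * C2 + 2 * K, by linarith, fun σ hσ hσ1 hσY hσX x y y' v hx hx2 hv hv1 hy hy3 hy' hy3' hd => ?_⟩
  have hYY : Y3 < Y := by nlinarith
  rcases hv.eq_or_lt with rfl | hv0
  · have : y = y' := by
      have : |y - y'| ≤ 0 := by simpa using hd
      linarith [abs_nonpos_iff.1 this]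
    simp [this]
  have hh : 0 < σ^4 * v := by positivity
  have hh1 : σ^4 * v ≤ σ^4 * 1 := by gcongr
  have hin : ∀ r ∈ Icc x (x + σ^4 * v), ∀ t, 0 < t → t ≤ Y3 → (r, t) ∈ Strp X Y := fun r hr t ht ht3 =>
    ⟨hx.trans_le hr.1, by simp only; linarith [hr.2], ht, by simp only; linarith⟩
  have hφ : ∀ r ∈ Icc x (x + σ^4 * v), |u (r, y) - u (r, y')| ≤ C2 * σ^6 * (σ^2 * v^2) := fun r hr => by
    have i1 := hin r hr y hy hy3
    have i2 := hin r hr y' hy' hy3'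
    have hb : ∀ t ∈ uIcc y' y, |uy (r, t)| ≤ C2 * σ^6 := fun t ht => by
      have i3 := SP.vseg i2 i1 ht
      have : t ≤ Y3 := by
        rw [mem_uIcc] at ht; rcases ht with ht | ht <;> linarith [ht.2]
      have := H (σ^2) (by positivity) hσY r t i3.1 (by
        have : 3 * (σ^2)^2 = 3 * σ^4 := by ring
        rw [this]; linarith [hr.2]) i3.2.1 i3.2.2.1 this
      exact this.trans_eq (by ring)
    have := mvt1 (g := fun t => u (r, t)) (g' := fun t => uy (r, t)) (fun t ht => linF_dy (h.c2.d0 _ (SP.vseg i2 i1 ht))) hb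
    exact this.trans (by gcongr)
  have key := interp1 (g := fun r => u (r, y) - u (r, y')) (g' := fun r => ux (r, y) - ux (r, y'))
    (g2 := fun r => uxx (r, y) - uxx (r, y')) (L := 2 * K) hh
    (fun r hr => (linF_dx (h.c2.d0 _ (hin r hr y hy hy3))).sub (linF_dx (h.c2.d0 _ (hin r hr y' hy' hy3'))))
    (fun r hr => (linF_dx (h.c2.d1 _ (hin r hr y hy hy3))).sub (linF_dx (h.c2.d1 _ (hin r hr y' hy' hy3'))))
    (fun r hr => (abs_sub _ _).trans (by linarith [h.bxx _ (hin r hr y hy hy3), h.bxx _ (hin r hr y' hy' hy3')]))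
    (hφ x ⟨le_rfl, by linarith⟩) (hφ _ ⟨by linarith, le_rfl⟩)
  have e : 2 * (C2 * σ^6 * (σ^2 * v^2)) + 2 * K * (σ^4 * v)^2 = σ^4 * v * ((2 * C2 + 2 * K) * (σ^4 * v)) := by ring
  rw [e] at key
  exact le_of_mul_le_mul_left key hh

lemma SP.ux_lip (h : SP X Y a b δ K O₁ O₂ O₃ O₄ O₅ u ux uy uxx uxy uyy) {x x' y : ℝ}
    (h1 : (x, y) ∈ Strp X Y) (h2 : (x', y) ∈ Strp X Y) : |ux (x, y) - ux (x', y)| ≤ K * |x - x'| :=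
  mvt1 (g := fun t => ux (t, y)) (g' := fun t => uxx (t, y)) (fun r hr => linF_dx (h.c2.d1 _ (SP.hseg h2 h1 hr)))
    (fun r hr => h.bxx _ (SP.hseg h2 h1 hr))

lemma SP.uy_lip (h : SP X Y a b δ K O₁ O₂ O₃ O₄ O₅ u ux uy uxx uxy uyy) {p q : ℝ × ℝ}
    (h1 : p ∈ Strp X Y) (h2 : q ∈ Strp X Y) : |uy p - uy q| ≤ K * (|p.1 - q.1| + |p.2 - q.2|) := by
  obtain ⟨x, y⟩ := p
  obtain ⟨x', y'⟩ := q
  have h3 : (x', y) ∈ Strp X Y := ⟨h2.1, h2.2.1, h1.2.2.1, h1.2.2.2⟩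
  have a1 := mvt1 (g := fun t => uy (t, y)) (g' := fun t => uxy (t, y)) (fun r hr => linF_dx (h.c2.d2 _ (SP.hseg h3 h1 hr)))
    (fun r hr => h.bxy _ (SP.hseg h3 h1 hr))
  have a2 := mvt1 (g := fun t => uy (x', t)) (g' := fun t => uyy (x', t)) (fun r hr => linF_dy (h.c2.d2 _ (SP.vseg h2 h3 hr)))
    (fun r hr => h.byy _ (SP.vseg h2 h3 hr))
  have := abs_sub_le (uy (x, y)) (uy (x', y)) (uy (x', y'))
  simp only at *
  linarith
end
end

section
lemma mul_abs_le {x y A B C : ℝ} (h1 : |x| ≤ A) (h2 : |y| ≤ B) (h : A * B ≤ C) : |x * y| ≤ C := by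
  rw [abs_mul]
  exact (mul_le_mul h1 h2 (abs_nonneg _) ((abs_nonneg _).trans h1)).trans h

section
variable {X Y a b δ K : ℝ} {O₁ O₂ O₃ O₄ O₅ u ux uy uxx uxy uyy : ℝ × ℝ → ℝ}

lemma SP.gdiff (h : SP X Y a b δ K O₁ O₂ O₃ O₄ O₅ u ux uy uxx uxy uyy) (Y3 : ℝ) :
    ∃ C ≥ 1, ∀ σ > 0, σ ≤ 1 → σ^2 < Y - Y3 → 3 * σ^4 < X → ∀ z z0 : ℝ × ℝ, ∀ v M : ℝ, z0.1 = σ^4 → 0 < z.1 → z.1 ≤ 2 * σ^4 →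
      0 < z.2 → z.2 ≤ Y3 → 0 < z0.2 → z0.2 ≤ Y3 → 0 ≤ v → v ≤ 1 → |z.1 - z0.1| ≤ σ^4 * v^2 → |z.2 - z0.2| ≤ σ^2 * v^2 → |uxy z| ≤ M →
      |((2 * z0.1 - a * ux z0 + O₁ z0) * uxx z + O₂ z0 * uxy z + (b + O₃ z0) * uyy z) -
       ((2 * z0.1 - a * ux z0 + O₁ z0) * uxx z0 + O₂ z0 * uxy z0 + (b + O₃ z0) * uyy z0)| ≤ C * ((σ^4 + M * σ^3) * v) := by
  have hK := h.hK
  have ha := h.ha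
  have hK0 : 0 < K := by linarith
  obtain ⟨C1, hC1, H1⟩ := h.uyy_bd
  obtain ⟨C2, hC2, H2⟩ := h.uy_bd Y3
  obtain ⟨Ch, hCh, Hh⟩ := h.ux_hol Y3
  set U := K + Ch with hU
  have hU1 : 1 ≤ U := by linarith
  refine ⟨(2 + a * U + 4 * K) * K + 3 * K + 4 * K * C1 + U + 4 * K^2 + K * U + 2 * K * C2 + 2 * K^2, ?_, ?_⟩
  · have : 0 ≤ (2 + a * U + 4 * K) * K + 3 * K + 4 * K * C1 + 4 * K^2 + K * U + 2 * K * C2 + 2 * K^2 := by positivity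
    linarith
  rintro σ hσ hσ1 hσY hσX ⟨x, y⟩ ⟨x0, y0⟩ v M hx0 hx hx2 hy hy3 hy0 hy03 hv hv1 hdx hdy hM
  simp only at hx0 hx hx2 hy hy3 hy0 hy03 hdx hdy ⊢
  have hYY : Y3 < Y := by nlinarith
  have hs4 : 0 < σ^4 := by positivity
  have hz : (x, y) ∈ Strp X Y := ⟨hx, by simp only; linarith, hy, by simp only; linarith⟩
  have hz0 : (x0, y0) ∈ Strp X Y := ⟨by simp only; linarith, by simp only; linarith, hy0, by simp only; linarith⟩
  have hz1 : (x0, y) ∈ Strp X Y := ⟨hz0.1, hz0.2.1, hz.2.2.1, hz.2.2.2⟩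
  have hM0 : 0 ≤ M := (abs_nonneg _).trans hM
  have vv : v^2 ≤ v := by nlinarith
  have s42 : σ^4 ≤ σ^2 := pow_le_pow_of_le_one hσ.le hσ1 (by norm_num)
  have s64 : σ^6 ≤ σ^4 := pow_le_pow_of_le_one hσ.le hσ1 (by norm_num)
  have s84 : σ^8 ≤ σ^4 := pow_le_pow_of_le_one hσ.le hσ1 (by norm_num)
  have s4 : σ^4 ≤ 1 := pow_le_one₀ hσ.le hσ1
  have p64 : σ^6 * v^2 ≤ σ^4 * v := mul_le_mul s64 vv (by positivity) (by positivity)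
  have p84 : σ^8 * v^2 ≤ σ^4 * v := mul_le_mul s84 vv (by positivity) (by positivity)
  have p44 : σ^4 * v^2 ≤ σ^4 * v := by gcongr
  have p84' : σ^8 * v ≤ σ^4 * v := by gcongr
  have hL : |x - x0| + |y - y0| ≤ 2 * (σ^2 * v^2) := by
    have : σ^4 * v^2 ≤ σ^2 * v^2 := by gcongr
    linarith
  have hL' : |x0 - x| + |y0 - y| ≤ 2 * (σ^2 * v^2) := by rw [abs_sub_comm x0, abs_sub_comm y0]; exact hL
  have dux : |ux (x, y) - ux (x0, y0)| ≤ U * (σ^4 * v) := by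
    have a1 := h.ux_lip hz hz1
    have a2 := Hh σ hσ hσ1 hσY hσX x0 y y0 v hz0.1 (by linarith) hv hv1 hy hy3 hy0 hy03 hdy
    have a3 := abs_sub_le (ux (x, y)) (ux (x0, y)) (ux (x0, y0))
    have a4 : K * |x - x0| ≤ K * (σ^4 * v) := by gcongr; linarith
    rw [hU]; linarith
  have dA : |(2 * x0 - a * ux (x0, y0) + O₁ (x0, y0)) - (2 * x - a * ux (x, y) + O₁ (x, y))| ≤ (2 + a * U + 4 * K) * (σ^4 * v) := by
    have a1 := h.l1 _ hz0 _ hz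
    simp only at a1
    have a2 : K * max x0 x * (|x0 - x| + |y0 - y|) ≤ K * (2 * σ^4) * (2 * (σ^2 * v^2)) := by
      gcongr; exact max_le (by linarith) hx2
    have a3 : K * (2 * σ^4) * (2 * (σ^2 * v^2)) = 4 * K * (σ^6 * v^2) := by ring
    have a4 : 4 * K * (σ^6 * v^2) ≤ 4 * K * (σ^4 * v) := by gcongr
    have a5 : a * |ux (x, y) - ux (x0, y0)| ≤ a * (U * (σ^4 * v)) := by gcongr
    have a6 : |a * (ux (x, y) - ux (x0, y0))| = a * |ux (x, y) - ux (x0, y0)| := by rw [abs_mul, abs_of_pos ha]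
    have a7 := abs_add_three (2 * (x0 - x)) (a * (ux (x, y) - ux (x0, y0))) (O₁ (x0, y0) - O₁ (x, y))
    have a8 : |2 * (x0 - x)| = 2 * |x - x0| := by rw [abs_mul, abs_sub_comm]; norm_num
    have e : (2 * x0 - a * ux (x0, y0) + O₁ (x0, y0)) - (2 * x - a * ux (x, y) + O₁ (x, y)) = 2 * (x0 - x) + a * (ux (x, y) - ux (x0, y0)) + (O₁ (x0, y0) - O₁ (x, y)) := by ring
    rw [e]; linarith
  have dE : |O₂ (x0, y0) - O₂ (x, y)| ≤ 3 * K * (σ^3 * v) := by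
    have a1 : |O₂ (x0, y0) - O₂ (x, y)| ≤ K * (2 * (σ^2 * v^2)) := (h.l2 _ hz0 _ hz).trans (by gcongr)
    have a2 : |O₂ (x0, y0) - O₂ (x, y)| ≤ 3 * K * σ^4 := by
      refine (abs_sub _ _).trans ?_
      have b1 := h.o2 _ hz0
      have b2 := h.o2 _ hz
      simp only at b1 b2
      have : K * x ≤ K * (2 * σ^4) := by gcongr
      rw [hx0] at b1 ⊢
      linarith
    have a3 := mul_le_mul a1 a2 (abs_nonneg _) (by positivity)
    refine (sq_le_sq₀ (abs_nonneg _) (by positivity)).1 ?_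
    have : 0 ≤ (K * (σ^3 * v))^2 := sq_nonneg _
    rw [pow_two |O₂ (x0, y0) - O₂ (x, y)|]
    linarith only [this, a3]
  have dL : ∀ O : ℝ × ℝ → ℝ, |O (x, y) - O (x0, y0)| ≤ K * (|x - x0| + |y - y0|) → |O (x, y) - O (x0, y0)| ≤ K * (2 * (σ^2 * v^2)) :=
    fun O hO => hO.trans (by gcongr)
  have d3 := dL O₃ (h.l3 _ hz _ hz0)
  have d4 := dL O₄ (h.l4 _ hz _ hz0)
  have d5 := dL O₅ (h.l5 _ hz _ hz0)
  have dy := dL uy (h.uy_lip hz hz0)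
  have t1 := mul_abs_le dA (h.bxx _ hz) le_rfl
  have t2 := mul_abs_le dE hM le_rfl
  have t3 : |(O₃ (x, y) - O₃ (x0, y0)) * uyy (x, y)| ≤ 4 * K * C1 * (σ^4 * v) := by
    refine mul_abs_le d3 ((H1 _ hz).trans (mul_le_mul_of_nonneg_left hx2 (by linarith))) ?_
    calc K * (2 * (σ^2 * v^2)) * (C1 * (2 * σ^4)) = 4 * K * C1 * (σ^6 * v^2) := by ring
      _ ≤ _ := by gcongr
  have t4 : |(O₄ (x, y) - O₄ (x0, y0)) * ux (x, y)| ≤ 4 * K^2 * (σ^4 * v) := by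
    refine mul_abs_le d4 ((h.bx _ hz).1.trans (mul_le_mul_of_nonneg_left hx2 (by linarith))) ?_
    calc K * (2 * (σ^2 * v^2)) * (K * (2 * σ^4)) = 4 * K^2 * (σ^6 * v^2) := by ring
      _ ≤ _ := by gcongr
  have t5 : |O₄ (x0, y0) * (ux (x, y) - ux (x0, y0))| ≤ K * U * (σ^4 * v) := by
    refine mul_abs_le (h.o4 _ hz0) dux ?_
    simp only [hx0]
    calc K * σ^4 * (U * (σ^4 * v)) = K * U * (σ^8 * v) := by ring
      _ ≤ _ := by gcongr
  have t6 : |(O₅ (x, y) - O₅ (x0, y0)) * uy (x, y)| ≤ 2 * K * C2 * (σ^4 * v) := by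
    refine mul_abs_le d5 (H2 (σ^2) (by positivity) hσY x y hx (by
      have : 3 * (σ^2)^2 = 3 * σ^4 := by ring
      rw [this]; linarith) hz.2.1 hy hy3) ?_
    calc K * (2 * (σ^2 * v^2)) * (C2 * (σ^2)^3) = 2 * K * C2 * (σ^8 * v^2) := by ring
      _ ≤ _ := by gcongr
  have t7 : |O₅ (x0, y0) * (uy (x, y) - uy (x0, y0))| ≤ 2 * K^2 * (σ^4 * v) := by
    refine mul_abs_le (h.o5 _ hz0) dy ?_
    simp only [hx0]
    calc K * σ^4 * (K * (2 * (σ^2 * v^2))) = 2 * K^2 * (σ^6 * v^2) := by ring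
      _ ≤ _ := by gcongr
  have e1 := h.eq _ hz
  have e2 := h.eq _ hz0
  simp only at e1 e2
  have e : ((2 * x0 - a * ux (x0, y0) + O₁ (x0, y0)) * uxx (x, y) + O₂ (x0, y0) * uxy (x, y) + (b + O₃ (x0, y0)) * uyy (x, y)) -
       ((2 * x0 - a * ux (x0, y0) + O₁ (x0, y0)) * uxx (x0, y0) + O₂ (x0, y0) * uxy (x0, y0) + (b + O₃ (x0, y0)) * uyy (x0, y0)) =
      ((2 * x0 - a * ux (x0, y0) + O₁ (x0, y0)) - (2 * x - a * ux (x, y) + O₁ (x, y))) * uxx (x, y)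
      + (O₂ (x0, y0) - O₂ (x, y)) * uxy (x, y) - (O₃ (x, y) - O₃ (x0, y0)) * uyy (x, y) + (ux (x, y) - ux (x0, y0))
      + (O₄ (x, y) - O₄ (x0, y0)) * ux (x, y) + O₄ (x0, y0) * (ux (x, y) - ux (x0, y0))
      - (O₅ (x, y) - O₅ (x0, y0)) * uy (x, y) - O₅ (x0, y0) * (uy (x, y) - uy (x0, y0)) := by
    linear_combination e1 - e2
  rw [e]
  have r1 : 0 ≤ σ^4 * v := by positivity
  have r2 : 0 ≤ M * (σ^3 * v) := by positivity
  have q1 : 0 ≤ ((2 + a * U + 4 * K) * K + 4 * K * C1 + U + 4 * K^2 + K * U + 2 * K * C2 + 2 * K^2) * (M * (σ^3 * v)) := by positivity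
  have q2 : 0 ≤ 3 * K * (σ^4 * v) := by positivity
  rw [abs_le] at *
  constructor <;> linarith [t1.1, t1.2, t2.1, t2.2, t3.1, t3.2, t4.1, t4.2, t5.1, t5.2, t6.1, t6.2, t7.1, t7.2, dux.1, dux.2]
end
end

section
lemma app0 : ∃ C > 0, ∀ (U : Set (ℝ × ℝ)) (W Wx Wy Wxx Wxy Wyy : ℝ × ℝ → ℝ), C2on U W Wx Wy Wxx Wxy Wyy →
    ∀ x0 y0 p q r R d g0 m G e : ℝ, 0 < p → 0 < r → 0 < R → 0 < d → d ≤ 1 → q^2 ≤ p^2 → 0 ≤ m → 0 ≤ G → 0 ≤ e →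
    (∀ t ∈ BX d, (x0 + R * (p * t.1 + q * t.2), y0 + R * r * t.2) ∈ U) →
    (∀ t ∈ BX d, |W (x0 + R * (p * t.1 + q * t.2), y0 + R * r * t.2)| ≤ m) →
    (∀ t ∈ BX d, ∀ z, z = (x0 + R * (p * t.1 + q * t.2), y0 + R * r * t.2) →
      |((p^2 + q^2) * Wxx z + 2 * (q * r) * Wxy z + r^2 * Wyy z) - g0| ≤ G * (qq t) ^ (1/8:ℝ)) →
    (d = 1 ∨ ∀ s ∈ Icc (-1:ℝ) 1, |R * r * Wy (x0 + R * (p * s + q * (-d)), y0 + R * r * (-d))| ≤ e * d^2) →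
    R^2 * (p * |q * Wxx (x0, y0) + r * Wxy (x0, y0)|) ≤ C * (m + 2 * R^2 * |g0| + R^2 * G + e) ∧
    R^2 * (p^2 * |Wxx (x0, y0)|) ≤ C * (m + 2 * R^2 * |g0| + R^2 * G + e) := by
  obtain ⟨C, hC, H⟩ := lemS
  refine ⟨C, hC, ?_⟩
  intro U W Wx Wy Wxx Wxy Wyy hW x0 y0 p q r R d g0 m G e hp hr hR hd hd1 hqp hm hG he hin hWm hg hbot
  have A1 := hW.aff (V := BX d) x0 y0 (R * p) (R * q) 0 (R * r) (fun t ht => by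
    convert hin t ht using 2 <;> ring)
  have A2 := C2on_snd (U := BX d) (g := fun t => R^2 * g0 / 2 * (t + d)^2) (g1 := fun t => R^2 * g0 * (t + d))
    (g2 := fun _ => R^2 * g0) (fun z _ => by
      refine ((((hasDerivAt_id z.2).add_const d).pow 2).const_mul (R^2 * g0 / 2)).congr_deriv ?_
      simp only [id, Nat.cast_ofNat, Nat.add_one_sub_one, pow_one]; ring) (fun z _ => by
      refine (((hasDerivAt_id z.2).add_const d).const_mul (R^2 * g0)).congr_deriv ?_
      ring) continuousOn_const
  have A3 := A1.sub A2
  have hT : ∀ t : ℝ × ℝ, ((x0 + (R * p * t.1 + R * q * t.2), y0 + (0 * t.1 + R * r * t.2)) : ℝ × ℝ) = (x0 + R * (p * t.1 + q * t.2), y0 + R * r * t.2) := by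
    intro t; ext <;> simp only <;> ring
  simp only [hT] at A3
  have hc : |q / p| ≤ 1 := by
    rw [abs_div, abs_of_pos hp, div_le_one hp]
    exact abs_le_of_sq_le_sq hqp hp.le
  have h0 : (0 : ℝ × ℝ) ∈ BX d := by rw [mem_BX]; simp; linarith
  have key := H (q / p) d (m + 2 * R^2 * |g0|) (R^2 * G) e hd hd1 hc (by positivity) (by positivity) he _ _ _ _ _ _ A3
    (fun t ht => by
      refine (abs_sub _ _).trans ?_
      have h1 := hWm t ht
      have h2 : |R^2 * g0 / 2 * (t.2 + d)^2| ≤ 2 * R^2 * |g0| := by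
        rw [mem_BX] at ht
        have e1 : (t.2 + d)^2 ≤ 4 := by nlinarith [ht.2.1, ht.2.2.2]
        have e2 : |R^2 * g0 / 2 * (t.2 + d)^2| = R^2 * |g0| / 2 * (t.2 + d)^2 := by
          rw [abs_mul, abs_div, abs_mul, abs_of_pos (by positivity : 0 < R^2), abs_of_nonneg (sq_nonneg (t.2 + d))]; norm_num
        rw [e2]
        calc R^2 * |g0| / 2 * (t.2 + d)^2 ≤ R^2 * |g0| / 2 * 4 := by gcongr
          _ = _ := by ring
      linarith)
    (fun t ht => by
      have h1 := hg t ht _ rfl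
      calc _ = |R^2 * (((p^2 + q^2) * Wxx (x0 + R * (p * t.1 + q * t.2), y0 + R * r * t.2) + 2 * (q * r) * Wxy (x0 + R * (p * t.1 + q * t.2), y0 + R * r * t.2) + r^2 * Wyy (x0 + R * (p * t.1 + q * t.2), y0 + R * r * t.2)) - g0)| := by congr 1; ring
        _ ≤ R^2 * (G * (qq t) ^ (1/8:ℝ)) := by rw [abs_mul, abs_of_pos (by positivity : 0 < R^2)]; gcongr
        _ = _ := by ring)
    (by
      rcases hbot with hb | hb
      · exact Or.inl hb
      · refine Or.inr fun s hs => ?_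
        have := hb s hs
        refine le_trans (le_of_eq ?_) this
        congr 1
        field_simp
        ring)
  obtain ⟨k1, k2⟩ := key
  have hgz := hg 0 h0 (x0, y0) (by simp)
  have hq0 : (qq (0 : ℝ × ℝ)) ^ (1/8:ℝ) = 0 := by
    have : qq (0 : ℝ × ℝ) = 0 := by simp [qq]
    rw [this, Real.zero_rpow (by norm_num)]
  rw [hq0, mul_zero] at hgz
  have hgz' := sub_eq_zero.1 (abs_nonpos_iff.1 hgz)
  simp only [Prod.fst_zero, Prod.snd_zero, mul_zero, add_zero, zero_mul, sub_zero] at k1 k2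
  constructor
  · refine le_trans (le_of_eq ?_) k1
    rw [← abs_of_pos hp, ← abs_mul, abs_of_pos hp, ← abs_of_pos (by positivity : 0 < R^2), ← abs_mul]
    congr 1; ring
  · have e1 : R^2 * (p^2 * |Wxx (x0, y0)|) = |R^2 * (p^2 * Wxx (x0, y0))| := by
      rw [abs_mul, abs_mul, abs_of_pos (by positivity : 0 < R^2), abs_of_pos (by positivity : 0 < p^2)]
    rw [e1]
    have e2 : 2 * (R^2 * (p^2 * Wxx (x0, y0))) = Wxx (x0, y0) * (R * p)^2 + 2 * 0 + Wyy (x0, y0) * 0^2 - 0 -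
        (Wxx (x0, y0) * (R * q)^2 + 2 * (Wxy (x0, y0) * (R * q) * (R * r)) + Wyy (x0, y0) * (R * r)^2 - R^2 * g0) := by
      rw [← hgz']; ring
    have e3 : |2 * (R^2 * (p^2 * Wxx (x0, y0)))| ≤ C * (m + 2 * R^2 * |g0| + R^2 * G + e) := by
      rw [e2]
      refine le_trans (le_of_eq ?_) k2
      congr 1; ring
    rw [abs_mul, abs_of_pos (by norm_num : (0:ℝ) < 2)] at e3
    linarith [abs_nonneg (R^2 * (p^2 * Wxx (x0, y0)))]
end

section
lemma choose_d {y0 c K e : ℝ} (hy : 0 < y0) (hc : 0 < c) (hK : 0 < K) (he : 0 < e) :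
    ∃ d, 0 < d ∧ d ≤ 1 ∧ 0 < y0 - c * d ∧ (d = 1 ∨ c * K * (y0 - c * d) ≤ e * d^2) := by
  by_cases hcy : c < y0
  · exact ⟨1, one_pos, le_rfl, by linarith, Or.inl rfl⟩
  push Not at hcy
  set d0 := y0 / (2 * c) with hd0
  have hd0p : 0 < d0 := by positivity
  set ε := min (y0 / 2) (e * d0^2 / (c * K)) with hε
  have hεp : 0 < ε := by positivity
  have e1 : ε ≤ y0 / 2 := min_le_left _ _
  have e2 : ε ≤ e * d0^2 / (c * K) := min_le_right _ _
  have h1 : d0 ≤ (y0 - ε) / c := by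
    rw [hd0, div_le_div_iff₀ (by positivity) hc]
    nlinarith
  have h2 : c * ((y0 - ε) / c) = y0 - ε := by field_simp
  refine ⟨(y0 - ε) / c, hd0p.trans_le h1, ?_, by rw [h2]; linarith, Or.inr ?_⟩
  · rw [div_le_one hc]; linarith
  · rw [h2, sub_sub_cancel]
    calc c * K * ε ≤ c * K * (e * d0^2 / (c * K)) := by gcongr
      _ = e * d0^2 := by field_simp
      _ ≤ _ := by gcongr

lemma rho8 {t : ℝ × ℝ} (h1 : |t.1| ≤ 1) (h2 : |t.2| ≤ 1) :
    0 ≤ (qq t) ^ (1/8:ℝ) ∧ |t.1| ≤ ((qq t) ^ (1/8:ℝ))^4 ∧ |t.2| ≤ ((qq t) ^ (1/8:ℝ))^4 ∧ ((qq t) ^ (1/8:ℝ))^2 ≤ 2 ∧ (qq t) ^ (1/8:ℝ) ≤ 2 := by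
  have hq : 0 ≤ qq t := by unfold qq; positivity
  set ρ := (qq t) ^ (1/8:ℝ) with hρ
  have h0 : 0 ≤ ρ := by positivity
  have h8 : ρ^8 = qq t := by
    rw [hρ, ← Real.rpow_natCast, ← Real.rpow_mul hq]; norm_num
  have e8 : (ρ^4)^2 = t.1^2 + t.2^2 := by rw [← pow_mul]; exact h8
  have hq2 : t.1^2 + t.2^2 ≤ 2 := by
    rw [← sq_abs t.1, ← sq_abs t.2]; nlinarith [abs_nonneg t.1, abs_nonneg t.2]
  have h4 : ρ^4 ≤ 2 := by nlinarith [pow_nonneg h0 4]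
  have h2' : ρ^2 ≤ 2 := by
    have : (ρ^2)^2 ≤ 2 := by rw [← pow_mul]; exact h4
    nlinarith [pow_nonneg h0 2]
  refine ⟨h0, abs_le_of_sq_le_sq (by rw [e8]; nlinarith [sq_nonneg t.2]) (by positivity), abs_le_of_sq_le_sq (by rw [e8]; nlinarith [sq_nonneg t.1]) (by positivity), h2', by nlinarith⟩

lemma app_alg {δ σ k p q r r0 P C0 D Φ m S Wxx Wxy : ℝ} (hδ : 0 < δ) (hδ1 : δ < 1) (hσ : 0 < σ) (hk : 0 < k) (hp : 0 < p) (hr0 : 0 < r0) (hr : r0 ≤ r)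
    (hp2 : δ / 4 * σ^4 ≤ p^2) (hq : |q| ≤ P * σ^2) (hC0 : 0 < C0) (hD : 0 < D) (hΦ : 0 ≤ Φ)
    (hS : S ≤ (k^2 * σ^2)^2 * (σ^4 * (D * Φ)))
    (h1 : (k^2 * σ^2)^2 * (p * |q * Wxx + r * Wxy|) ≤ C0 * S)
    (h2 : (k^2 * σ^2)^2 * (p^2 * |Wxx|) ≤ C0 * S) :
    |Wxx| ≤ (4 / δ * C0 * D) * Φ ∧ |Wxy| ≤ (4 / δ * C0 * D) * (1 + P) / r0 * (σ^2 * Φ) := by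
  have hR : 0 < (k^2 * σ^2)^2 := by positivity
  have b1 : p * |q * Wxx + r * Wxy| ≤ C0 * (σ^4 * (D * Φ)) := by
    refine le_of_mul_le_mul_left (h1.trans ?_) hR
    calc C0 * S ≤ C0 * ((k^2 * σ^2)^2 * (σ^4 * (D * Φ))) := by gcongr
      _ = _ := by ring
  have b2 : p^2 * |Wxx| ≤ C0 * (σ^4 * (D * Φ)) := by
    refine le_of_mul_le_mul_left (h2.trans ?_) hR
    calc C0 * S ≤ C0 * ((k^2 * σ^2)^2 * (σ^4 * (D * Φ))) := by gcongr
      _ = _ := by ring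
  have hs4 : 0 < σ^4 := by positivity
  have r1 : |Wxx| ≤ (4 / δ * C0 * D) * Φ := by
    have : δ / 4 * σ^4 * |Wxx| ≤ δ / 4 * σ^4 * ((4 / δ * C0 * D) * Φ) := by
      calc δ / 4 * σ^4 * |Wxx| ≤ p^2 * |Wxx| := by gcongr
        _ ≤ _ := b2
        _ = _ := by field_simp
    exact le_of_mul_le_mul_left this (by positivity)
  refine ⟨r1, ?_⟩
  have hpl : δ / 4 * σ^2 ≤ p := by
    refine (sq_le_sq₀ (by positivity) hp.le).1 (le_trans ?_ hp2)
    have : (δ / 4 * σ^2)^2 = (δ / 4 * (δ / 4)) * σ^4 := by ring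
    rw [this]
    gcongr
    nlinarith
  have b3 : |q * Wxx + r * Wxy| ≤ σ^2 * ((4 / δ * C0 * D) * Φ) := by
    have : δ / 4 * σ^2 * |q * Wxx + r * Wxy| ≤ δ / 4 * σ^2 * (σ^2 * ((4 / δ * C0 * D) * Φ)) := by
      calc δ / 4 * σ^2 * |q * Wxx + r * Wxy| ≤ p * |q * Wxx + r * Wxy| := by gcongr
        _ ≤ _ := b1
        _ = _ := by field_simp
    exact le_of_mul_le_mul_left this (by positivity)
  have b4 : |q * Wxx| ≤ P * σ^2 * ((4 / δ * C0 * D) * Φ) := mul_abs_le hq r1 le_rfl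
  have b5 : r0 * |Wxy| ≤ (4 / δ * C0 * D) * (1 + P) * (σ^2 * Φ) := by
    calc r0 * |Wxy| ≤ r * |Wxy| := by gcongr
      _ = |(q * Wxx + r * Wxy) - q * Wxx| := by rw [add_sub_cancel_left, abs_mul, abs_of_pos (hr0.trans_le hr)]
      _ ≤ _ := abs_sub _ _
      _ ≤ σ^2 * ((4 / δ * C0 * D) * Φ) + P * σ^2 * ((4 / δ * C0 * D) * Φ) := add_le_add b3 b4
      _ = _ := by ring
  rw [div_mul_eq_mul_div, le_div_iff₀ hr0]
  linarith
end

section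
variable {X Y a b δ K : ℝ} {O₁ O₂ O₃ O₄ O₅ u ux uy uxx uxy uyy : ℝ × ℝ → ℝ}

lemma SP.coef (h : SP X Y a b δ K O₁ O₂ O₃ O₄ O₅ u ux uy uxx uxy uyy) {z : ℝ × ℝ} (hz : z ∈ Strp X Y) {σ : ℝ} (hσ : 0 < σ)
    (hz1 : z.1 = σ^4) : ∃ p q r : ℝ, 0 < p ∧ √(b/2) ≤ r ∧ r ≤ 1 + 2 * b ∧ q^2 ≤ p^2 ∧ δ / 4 * σ^4 ≤ p^2 ∧ p ≤ (3 + a * K) * σ^2 ∧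
      |q| ≤ (3 + a * K) * σ^2 ∧ p^2 + q^2 = 2 * z.1 - a * ux z + O₁ z ∧ 2 * (q * r) = O₂ z ∧ r^2 = b + O₃ z := by
  have ha := h.ha
  have hb := h.hb
  have hK := h.hK
  have hδ := h.hδ
  have h1 := h.A_low hz
  have h2 := h.A_up hz
  obtain ⟨h3, h4⟩ := h.B_bd hz
  have h5 := h.ell hz
  set A := 2 * z.1 - a * ux z + O₁ z
  set B := b + O₃ z
  rw [hz1] at h1 h2
  have hs : 0 < σ^4 := by positivity
  have hB : 0 < B := by linarith
  have hA : 0 < A := lt_of_lt_of_le (by positivity) h1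
  have hr : 0 < √B := Real.sqrt_pos.2 hB
  have hr2 : (√B)^2 = B := Real.sq_sqrt hB.le
  set q := O₂ z / (2 * √B) with hq
  have hq2 : q^2 ≤ A / 2 := by
    rw [hq, div_pow, mul_pow, hr2, div_le_iff₀ (by positivity)]
    linarith
  have hp2 : (√(A - q^2))^2 = A - q^2 := Real.sq_sqrt (by linarith)
  have hP1 : 1 ≤ 3 + a * K := by nlinarith
  have hAA : A ≤ ((3 + a * K) * σ^2)^2 := by
    refine h2.trans ?_
    have : ((3 + a * K) * σ^2)^2 = (3 + a * K)^2 * σ^4 := by ring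
    rw [this]
    gcongr
    nlinarith
  refine ⟨√(A - q^2), q, √B, Real.sqrt_pos.2 (by linarith), Real.sqrt_le_sqrt h3, ?_, by linarith, by linarith, ?_, ?_, by linarith, ?_, hr2⟩
  · rw [Real.sqrt_le_left (by linarith)]; nlinarith
  · exact Real.sqrt_le_iff.2 ⟨by positivity, by nlinarith⟩
  · exact abs_le_of_sq_le_sq (by linarith) (by positivity)
  · rw [hq]; field_simp

lemma SP.g0bd (h : SP X Y a b δ K O₁ O₂ O₃ O₄ O₅ u ux uy uxx uxy uyy) (Y3 : ℝ) :
    ∃ C ≥ 1, ∀ σ > 0, σ ≤ 1 → σ^2 < Y - Y3 → 3 * σ^4 < X → ∀ z : ℝ × ℝ, ∀ Γ : ℝ, z.1 = σ^4 → 0 < z.2 → z.2 ≤ Y3 →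
      |ux z - σ^4 / a| ≤ Γ * σ^4 →
      |(2 * z.1 - a * ux z + O₁ z) * (uxx z - 1 / a) + O₂ z * uxy z + (b + O₃ z) * uyy z| ≤ 2 * Γ * σ^4 + C * σ^8 := by
  have ha := h.ha
  have hK := h.hK
  obtain ⟨C2, hC2, H⟩ := h.uy_bd Y3
  refine ⟨K * K + K * C2 + K / a + 1, by have : 0 ≤ K * K + K * C2 + K / a := by positivity
                                         linarith, fun σ hσ hσ1 hσY hσX z Γ hz1 hz2 hz3 hΓ => ?_⟩
  have hs : 0 < σ^4 := by positivity
  have hz : z ∈ Strp X Y := ⟨by rw [hz1]; positivity, by rw [hz1]; linarith, hz2, by nlinarith⟩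
  have e := h.eq z hz
  have e2 : (2 * z.1 - a * ux z + O₁ z) * (uxx z - 1 / a) + O₂ z * uxy z + (b + O₃ z) * uyy z =
      2 * (ux z - σ^4 / a) + O₄ z * ux z - O₅ z * uy z - O₁ z / a := by
    have : (2 * z.1 - a * ux z + O₁ z) * (1 / a) = 2 * σ^4 / a - ux z + O₁ z / a := by
      rw [hz1]; field_simp
    linear_combination e - this
  have b1 : |O₄ z * ux z| ≤ K * K * σ^8 := mul_abs_le (h.o4 z hz) (h.bx z hz).1 (by rw [hz1]; apply le_of_eq; ring)
  have hy := H (σ^2) (by positivity) hσY z.1 z.2 hz.1 (by rw [hz1]; nlinarith) hz.2.1 hz2 hz3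
  have b2 : |O₅ z * uy z| ≤ K * C2 * σ^8 := mul_abs_le (h.o5 z hz) hy (by
    rw [hz1]
    calc K * σ^4 * (C2 * (σ^2)^3) = K * C2 * σ^8 * σ^2 := by ring
      _ ≤ K * C2 * σ^8 * 1 := by gcongr; nlinarith
      _ = _ := by ring)
  have b3 : |O₁ z / a| ≤ K / a * σ^8 := by
    rw [abs_div, abs_of_pos ha, div_mul_eq_mul_div]
    gcongr
    refine (h.o1 z hz).trans (le_of_eq ?_)
    rw [hz1]; ring
  rw [e2]
  have h8 : 0 < σ^8 := by positivity
  rw [abs_le] at b1 b2 b3 hΓ ⊢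
  constructor <;> linarith only [b1.1, b1.2, b2.1, b2.2, b3.1, b3.2, hΓ.1, hΓ.2, h8]

lemma app_geo {σ k p q r P B d y0 : ℝ} {t : ℝ × ℝ} (ht : t ∈ BX d) (hd1 : d ≤ 1) (hσ : 0 < σ) (hk : 0 < k)
    (hp : 0 < p) (hr : 0 < r) (hrB : r ≤ B) (hpP : p ≤ P * σ^2) (hqP : |q| ≤ P * σ^2) (hP : 0 < P)
    (hk1 : k ≤ 1 / (4 * (2 * P + B + 1))) (hy0 : 0 < y0 - k^2 * σ^2 * r * d) :
    ∃ v, 0 ≤ v ∧ v ≤ 1 / 2 ∧ v ≤ 2 * (2 * P + B + 1) * k * (qq t) ^ (1/8:ℝ) ∧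
      |k^2 * σ^2 * (p * t.1 + q * t.2)| ≤ σ^4 * v^2 ∧ |k^2 * σ^2 * r * t.2| ≤ σ^2 * v^2 ∧ 0 < y0 + k^2 * σ^2 * r * t.2 := by
  rw [mem_BX] at ht
  obtain ⟨t1, t2, t3, t4⟩ := ht
  have ha1 : |t.1| ≤ 1 := abs_le.2 ⟨t1, t3⟩
  have ha2 : |t.2| ≤ 1 := abs_le.2 ⟨by linarith, t4⟩
  obtain ⟨r0, r1, r2, r3, r4⟩ := rho8 ha1 ha2
  set ρ := (qq t) ^ (1/8:ℝ)
  set L := 2 * P + B + 1 with hL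
  have hB : 0 < B := hr.trans_le hrB
  have hL1 : 1 ≤ L := by linarith
  have hkL : L * k ≤ 1 / 4 := by
    rw [le_div_iff₀ (by positivity)] at hk1
    linarith
  have hLL : ∀ c, c ≤ L → c ≤ L^2 := fun c hc => by nlinarith
  refine ⟨L * k * ρ^2, by positivity, ?_, ?_, ?_, ?_, ?_⟩
  · nlinarith [mul_nonneg (by linarith : (0:ℝ) ≤ L) hk.le]
  · have : L * k * ρ^2 ≤ L * k * (2 * ρ) := by gcongr; nlinarith
    linarith
  · have h1 : |p * t.1 + q * t.2| ≤ 2 * P * σ^2 * ρ^4 := by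
      have a1 : |p * t.1| ≤ P * σ^2 * ρ^4 := mul_abs_le (by rwa [abs_of_pos hp]) r1 le_rfl
      have a2 : |q * t.2| ≤ P * σ^2 * ρ^4 := mul_abs_le hqP r2 le_rfl
      linarith [abs_add_le (p * t.1) (q * t.2)]
    rw [abs_mul, abs_of_pos (by positivity)]
    calc k^2 * σ^2 * |p * t.1 + q * t.2| ≤ k^2 * σ^2 * (2 * P * σ^2 * ρ^4) := by gcongr
      _ = (2 * P) * (σ^4 * k^2 * ρ^4) := by ring
      _ ≤ L^2 * (σ^4 * k^2 * ρ^4) := by gcongr; exact hLL _ (by linarith)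
      _ = _ := by ring
  · rw [abs_mul, abs_of_pos (by positivity)]
    calc k^2 * σ^2 * r * |t.2| ≤ k^2 * σ^2 * B * ρ^4 := by gcongr
      _ = B * (σ^2 * k^2 * ρ^4) := by ring
      _ ≤ L^2 * (σ^2 * k^2 * ρ^4) := by gcongr; exact hLL _ (by linarith)
      _ = _ := by ring
  · have : 0 < k^2 * σ^2 * r := by positivity
    nlinarith
end

section
variable {X Y a b δ K : ℝ} {O₁ O₂ O₃ O₄ O₅ u ux uy uxx uxy uyy : ℝ × ℝ → ℝ}

set_option maxHeartbeats 1000000 in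
lemma SP.app (h : SP X Y a b δ K O₁ O₂ O₃ O₄ O₅ u ux uy uxx uxy uyy) {Y2 : ℝ} (hY2Y : Y2 < Y) :
    ∃ C ≥ 1, ∃ k1 > 0, ∃ s1 > 0, s1 ≤ 1 ∧ 3 * s1^4 ≤ X ∧ ∀ σ, 0 < σ → σ < s1 → ∀ k, 0 < k → k ≤ k1 → ∀ y0, 0 < y0 → y0 ≤ Y2 → ∀ m M Γ, 0 ≤ m → 0 ≤ M → 0 ≤ Γ →
      (∀ z : ℝ × ℝ, |z.1 - σ^4| ≤ σ^4/2 → 0 < z.2 → z.2 ≤ (Y2+Y)/2 → |u z - z.1^2 / (2*a)| ≤ m * σ^8 ∧ |uxy z| ≤ M) →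
      |ux (σ^4, y0) - σ^4/a| ≤ Γ * σ^4 →
      |uxx (σ^4, y0) - 1/a| ≤ C * (m / k^4 + Γ + σ^4 + k * (1 + M/σ)) ∧
      |uxy (σ^4, y0)| ≤ C * (σ^2 * (m / k^4 + Γ + σ^4 + k * (1 + M/σ))) := by
  have ha := h.ha
  have hb := h.hb
  have hK := h.hK
  have hδ := h.hδ
  have hX := h.hX
  have hX1 := h.hX1
  set Y3 := (Y2 + Y) / 2 with hY3
  obtain ⟨C0, hC0, H0⟩ := app0
  obtain ⟨Cg, hCg, Hg⟩ := h.gdiff Y3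
  obtain ⟨C5, hC5, H5⟩ := h.g0bd Y3
  set P := 3 + a * K with hP
  have hP0 : 0 < P := by positivity
  set B := 1 + 2 * b with hB
  have hB0 : 0 < B := by positivity
  set L := 2 * P + B + 1 with hL
  have hL0 : 0 < L := by positivity
  set D := 1 + 4 + 2 * C5 + 2 * Cg * L + 1 with hD
  have hD0 : 0 < D := by positivity
  set r0 := √(b/2) with hr0
  have hr00 : 0 < r0 := Real.sqrt_pos.2 (by positivity)
  set C1 := 4 / δ * C0 * D with hC1
  have hC10 : 0 < C1 := by positivity
  set s1 := min (X/3) ((Y - Y2)/2) with hs1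
  have hs1p : 0 < s1 := lt_min (by linarith) (by linarith)
  have hs1X : s1 ≤ X/3 := min_le_left _ _
  have hs1Y : s1 ≤ (Y-Y2)/2 := min_le_right _ _
  have hs11 : s1 ≤ 1 := by linarith
  refine ⟨C1 + C1 * (1 + P) / r0 + 1, ?_, 1 / (4 * L), by positivity, s1, hs1p, hs11, ?_, ?_⟩
  · have : 0 ≤ C1 + C1 * (1 + P) / r0 := by positivity
    linarith
  · have : s1^4 ≤ s1 := pow_le_of_le_one hs1p.le hs11 (by norm_num)
    linarith
  intro σ hσ hσs k hk hk1 y0 hy0 hy2 m M Γ hm hM hΓ hyp hux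
  have hσ1 : σ ≤ 1 := by linarith
  have hs2 : σ^2 ≤ σ := pow_le_of_le_one hσ.le hσ1 (by norm_num)
  have hs4 : σ^4 ≤ σ := pow_le_of_le_one hσ.le hσ1 (by norm_num)
  have hσY : σ^2 < Y - Y3 := by rw [hY3]; linarith
  have hσX : 3 * σ^4 < X := by linarith
  have hs4p : 0 < σ^4 := by positivity
  have hY23 : y0 ≤ Y3 := by rw [hY3]; linarith
  have hz0 : ((σ^4, y0) : ℝ × ℝ) ∈ Strp X Y := ⟨hs4p, by simp only; linarith, hy0, by simp only; linarith⟩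
  obtain ⟨p, q, r, hp, hr, hrB, hqp, hp2, hpP, hqP, e1, e2, e3⟩ := h.coef hz0 hσ rfl
  have hrp : 0 < r := hr00.trans_le hr
  have hkL : L * k ≤ 1 / 4 := by
    rw [le_div_iff₀ (by positivity)] at hk1
    linarith
  set R := k^2 * σ^2 with hR
  have hRp : 0 < R := by positivity
  obtain ⟨d, hd, hd1, hyd, hdd⟩ := choose_d (y0 := y0) (c := R * r) (K := K) (e := R^2 * σ^8) hy0 (by positivity) (by linarith) (by positivity)
  have geo : ∀ t ∈ BX d, ∃ v, 0 ≤ v ∧ v ≤ 1 / 2 ∧ v ≤ 2 * L * k * (qq t) ^ (1/8:ℝ) ∧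
      |R * (p * t.1 + q * t.2)| ≤ σ^4 * v^2 ∧ |R * r * t.2| ≤ σ^2 * v^2 ∧ 0 < y0 + R * r * t.2 := fun t ht =>
    app_geo ht hd1 hσ hk hp hrp hrB hpP hqP hP0 hk1 hyd
  have geo2 : ∀ t ∈ BX d, ∀ z : ℝ × ℝ, z = (σ^4 + R * (p * t.1 + q * t.2), y0 + R * r * t.2) →
      |z.1 - σ^4| ≤ σ^4 / 2 ∧ 0 < z.2 ∧ z.2 ≤ Y3 ∧ z ∈ Strp X Y := by
    intro t ht z hz
    obtain ⟨v, v0, v1, v2, v3, v4, v5⟩ := geo t ht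
    have hvv : v^2 ≤ 1/2 := by
      have := mul_le_mul v1 v1 v0 (by norm_num)
      rw [sq]; linarith
    have b1 : |z.1 - σ^4| ≤ σ^4 / 2 := by
      rw [hz]; simp only [add_sub_cancel_left]
      have := mul_le_mul_of_nonneg_left hvv hs4p.le
      linarith
    have b2 : z.2 ≤ Y3 := by
      rw [hz]; simp only
      have := (abs_le.1 v4).2
      have : σ^2 * v^2 ≤ σ^2 * 1 := by gcongr; linarith
      rw [hY3]; linarith
    have b3 := abs_le.1 b1
    refine ⟨b1, by rw [hz]; exact v5, b2, by linarith [b3.1], by linarith [b3.2], by rw [hz]; exact v5, ?_⟩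
    rw [hY3] at b2; linarith
  have hW := h.c2.sub (C2on_fst (U := Strp X Y) (g := fun t => t^2 / (2*a)) (g1 := fun t => t / a) (g2 := fun _ => 1 / a)
    (fun z _ => by
      refine ((hasDerivAt_pow 2 z.1).div_const (2*a)).congr_deriv ?_
      simp; field_simp) (fun z _ => (hasDerivAt_id z.1).div_const a) continuousOn_const)
  set g0 := (2 * σ^4 - a * ux (σ^4, y0) + O₁ (σ^4, y0)) * (uxx (σ^4, y0) - 1 / a) + O₂ (σ^4, y0) * uxy (σ^4, y0) + (b + O₃ (σ^4, y0)) * uyy (σ^4, y0) with hg0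
  have hg0b : |g0| ≤ 2 * Γ * σ^4 + C5 * σ^8 := H5 σ hσ hσ1 hσY hσX (σ^4, y0) Γ rfl hy0 hY23 hux
  have key := H0 (Strp X Y) _ _ _ _ _ _ hW (σ^4) y0 p q r R d g0 (m * σ^8) (Cg * (σ^4 + M * σ^3) * (2 * L * k)) (R^2 * σ^8) hp hrp hRp hd hd1 hqp
    (by positivity) (by positivity) (by positivity) (fun t ht => (geo2 t ht _ rfl).2.2.2)
    (fun t ht => by
      obtain ⟨c1, c2, c3, -⟩ := geo2 t ht _ rfl
      exact (hyp _ c1 c2 c3).1)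
    (fun t ht z hz => by
      obtain ⟨c1, c2, c3, c4⟩ := geo2 t ht z hz
      obtain ⟨v, v0, v1, v2, v3, v4, v5⟩ := geo t ht
      have c5 := abs_le.1 c1
      have := Hg σ hσ hσ1 hσY hσX z (σ^4, y0) v M rfl c4.1 (by linarith [c5.2]) c2 c3 hy0 hY23 v0 (by linarith)
        (by rw [hz]; simpa using v3) (by rw [hz]; simpa using v4) (hyp z c1 c2 c3).2
      rw [e1, e2, e3, hg0]
      simp only at this ⊢
      calc _ = _ := by congr 1; ring
        _ ≤ _ := this
        _ ≤ Cg * ((σ^4 + M * σ^3) * (2 * L * k * (qq t) ^ (1/8:ℝ))) := by gcongr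
        _ = _ := by ring)
    (by
      rcases hdd with hdd | hdd
      · exact Or.inl hdd
      right
      intro s hs
      have ht : ((s, -d) : ℝ × ℝ) ∈ BX d := mem_BX.2 ⟨hs.1, le_rfl, hs.2, by simp only; linarith⟩
      obtain ⟨c1, c2, c3, c4⟩ := geo2 _ ht _ rfl
      have := h.bY _ c4
      simp only [sub_zero] at this ⊢
      rw [abs_mul, abs_of_pos (by positivity)]
      calc _ ≤ R * r * (K * (y0 + R * r * -d)) := by gcongr
        _ = R * r * K * (y0 - R * r * d) := by ring
        _ ≤ _ := hdd)
  set Φ := m / k^4 + Γ + σ^4 + k * (1 + M/σ) with hΦ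
  have hΦ0 : 0 ≤ Φ := by positivity
  have hS : m * σ^8 + 2 * R^2 * |g0| + R^2 * (Cg * (σ^4 + M * σ^3) * (2 * L * k)) + R^2 * σ^8 ≤ (k^2 * σ^2)^2 * (σ^4 * (D * Φ)) := by
    rw [← hR]
    have f1 : m * σ^8 = R^2 * (σ^4 * (m / k^4)) := by rw [hR]; field_simp
    have f2 : 2 * R^2 * |g0| ≤ R^2 * (σ^4 * (4 * Γ + 2 * C5 * σ^4)) := by
      calc 2 * R^2 * |g0| ≤ 2 * R^2 * (2 * Γ * σ^4 + C5 * σ^8) := by gcongr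
        _ = _ := by ring
    have f3 : R^2 * (Cg * (σ^4 + M * σ^3) * (2 * L * k)) = R^2 * (σ^4 * (2 * Cg * L * (k * (1 + M/σ)))) := by field_simp
    have f4 : R^2 * σ^8 = R^2 * (σ^4 * σ^4) := by ring
    have f5 : m / k^4 + (4 * Γ + 2 * C5 * σ^4) + (2 * Cg * L * (k * (1 + M/σ))) + σ^4 ≤ D * Φ := by
      have i1 : 0 ≤ m / k^4 := by positivity
      have i2 : 0 ≤ k * (1 + M/σ) := by positivity
      have i3 : 0 ≤ 2 * Cg * L := by positivity
      have j1 : m / k^4 ≤ D * (m / k^4) := le_mul_of_one_le_left i1 (by linarith)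
      have j2 : 4 * Γ ≤ D * Γ := by gcongr; linarith
      have j3 : (2 * C5 + 1) * σ^4 ≤ D * σ^4 := by gcongr; linarith
      have j4 : 2 * Cg * L * (k * (1 + M/σ)) ≤ D * (k * (1 + M/σ)) := by gcongr; linarith
      rw [hΦ]
      linarith
    have hR2 : 0 < R^2 := by positivity
    calc _ ≤ R^2 * (σ^4 * (m / k^4)) + R^2 * (σ^4 * (4 * Γ + 2 * C5 * σ^4)) + R^2 * (σ^4 * (2 * Cg * L * (k * (1 + M/σ)))) + R^2 * (σ^4 * σ^4) := by
            rw [f1, f3, f4]; gcongr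
      _ = R^2 * (σ^4 * (m / k^4 + (4 * Γ + 2 * C5 * σ^4) + (2 * Cg * L * (k * (1 + M/σ))) + σ^4)) := by ring
      _ ≤ _ := by gcongr
  have fin := app_alg (m := 0) hδ h.hδ1 hσ hk hp hr00 hr hp2 hqP hC0 hD0 hΦ0 hS key.1 key.2
  have hC12 : 0 < C1 * (1 + P) / r0 := by positivity
  refine ⟨fin.1.trans ?_, ?_⟩
  · gcongr; linarith
  · have := fin.2
    simp only [sub_zero] at this
    refine this.trans ?_
    gcongr
    linarith
end

section
variable {X Y a b δ K : ℝ} {O₁ O₂ O₃ O₄ O₅ u ux uy uxx uxy uyy : ℝ × ℝ → ℝ}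

lemma SP.ux_asym (h : SP X Y a b δ K O₁ O₂ O₃ O₄ O₅ u ux uy uxx uxy uyy) {Y2 : ℝ} (hY2 : 0 < Y2) (hY2Y : Y2 < Y) {ε : ℝ} (hε : 0 < ε) :
    ∃ x0 > 0, ∀ x, 0 < x → x < x0 → ∀ y, 0 < y → y ≤ Y2 → |ux (x, y) - x / a| ≤ ε * x := by
  have ha := h.ha
  have hK := h.hK
  have hX := h.hX
  set L := K + 1 / a with hL
  have hL0 : 0 < L := by positivity
  set θ := min 1 (ε / (2 * L)) with hθ
  have hθ0 : 0 < θ := by positivity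
  have hθ1 : θ ≤ 1 := min_le_left _ _
  have hθ2 : L * θ ≤ ε / 2 := by
    have : θ ≤ ε / (2 * L) := min_le_right _ _
    rw [le_div_iff₀ (by positivity)] at this
    linarith
  obtain ⟨x1, hx1, H⟩ := h.asym hY2 hY2Y (ε := ε * θ / 16) (by positivity)
  refine ⟨min x1 X / 2, by positivity, fun x hx hxx y hy hyy => ?_⟩
  have c1 : min x1 X ≤ x1 := min_le_left _ _
  have c2 : min x1 X ≤ X := min_le_right _ _
  have hθx : θ * x ≤ x := by nlinarith
  have hin : ∀ r ∈ Icc x (x + θ * x), 0 < r ∧ r ≤ 2 * x ∧ r < x1 ∧ (r, y) ∈ Strp X Y := by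
    intro r hr
    have r1 := hr.1
    have r2 := hr.2
    refine ⟨by linarith, by linarith, by linarith, by simp only; linarith, by simp only; linarith, hy, by simp only; linarith⟩
  have hm : ∀ r ∈ Icc x (x + θ * x), |u (r, y) - r^2 / (2 * a)| ≤ ε * θ / 16 * (4 * x^2) := by
    intro r hr
    obtain ⟨r1, r2, r3, -⟩ := hin r hr
    refine (H r r1 r3 y hy hyy).trans ?_
    gcongr
    nlinarith
  have hend : x ≤ x + θ * x := by nlinarith
  have := interp1 (g := fun t => u (t, y) - t^2 / (2 * a)) (g' := fun t => ux (t, y) - t / a) (g2 := fun t => uxx (t, y) - 1 / a)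
    (s := x) (h := θ * x) (m := ε * θ / 16 * (4 * x^2)) (L := L) (by positivity)
    (fun r hr => by
      refine (linF_dx (h.c2.d0 _ (hin r hr).2.2.2)).sub (((hasDerivAt_pow 2 r).div_const (2*a)).congr_deriv ?_)
      simp; field_simp)
    (fun r hr => (linF_dx (h.c2.d1 _ (hin r hr).2.2.2)).sub ((hasDerivAt_id r).div_const a))
    (fun r hr => by
      have b1 := h.bxx _ (hin r hr).2.2.2
      have b2 : |1 / a| = 1 / a := abs_of_pos (by positivity)
      linarith [abs_sub (uxx (r, y)) (1 / a)])
    (hm x ⟨le_rfl, hend⟩) (hm _ ⟨hend, le_rfl⟩)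
  have hpos : 0 < θ * x := by positivity
  refine le_of_mul_le_mul_left (this.trans ?_) hpos
  have : L * θ * (θ * x^2) ≤ ε / 2 * (θ * x^2) := by gcongr
  nlinarith

lemma SP.r1 (h : SP X Y a b δ K O₁ O₂ O₃ O₄ O₅ u ux uy uxx uxy uyy) {Y2 : ℝ} (hY2Y : Y2 < Y) :
    ∃ C ≥ 1, ∃ s > 0, ∀ σ, 0 < σ → σ < s → ∀ y, 0 < y → y ≤ Y2 → |uxy (σ^4, y)| ≤ C * σ := by
  have ha := h.ha
  have hK := h.hK
  obtain ⟨C, hC, k1, hk1, s1, hs1, hs11, hs1X, H⟩ := h.app hY2Y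
  refine ⟨C * (8 / a / k1^4 + (K + 1 / a) + 1 + k1 * (1 + K)), ?_, s1, hs1, ?_⟩
  · have : 0 ≤ 8 / a / k1^4 + (K + 1 / a) + k1 * (1 + K) := by positivity
    nlinarith
  intro σ hσ hσs y hy hy2
  have hσ1 : σ ≤ 1 := by linarith
  have hs4p : 0 < σ^4 := by positivity
  have hs4 : σ^4 ≤ s1^4 := by gcongr
  have hz0 : ((σ^4, y) : ℝ × ℝ) ∈ Strp X Y := ⟨hs4p, by simp only; linarith, hy, by simp only; linarith⟩
  have := (H σ hσ hσs k1 hk1 le_rfl y hy hy2 (8 / a) K (K + 1 / a) (by positivity) (by positivity) (by positivity) (fun z z1 z2 z3 => by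
      have z4 := abs_le.1 z1
      have hz : z ∈ Strp X Y := ⟨by linarith, by linarith, z2, by linarith⟩
      refine ⟨?_, h.bxy z hz⟩
      obtain ⟨u1, u2⟩ := h.ub z hz.1.le hz.2.1 hz.2.2.1.le hz.2.2.2
      have u3 : u z ≤ z.1^2 / a := by rw [le_div_iff₀ ha]; linarith
      have u4 : z.1^2 / (2 * a) = (z.1^2 / a) / 2 := by field_simp
      have u5 : z.1^2 / a ≤ 8 / a * σ^8 := by
        rw [div_mul_eq_mul_div]
        gcongr
        calc z.1^2 ≤ (2 * σ^4)^2 := by gcongr <;> linarith [hz.1]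
          _ ≤ _ := by nlinarith
      have : 0 ≤ z.1^2 / a := by positivity
      rw [u4, abs_le]
      constructor <;> linarith) (by
      have b1 := (h.bx _ hz0).1
      have b2 : |σ^4 / a| = 1 / a * σ^4 := by rw [abs_of_pos (by positivity)]; ring
      simp only at b1
      linarith [abs_sub (ux (σ^4, y)) (σ^4 / a)])).2
  refine this.trans ?_
  rw [mul_assoc]
  refine mul_le_mul_of_nonneg_left ?_ (by linarith)
  have e : σ^2 * (8 / a / k1^4 + (K + 1 / a) + σ^4 + k1 * (1 + K / σ)) = (σ * (8 / a / k1^4) + σ * (K + 1 / a) + σ * σ^4 + k1 * (σ + K)) * σ := by field_simp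
  rw [e]
  gcongr
  · exact mul_le_of_le_one_left (by positivity) hσ1
  · exact mul_le_of_le_one_left (by positivity) hσ1
  · exact mul_le_one₀ hσ1 (by positivity) (pow_le_one₀ hσ.le hσ1)

lemma fourth {x : ℝ} (hx : 0 < x) : ∃ τ > 0, τ^4 = x := by
  refine ⟨√√x, by positivity, ?_⟩
  have : (√√x)^4 = ((√√x)^2)^2 := by ring
  rw [this, Real.sq_sqrt (by positivity), Real.sq_sqrt hx.le]

lemma SP.final (h : SP X Y a b δ K O₁ O₂ O₃ O₄ O₅ u ux uy uxx uxy uyy) {Y2 : ℝ} (hY2 : 0 < Y2) (hY2Y : Y2 < Y) {ε : ℝ} (hε : 0 < ε) :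
    ∃ x0 > 0, ∀ x, 0 < x → x < x0 → ∀ y, 0 < y → y ≤ Y2 → |uxx (x, y) - 1/a| ≤ ε ∧ |uxy (x, y)| ≤ ε ∧ |uyy (x, y)| ≤ ε := by
  have ha := h.ha
  have hK := h.hK
  have hX := h.hX
  obtain ⟨C, hC, k1, hk1, s1, hs1, hs11, hs1X, H⟩ := h.app hY2Y
  have hY3 : (Y2 + Y) / 2 < Y := by linarith
  obtain ⟨C', hC', s2, hs2, H1⟩ := h.r1 hY3
  obtain ⟨C3, hC3, H3⟩ := h.uyy_bd
  set η := ε / (4 * C) with hη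
  have hη0 : 0 < η := by positivity
  set k := min k1 (η / (1 + 2 * C')) with hk
  have hk0 : 0 < k := by positivity
  have hkk : k * (1 + 2 * C') ≤ η := by
    have : k ≤ η / (1 + 2 * C') := min_le_right _ _
    rwa [le_div_iff₀ (by positivity)] at this
  obtain ⟨x1, hx1, A1⟩ := h.asym (Y2 := (Y2 + Y) / 2) (by linarith) hY3 (ε := η * k^4 / 4) (by positivity)
  obtain ⟨x2, hx2, A2⟩ := h.ux_asym hY2 hY2Y hη0
  set x0 := min (min (min (s1^4) ((s2/2)^4)) (min (x1/2) x2)) (min η (ε / C3)) with hx0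
  have q1 : x0 ≤ s1^4 := (min_le_left _ _).trans ((min_le_left _ _).trans (min_le_left _ _))
  have q2 : x0 ≤ (s2/2)^4 := (min_le_left _ _).trans ((min_le_left _ _).trans (min_le_right _ _))
  have q3 : x0 ≤ x1/2 := (min_le_left _ _).trans ((min_le_right _ _).trans (min_le_left _ _))
  have q4 : x0 ≤ x2 := (min_le_left _ _).trans ((min_le_right _ _).trans (min_le_right _ _))
  have q5 : x0 ≤ η := (min_le_right _ _).trans (min_le_left _ _)
  have q6 : x0 ≤ ε / C3 := (min_le_right _ _).trans (min_le_right _ _)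
  refine ⟨x0, by positivity, ?_⟩
  intro x hx hxx y hy hy2
  obtain ⟨σ, hσ, rfl⟩ := fourth hx
  have hσ1 : σ < s1 := lt_of_pow_lt_pow_left₀ 4 hs1.le (by linarith)
  have hσ2 : σ < s2 / 2 := lt_of_pow_lt_pow_left₀ 4 (by positivity) (by linarith)
  have hσ0 : σ ≤ 1 := by linarith
  have hz0 : ((σ^4, y) : ℝ × ℝ) ∈ Strp X Y := ⟨hx, by simp only; linarith, hy, by simp only; linarith⟩
  have R := H σ hσ hσ1 k hk0 (min_le_left _ _) y hy hy2 (η * k^4) (2 * C' * σ) η (by positivity) (by positivity) hη0.le (fun z z1 z2 z3 => by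
      have z4 := abs_le.1 z1
      have hzp : 0 < z.1 := by linarith
      constructor
      · refine (A1 z.1 hzp (by linarith) z.2 z2 z3).trans ?_
        calc η * k^4 / 4 * z.1^2 ≤ η * k^4 / 4 * (2 * σ^4)^2 := by gcongr; linarith
          _ = _ := by ring
      · obtain ⟨τ, hτ, e⟩ := fourth hzp
        have hτσ : τ < 2 * σ := lt_of_pow_lt_pow_left₀ 4 (by positivity) (by
          rw [e, mul_pow]; norm_num; linarith)
        have := H1 τ hτ (by linarith) z.2 z2 z3
        rw [e] at this
        refine this.trans ?_
        nlinarith) (A2 _ hx (by linarith) y hy hy2)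
  have e1 : η * k^4 / k^4 = η := by field_simp
  have e2 : 2 * C' * σ / σ = 2 * C' := by field_simp
  rw [e1, e2] at R
  have hΦ : C * (η + η + σ^4 + k * (1 + 2 * C')) ≤ ε := by
    calc C * (η + η + σ^4 + k * (1 + 2 * C')) ≤ C * (η + η + η + η) := by gcongr; linarith
      _ = ε := by rw [hη]; field_simp; norm_num
  refine ⟨R.1.trans hΦ, R.2.trans (le_trans ?_ hΦ), (H3 _ hz0).trans ?_⟩
  · gcongr
    exact mul_le_of_le_one_left (by positivity) (pow_le_one₀ hσ.le hσ0)
  · have : σ^4 ≤ ε / C3 := by linarith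
    rw [le_div_iff₀ (by positivity)] at this
    simp only; linarith
end

section
lemma pd_eq {ψ : ℝ × ℝ → ℝ} {p : ℝ × ℝ} {L : ℝ × ℝ →L[ℝ] ℝ} (h : HasFDerivAt ψ L p) : pd1 ψ p = L (1, 0) ∧ pd2 ψ p = L (0, 1) := by
  have e : L = linF (L (1,0)) (L (0,1)) := linF_ext rfl rfl
  rw [e] at h
  exact ⟨(linF_dx h).deriv, (linF_dy h).deriv⟩

lemma pd_has {ψ : ℝ × ℝ → ℝ} {p : ℝ × ℝ} (h : DifferentiableAt ℝ ψ p) : HasFDerivAt ψ (linF (pd1 ψ p) (pd2 ψ p)) p := by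
  have := h.hasFDerivAt
  rw [(pd_eq this).1, (pd_eq this).2, ← linF_ext rfl rfl]
  exact this

lemma pd_cd {ψ : ℝ × ℝ → ℝ} {S : Set (ℝ × ℝ)} (hS : IsOpen S) {n m : WithTop ℕ∞} (hmn : m + 1 ≤ n) (h : ContDiffOn ℝ n ψ S) :
    ContDiffOn ℝ m (pd1 ψ) S ∧ ContDiffOn ℝ m (pd2 ψ) S := by
  have h1 := h.fderiv_of_isOpen hS hmn
  have hd : ∀ p ∈ S, HasFDerivAt ψ (fderiv ℝ ψ p) p := fun p hp =>
    ((h.differentiableOn (by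
      rintro rfl
      simp at hmn)) p hp |>.differentiableAt (hS.mem_nhds hp)).hasFDerivAt
  exact ⟨(h1.clm_apply contDiffOn_const).congr fun p hp => (pd_eq (hd p hp)).1,
    (h1.clm_apply contDiffOn_const).congr fun p hp => (pd_eq (hd p hp)).2⟩

lemma pd_symm {ψ : ℝ × ℝ → ℝ} {S : Set (ℝ × ℝ)} (hS : IsOpen S) (h : ContDiffOn ℝ 2 ψ S) {p : ℝ × ℝ} (hp : p ∈ S) :
    pd1 (pd2 ψ) p = pd2 (pd1 ψ) p := by
  have h1 := h.fderiv_of_isOpen (m := 1) hS (by norm_num)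
  have hd : ∀ p ∈ S, HasFDerivAt ψ (fderiv ℝ ψ p) p := fun p hp =>
    ((h.differentiableOn (by norm_num)) p hp |>.differentiableAt (hS.mem_nhds hp)).hasFDerivAt
  have hd2 : HasFDerivAt (fderiv ℝ ψ) (fderiv ℝ (fderiv ℝ ψ) p) p :=
    ((h1.differentiableOn (by norm_num)) p hp |>.differentiableAt (hS.mem_nhds hp)).hasFDerivAt
  have a2 : HasFDerivAt (pd2 ψ) ((fderiv ℝ (fderiv ℝ ψ) p).flip (0, 1)) p := by
    refine HasFDerivAt.congr_of_eventuallyEq (f := fun q => fderiv ℝ ψ q (0, 1)) ?_ ?_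
    · exact (hd2.clm_apply (hasFDerivAt_const _ _)).congr_fderiv (by ext <;> simp)
    · filter_upwards [hS.mem_nhds hp] with q hq using (pd_eq (hd q hq)).2
  have a1 : HasFDerivAt (pd1 ψ) ((fderiv ℝ (fderiv ℝ ψ) p).flip (1, 0)) p := by
    refine HasFDerivAt.congr_of_eventuallyEq (f := fun q => fderiv ℝ ψ q (1, 0)) ?_ ?_
    · exact (hd2.clm_apply (hasFDerivAt_const _ _)).congr_fderiv (by ext <;> simp)
    · filter_upwards [hS.mem_nhds hp] with q hq using (pd_eq (hd q hq)).1
  rw [(pd_eq a2).1, (pd_eq a1).2]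
  simp only [ContinuousLinearMap.flip_apply]
  have := (h.contDiffAt (hS.mem_nhds hp)).isSymmSndFDerivAt (by simp)
  exact this.eq _ _

lemma pd_C2on {ψ : ℝ × ℝ → ℝ} {S : Set (ℝ × ℝ)} (hS : IsOpen S) (h : ContDiffOn ℝ 2 ψ S) :
    C2on S ψ (pd1 ψ) (pd2 ψ) (pd1 (pd1 ψ)) (pd2 (pd1 ψ)) (pd2 (pd2 ψ)) := by
  have h1 := pd_cd hS (n := 2) (m := 1) (by norm_num) h
  have dd : ∀ {g : ℝ × ℝ → ℝ} {n : WithTop ℕ∞}, n ≠ 0 → ContDiffOn ℝ n g S → ∀ p ∈ S, DifferentiableAt ℝ g p := fun hn hg p hp =>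
    (hg.differentiableOn hn) p hp |>.differentiableAt (hS.mem_nhds hp)
  have h2 := pd_cd hS (n := 1) (m := 0) (by norm_num) h1.1
  have h3 := pd_cd hS (n := 1) (m := 0) (by norm_num) h1.2
  refine ⟨fun p hp => pd_has (dd (by norm_num) h p hp), fun p hp => pd_has (dd (by norm_num) h1.1 p hp), fun p hp => ?_, h2.1.continuousOn, h2.2.continuousOn, h3.2.continuousOn⟩
  rw [← pd_symm hS h hp]
  exact pd_has (dd (by norm_num) h1.2 p hp)

lemma lip_part {g : ℝ × ℝ → ℝ} {a b : ℝ} {p : ℝ × ℝ} {s : Set (ℝ × ℝ)} {K : NNReal} (h : HasFDerivAt g (linF a b) p) (hs : s ∈ nhds p)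
    (hl : LipschitzOnWith K g s) : |a| ≤ K ∧ |b| ≤ K := by
  have h1 := h.le_of_lipschitzOn hs hl
  constructor
  · have := (linF a b).le_of_opNorm_le h1 (1, 0)
    simpa using this
  · have := (linF a b).le_of_opNorm_le h1 (0, 1)
    simpa using this

lemma O_lip {X Y m c : ℝ} {O : ℝ × ℝ → ℝ} {D : Set (ℝ × ℝ)} (hD : Strp X Y ⊆ D) (hO : ContDiffOn ℝ 1 O D)
    (hb : ∀ p ∈ Strp X Y, p.1 ≤ m → ‖fderivWithin ℝ O D p‖ ≤ c) {p q : ℝ × ℝ} (hp : p ∈ Strp X Y) (hq : q ∈ Strp X Y) (hpm : p.1 ≤ m) (hqm : q.1 ≤ m) :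
    |O p - O q| ≤ c * (|p.1 - q.1| + |p.2 - q.2|) := by
  have hconv : Convex ℝ {z : ℝ × ℝ | z ∈ Strp X Y ∧ z.1 ≤ m} := by
    have : {z : ℝ × ℝ | z ∈ Strp X Y ∧ z.1 ≤ m} = (Ioo 0 X ∩ Iic m) ×ˢ Ioo 0 Y := by
      ext z; simp [Strp]; tauto
    rw [this]
    exact ((convex_Ioo 0 X).inter (convex_Iic m)).prod (convex_Ioo 0 Y)
  have hc : 0 ≤ c := (norm_nonneg _).trans (hb p hp hpm)
  have := hconv.norm_image_sub_le_of_norm_hasFDerivWithin_le (f := O) (f' := fun z => fderivWithin ℝ O D z) (C := c)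
    (fun z hz => by
      have hz1 := hz.1
      refine (((hO.differentiableOn (by norm_num)) z (hD hz1)).hasFDerivWithinAt).mono (fun w hw => hD hw.1))
    (fun z hz => hb z hz.1 hz.2) (x := q) (y := p) ⟨hq, hqm⟩ ⟨hp, hpm⟩
  refine this.trans ?_
  gcongr
  rw [Prod.norm_def]
  simp only [Prod.fst_sub, Prod.snd_sub, Real.norm_eq_abs]
  exact max_le (by linarith [abs_nonneg (p.2 - q.2)]) (by linarith [abs_nonneg (p.1 - q.1)])

lemma Strp_closure {X Y : ℝ} (hX : 0 < X) (hY : 0 < Y) {p : ℝ × ℝ} (h1 : 0 ≤ p.1) (h2 : p.1 ≤ X) (h3 : 0 ≤ p.2) (h4 : p.2 ≤ Y) : p ∈ closure (Strp X Y) := by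
  have : Strp X Y = Ioo 0 X ×ˢ Ioo 0 Y := by ext p; simp [Strp, and_assoc]
  rw [this, closure_prod_eq, closure_Ioo hX.ne, closure_Ioo hY.ne]
  exact ⟨⟨h1, h2⟩, h3, h4⟩
end

theorem stmt1
    (ε₀ a b ω lam N : ℝ)
    (hε₀ : 0 < ε₀) (ha : 0 < a) (hb : 0 < b) (hω : 0 < ω) (hlam : 0 < lam) (hN : 0 < N)
    (f f' : ℝ → ℝ)
    (hf0 : 0 < f 0)
    (hfd : ∀ x ∈ Icc (0:ℝ) ε₀, HasDerivAt f (f' x) x)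
    (hflip : ∃ K : NNReal, LipschitzOnWith K f (Icc (0:ℝ) ε₀) ∧
      LipschitzOnWith K f' (Icc (0:ℝ) ε₀))
    (hf'ω : ∀ x ∈ Icc (0:ℝ) ε₀, ω ≤ f' x)
    (O₁ O₂ O₃ O₄ O₅ : ℝ × ℝ → ℝ)
    (hO1s : ContDiffOn ℝ 1 O₁ (Dset ε₀ f))
    (hO2s : ContDiffOn ℝ 1 O₂ (Dset ε₀ f))
    (hO3s : ContDiffOn ℝ 1 O₃ (Dset ε₀ f))
    (hO4s : ContDiffOn ℝ 1 O₄ (Dset ε₀ f))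
    (hO5s : ContDiffOn ℝ 1 O₅ (Dset ε₀ f))
    (hO1b : ∀ p ∈ Dset ε₀ f, |O₁ p| ≤ N * p.1 ^ 2 ∧
      ‖fderivWithin ℝ O₁ (Dset ε₀ f) p‖ ≤ N * p.1)
    (hO2b : ∀ p ∈ Dset ε₀ f, |O₂ p| ≤ N * p.1 ∧
      ‖fderivWithin ℝ O₂ (Dset ε₀ f) p‖ ≤ N)
    (hO3b : ∀ p ∈ Dset ε₀ f, |O₃ p| ≤ N * p.1 ∧
      ‖fderivWithin ℝ O₃ (Dset ε₀ f) p‖ ≤ N)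
    (hO4b : ∀ p ∈ Dset ε₀ f, |O₄ p| ≤ N * p.1 ∧
      ‖fderivWithin ℝ O₄ (Dset ε₀ f) p‖ ≤ N)
    (hO5b : ∀ p ∈ Dset ε₀ f, |O₅ p| ≤ N * p.1 ∧
      ‖fderivWithin ℝ O₅ (Dset ε₀ f) p‖ ≤ N)
    (β₁ β₂ : ℝ × ℝ → ℝ)
    (hβ₁c : ContinuousOn β₁ (Gamf ε₀ f)) (hβ₂c : ContinuousOn β₂ (Gamf ε₀ f))
    (hβ₁ : ∀ p ∈ Gamf ε₀ f, lam ≤ β₁ p)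
    (hβ₂ : ∀ p ∈ Gamf ε₀ f, |β₂ p| ≤ 1 / lam)
    (ψ : ℝ × ℝ → ℝ)
    -- (i) ψ ∈ C²(Q) ∩ C^{1,1}(closure Q)
    (hψC2 : ContDiffOn ℝ 2 ψ (Qset ε₀ f))
    (hψC11 : ∃ K : NNReal, LipschitzOnWith K ψ (closure (Qset ε₀ f)) ∧
      LipschitzOnWith K (pd1 ψ) (closure (Qset ε₀ f)) ∧
      LipschitzOnWith K (pd2 ψ) (closure (Qset ε₀ f)))
    -- (ii) ψ > 0 in Q
    (hψpos : ∀ p ∈ Qset ε₀ f, 0 < ψ p)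
    -- (iii) −μ ≤ ψ_x/x ≤ (2−δ)/a in Q
    (hμδ : ∃ μ > (0:ℝ), ∃ δ ∈ Set.Ioo (0:ℝ) 1, ∀ p ∈ Qset ε₀ f,
      -μ ≤ pd1 ψ p / p.1 ∧ pd1 ψ p / p.1 ≤ (2 - δ) / a)
    -- (iv) the equation
    (heq : ∀ p ∈ Qset ε₀ f,
      (2 * p.1 - a * pd1 ψ p + O₁ p) * pd1 (pd1 ψ) p + O₂ p * pd2 (pd1 ψ) p +
        (b + O₃ p) * pd2 (pd2 ψ) p - (1 + O₄ p) * pd1 ψ p + O₅ p * pd2 ψ p = 0)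
    -- boundary conditions
    (hbc1 : ∀ p ∈ closure (Qset ε₀ f), p.1 = 0 → ψ p = 0)
    (hbc2 : ∀ p ∈ closure (Qset ε₀ f), p.2 = 0 → pd2 ψ p = 0)
    (hbc3 : ∀ p ∈ closure (Qset ε₀ f), p.2 = f p.1 →
      β₁ p * pd1 ψ p + β₂ p * pd2 ψ p + ψ p = 0) :
    ∀ y : ℝ, 0 ≤ y → y < f 0 →
      Tendsto (pd1 (pd1 ψ)) (nhdsWithin ((0:ℝ), y) (Qset ε₀ f)) (nhds (1 / a)) ∧
      Tendsto (pd2 (pd1 ψ)) (nhdsWithin ((0:ℝ), y) (Qset ε₀ f)) (nhds 0) ∧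
      Tendsto (pd2 (pd2 ψ)) (nhdsWithin ((0:ℝ), y) (Qset ε₀ f)) (nhds 0) := by
  intro y hy0 hyf
  obtain ⟨K', hL0, hL1, hL2⟩ := hψC11
  obtain ⟨μ, hμ, δ, ⟨hδ, hδ1⟩, hx⟩ := hμδ
  obtain ⟨Y2, hyY2, hY2f⟩ := exists_between hyf
  obtain ⟨Y, hY2Y, hYf⟩ := exists_between hY2f
  have hY2 : 0 < Y2 := by linarith
  have hY : 0 < Y := by linarith
  have hK'0 : (0:ℝ) ≤ K' := K'.2
  obtain ⟨K, hK⟩ : ∃ K : ℝ, K = N + K' + μ + 2 / a + 1 := ⟨_, rfl⟩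
  have h2a : 0 < 2 / a := by positivity
  have kN : N ≤ K := by linarith
  have kK : (K':ℝ) ≤ K := by linarith
  have kμ : μ ≤ K := by linarith
  have ka : 2 / a ≤ K := by linarith
  have k1 : 1 ≤ K := by linarith
  have k0 : 0 < K := by linarith
  obtain ⟨X, hX0, hXε, hX1, s1, s2, s3⟩ : ∃ X > 0, X ≤ ε₀ ∧ X ≤ 1 ∧ K * X ≤ δ / 2 ∧ K * X ≤ b / 2 ∧ K^2 * X ≤ δ * b / 2 := by
    refine ⟨min (min ε₀ 1) (min (min (δ / 2 / K) (b / 2 / K)) (δ * b / 2 / K^2)), by positivity,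
      (min_le_left _ _).trans (min_le_left _ _), (min_le_left _ _).trans (min_le_right _ _), ?_, ?_, ?_⟩
    · rw [mul_comm, ← le_div_iff₀ k0]
      exact (min_le_right _ _).trans ((min_le_left _ _).trans (min_le_left _ _))
    · rw [mul_comm, ← le_div_iff₀ k0]
      exact (min_le_right _ _).trans ((min_le_left _ _).trans (min_le_right _ _))
    · rw [mul_comm, ← le_div_iff₀ (by positivity)]
      exact (min_le_right _ _).trans (min_le_right _ _)
  have hfm : ∀ x ∈ Icc (0:ℝ) ε₀, f 0 ≤ f x := by
    have : MonotoneOn f (Icc 0 ε₀) := monotoneOn_of_deriv_nonneg (convex_Icc 0 ε₀)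
      (fun x hx => (hfd x hx).continuousAt.continuousWithinAt)
      (fun x hx => (hfd x (interior_subset hx)).differentiableAt.differentiableWithinAt)
      (fun x hx => by rw [(hfd x (interior_subset hx)).deriv]; exact hω.le.trans (hf'ω x (interior_subset hx)))
    exact fun x hx => this ⟨le_rfl, hε₀.le⟩ hx hx.1
  have hSQ : Strp X Y ⊆ Qset ε₀ f := fun p hp =>
    ⟨hp.1, hp.2.1.trans_le hXε, hp.2.2.1, (hp.2.2.2.trans hYf).trans_le (hfm p.1 ⟨hp.1.le, (hp.2.1.trans_le hXε).le⟩)⟩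
  have hSD : Strp X Y ⊆ Dset ε₀ f := fun p hp => ⟨subset_closure (hSQ hp), hp.1⟩
  have hcl : closure (Strp X Y) ⊆ closure (Qset ε₀ f) := closure_mono hSQ
  have hSc : Strp X Y ⊆ closure (Qset ε₀ f) := hSQ.trans subset_closure
  have hop := Strp_open X Y
  have hC2 := pd_C2on hop (hψC2.mono hSQ)
  have hcont : ContinuousOn ψ (closure (Strp X Y)) := hL0.continuousOn.mono hcl
  have hbx : ∀ p ∈ Strp X Y, -(μ * p.1) ≤ pd1 ψ p ∧ a * pd1 ψ p ≤ (2 - δ) * p.1 := by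
    intro p hp
    obtain ⟨x1, x2⟩ := hx p (hSQ hp)
    rw [le_div_iff₀ hp.1] at x1
    rw [div_le_div_iff₀ hp.1 ha] at x2
    constructor <;> linarith
  have hub0 : ∀ p ∈ Strp X Y, a * ψ p ≤ p.1^2 := by
    intro p hp
    have hseg : ∀ t ∈ Icc 0 p.1, ((t, p.2) : ℝ × ℝ) ∈ closure (Strp X Y) := fun t ht =>
      Strp_closure hX0 hY ht.1 (ht.2.trans hp.2.1.le) hp.2.2.1.le hp.2.2.2.le
    have hder : ∀ t ∈ interior (Icc 0 p.1), HasDerivAt (fun t => t^2 - a * ψ (t, p.2)) (2 * t - a * pd1 ψ (t, p.2)) t ∧ 0 ≤ 2 * t - a * pd1 ψ (t, p.2) := by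
      intro t ht
      rw [interior_Icc] at ht
      have hm : ((t, p.2) : ℝ × ℝ) ∈ Strp X Y := ⟨ht.1, ht.2.trans hp.2.1, hp.2.2.1, hp.2.2.2⟩
      constructor
      · refine ((hasDerivAt_pow 2 t).sub ((linF_dx (hC2.d0 _ hm)).const_mul a)).congr_deriv ?_
        simp
      · have := (hbx _ hm).2
        have ht1 := ht.1
        simp only at this
        nlinarith
    have hmono : MonotoneOn (fun t => t^2 - a * ψ (t, p.2)) (Icc 0 p.1) := monotoneOn_of_deriv_nonneg (convex_Icc _ _)
      ((continuousOn_pow 2).sub (continuousOn_const.mul (hcont.comp (by fun_prop) hseg)))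
      (fun t ht => (hder t ht).1.differentiableAt.differentiableWithinAt)
      (fun t ht => by rw [(hder t ht).1.deriv]; exact (hder t ht).2)
    have := hmono ⟨le_rfl, hp.1.le⟩ ⟨hp.1.le, le_rfl⟩ hp.1.le
    have h0 : ψ (0, p.2) = 0 := hbc1 _ (hcl (hseg 0 ⟨le_rfl, hp.1.le⟩)) rfl
    simp only [h0] at this
    simp only [Prod.mk.eta] at this
    linarith
  have hsub : {p : ℝ × ℝ | 0 ≤ p.1 ∧ p.1 < X ∧ 0 ≤ p.2 ∧ p.2 < Y} ⊆ closure (Strp X Y) := fun p hp =>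
    Strp_closure hX0 hY hp.1 hp.2.1.le hp.2.2.1 hp.2.2.2.le
  have hsp : SP X Y a b δ K O₁ O₂ O₃ O₄ O₅ ψ (pd1 ψ) (pd2 ψ) (pd1 (pd1 ψ)) (pd2 (pd1 ψ)) (pd2 (pd2 ψ)) := by
    have hlin : ∀ {O : ℝ × ℝ → ℝ}, ContDiffOn ℝ 1 O (Dset ε₀ f) → (∀ p ∈ Dset ε₀ f, |O p| ≤ N * p.1 ∧ ‖fderivWithin ℝ O (Dset ε₀ f) p‖ ≤ N) →
        (∀ p ∈ Strp X Y, |O p| ≤ K * p.1) ∧ ∀ p ∈ Strp X Y, ∀ q ∈ Strp X Y, |O p - O q| ≤ K * (|p.1 - q.1| + |p.2 - q.2|) := by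
      intro O hO hOb
      refine ⟨fun p hp => (hOb p (hSD hp)).1.trans (mul_le_mul_of_nonneg_right kN hp.1.le), fun p hp q hq => ?_⟩
      exact O_lip (m := X) hSD hO (fun z hz _ => (hOb z (hSD hz)).2.trans kN) hp hq hp.2.1.le hq.2.1.le
    refine ⟨hX0, hX1, hY, ha, hb, hδ, hδ1, k1, s1, s2, s3, hC2, hcont.mono hsub, fun p hp => hψpos p (hSQ hp), ?_, ?_, ?_, ?_, ?_, ?_, ?_,
      (hlin hO2s hO2b).1, (hlin hO3s hO3b).1, (hlin hO4s hO4b).1, (hlin hO5s hO5b).1, ?_,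
      (hlin hO2s hO2b).2, (hlin hO3s hO3b).2, (hlin hO4s hO4b).2, (hlin hO5s hO5b).2, fun p hp => heq p (hSQ hp)⟩
    · intro p p1 p2 p3 p4
      have hp := hsub (show p ∈ _ from ⟨p1, p2, p3, p4⟩)
      exact ⟨le_on_closure (fun z hz => (hψpos z (hSQ hz)).le) continuousOn_const hcont hp,
        le_on_closure (f := fun z => a * ψ z) (g := fun z : ℝ × ℝ => z.1^2) hub0 (continuousOn_const.mul hcont) (by fun_prop) hp⟩
    · exact fun p hp => (lip_part (hC2.d1 p hp) (hop.mem_nhds hp) (hL1.mono hSc)).1.trans kK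
    · exact fun p hp => (lip_part (hC2.d1 p hp) (hop.mem_nhds hp) (hL1.mono hSc)).2.trans kK
    · exact fun p hp => (lip_part (hC2.d2 p hp) (hop.mem_nhds hp) (hL2.mono hSc)).2.trans kK
    · intro p hp
      obtain ⟨x1, x2⟩ := hbx p hp
      refine ⟨abs_le.2 ⟨by nlinarith [hp.1], ?_⟩, x2⟩
      have hp1 := hp.1
      have : pd1 ψ p ≤ 2 / a * p.1 := by
        rw [div_mul_eq_mul_div, le_div_iff₀ ha]; nlinarith
      nlinarith
    · intro p hp
      have hp0 : ((p.1, 0) : ℝ × ℝ) ∈ closure (Qset ε₀ f) := hcl (Strp_closure hX0 hY hp.1.le hp.2.1.le le_rfl hY.le)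
      have := hL2.dist_le_mul p (hSc hp) _ hp0
      rw [hbc2 _ hp0 rfl, Real.dist_eq, sub_zero, Prod.dist_eq] at this
      simp only [dist_self, Real.dist_eq, sub_zero, abs_of_pos hp.2.2.1] at this
      rw [max_eq_right hp.2.2.1.le] at this
      exact this.trans (mul_le_mul_of_nonneg_right kK hp.2.2.1.le)
    · exact fun p hp => (hO1b p (hSD hp)).1.trans (mul_le_mul_of_nonneg_right kN (by positivity))
    · intro p hp q hq
      exact O_lip (m := max p.1 q.1) hSD hO1s (fun z hz hzm => (hO1b z (hSD hz)).2.trans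
        (mul_le_mul kN hzm hz.1.le k0.le)) hp hq (le_max_left _ _) (le_max_right _ _)
  have key : ∀ ε > 0, ∀ᶠ p in nhdsWithin ((0:ℝ), y) (Qset ε₀ f), |pd1 (pd1 ψ) p - 1 / a| ≤ ε ∧ |pd2 (pd1 ψ) p| ≤ ε ∧ |pd2 (pd2 ψ) p| ≤ ε := by
    intro ε hε
    obtain ⟨x0, hx0, H⟩ := hsp.final hY2 hY2Y hε
    have o1 : ∀ᶠ p : ℝ × ℝ in nhdsWithin ((0:ℝ), y) (Qset ε₀ f), p.1 < x0 :=
      nhdsWithin_le_nhds ((continuous_fst.tendsto ((0:ℝ), y)).eventually (gt_mem_nhds hx0))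
    have o2 : ∀ᶠ p : ℝ × ℝ in nhdsWithin ((0:ℝ), y) (Qset ε₀ f), p.2 < Y2 :=
      nhdsWithin_le_nhds ((continuous_snd.tendsto ((0:ℝ), y)).eventually (gt_mem_nhds hyY2))
    filter_upwards [o1, o2, self_mem_nhdsWithin] with p p1 p2 p3
    exact H p.1 p3.1 p1 p.2 p3.2.2.1 p2.le
  refine ⟨?_, ?_, ?_⟩ <;> rw [Metric.tendsto_nhds] <;> intro ε hε <;>
    filter_upwards [key (ε / 2) (half_pos hε)] with p hp <;> rw [Real.dist_eq]
  · linarith [hp.1]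
  · rw [sub_zero]; linarith [hp.2.1]
  · rw [sub_zero]; linarith [hp.2.2]
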